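/- There are exactly five orbits of the Mathieu group M_{24} on the 12-element subsets of a 24-element point set (the special, extraspecial, umbral, transverse and penumbral dodecads), and consequently exactly five Aut(Λ)-orbits of sublattices of the Leech lattice Λ isomorphic to D_{12}(2), of sizes 2^2·5·7·11·23·n_F, 2^4·3^2·5·7·11·23·n_F, 2^6·3^2·7·11·23·n_F, 2^8·3^2·7·23·n_F, and 2^4·7·23·n_F, where n_F = 8292375 is the number of frames of Λ. -/

import Mathlib

open Matrix Module

/-- An even unimodular positive definite lattice of rank `m`, presented by the Gram
matrix of a `ℤ`-basis.  The underlying `ℤ`-module is `Fin m → ℤ`. -/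
structure EvenUnimodularLattice (m : ℕ) where
  gram : Matrix (Fin m) (Fin m) ℤ
  symm : gram.IsSymm
  posdef : ∀ x : Fin m → ℤ, x ≠ 0 → 0 < x ⬝ᵥ gram.mulVec x
  even : ∀ x : Fin m → ℤ, 2 ∣ x ⬝ᵥ gram.mulVec x
  unimodular : gram.det = 1

namespace EvenUnimodularLattice

variable {m : ℕ} (Λ : EvenUnimodularLattice m)

/-- The bilinear form `(x, y)` of the lattice. -/
def inner (Λ : EvenUnimodularLattice m) (x y : Fin m → ℤ) : ℤ := x ⬝ᵥ Λ.gram.mulVec y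

/-- Reduction modulo `2Λ`, identifying `Λ/2Λ` with `(F₂)^m` via the chosen basis. -/
def red (_Λ : EvenUnimodularLattice m) (x : Fin m → ℤ) : Fin m → ZMod 2 := fun i => (x i : ZMod 2)

/-- A subspace `F ⊆ Λ/2Λ` is isotropic for the quadratic form
`q(x mod 2Λ) = (x,x)/2 mod 2`, i.e. `(x,x) ≡ 0 (mod 4)` for every lift `x` of an
element of `F`. -/
def Isotropic (F : Submodule (ZMod 2) (Fin m → ZMod 2)) : Prop :=
  ∀ x : Fin m → ℤ, Λ.red x ∈ F → (4 : ℤ) ∣ Λ.inner x x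

/-- A maximal isotropic subspace of `Λ/2Λ`. -/
def MaximalIsotropic (F : Submodule (ZMod 2) (Fin m → ZMod 2)) : Prop :=
  Λ.Isotropic F ∧ ∀ F', Λ.Isotropic F' → F ≤ F' → F' = F

end EvenUnimodularLattice

def IsLeech (Λ : EvenUnimodularLattice 24) : Prop :=
  ∀ v : Fin 24 → ℤ, Λ.inner v v ≠ 2

/-- A binary Golay code: a `[24,12,8]` binary linear code. -/
def IsGolayCode (C : Submodule (ZMod 2) (Fin 24 → ZMod 2)) : Prop :=
  Module.finrank (ZMod 2) C = 12 ∧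
  ∀ c ∈ C, c ≠ 0 → 8 ≤ (Finset.univ.filter fun i => c i ≠ 0).card

/-- Two subsets of the 24 points lie in the same `M₂₄`-orbit, `M₂₄` being the
automorphism group of the Golay code `C`. -/
def M24Equiv (C : Submodule (ZMod 2) (Fin 24 → ZMod 2)) (S S' : Finset (Fin 24)) :
    Prop :=
  ∃ g : Equiv.Perm (Fin 24), (∀ c ∈ C, (fun i => c (g i)) ∈ C) ∧ S.image g = S'

/-- The root lattice `D₁₂ = {x ∈ ℤ¹² : ∑ xᵢ even}`. -/
def D12 : Submodule ℤ (Fin 12 → ℤ) where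
  carrier := {x | (2 : ℤ) ∣ ∑ i, x i}
  add_mem' := by
    intro a b ha hb
    simpa [Finset.sum_add_distrib] using dvd_add ha hb
  zero_mem' := by simp
  smul_mem' := by
    intro c x hx
    simpa [Finset.mul_sum] using Dvd.dvd.mul_left hx c

/-- `N` is a sublattice of `Λ` isomorphic to `D₁₂(2)`. -/
def IsD12TwoSublattice (Λ : EvenUnimodularLattice 24)
    (N : Submodule ℤ (Fin 24 → ℤ)) : Prop :=
  ∃ φ : D12 →ₗ[ℤ] (Fin 24 → ℤ), Function.Injective φ ∧ LinearMap.range φ = N ∧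
    ∀ x y : D12, Λ.inner (φ x) (φ y) = 2 * ((x : Fin 12 → ℤ) ⬝ᵥ (y : Fin 12 → ℤ))

/-- Two sublattices of `Λ` lie in the same `Aut(Λ)`-orbit. -/
def AutEquiv (Λ : EvenUnimodularLattice 24) (N N' : Submodule ℤ (Fin 24 → ℤ)) : Prop :=
  ∃ U : Matrix (Fin 24) (Fin 24) ℤ, Uᵀ * Λ.gram * U = Λ.gram ∧
    Submodule.map (Matrix.mulVecLin U) N = N'

section
namespace FiveOrbits
open MeasureTheory UnitAddTorus
open scoped Real

section Poisson

variable {ι : Type*} [Fintype ι]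

/-- The half open unit cube. -/
def cube (ι : Type*) (a : ι → ℝ) : Set (ι → ℝ) := {x | ∀ i, x i ∈ Set.Ioc (a i) (a i + 1)}

lemma measurableSet_cube (a : ι → ℝ) : MeasurableSet (cube ι a) :=
  MeasurableSet.univ_pi' (fun _ => measurableSet_Ioc)

lemma integral_eq_tsum_cube (f : (ι → ℝ) → ℂ) (hf : Integrable f) :
    HasSum (fun v : ι → ℤ => ∫ x in cube ι 0, f (x + fun i => (v i : ℝ))) (∫ x, f x) := by
  have h1 : (⋃ v : ι → ℤ, cube ι (fun i => (v i : ℝ))) = Set.univ := by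
    ext x
    simp only [Set.mem_iUnion, Set.mem_univ, iff_true]
    refine ⟨fun i => ⌈x i⌉ - 1, fun i => ?_⟩
    have h1 := Int.ceil_lt_add_one (x i)
    have h2 := Int.le_ceil (x i)
    constructor <;> push_cast <;> linarith
  have h2 : Pairwise (Function.onFun Disjoint fun v : ι → ℤ => cube ι (fun i => (v i : ℝ))) := by
    intro v w hvw
    rw [Function.onFun, Set.disjoint_left]
    intro x hx hy
    apply hvw
    ext i
    have h1 := hx i
    have h2 := hy i
    have a1 : (v i : ℝ) < w i + 1 := by linarith [h1.1, h2.2]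
    have a2 : (w i : ℝ) < v i + 1 := by linarith [h2.1, h1.2]
    have a3 : v i < w i + 1 := by exact_mod_cast a1
    have a4 : w i < v i + 1 := by exact_mod_cast a2
    omega
  have h3 := hasSum_integral_iUnion (μ := volume) (f := f)
    (fun v : ι → ℤ => measurableSet_cube (fun i => (v i : ℝ))) h2 hf.integrableOn
  rw [h1, setIntegral_univ] at h3
  convert! h3 using 1
  funext v
  have : cube ι 0 = (fun x => x + fun i => (v i : ℝ)) ⁻¹' cube ι (fun i => (v i : ℝ)) := by
    ext x
    simp only [cube, Set.mem_ofPred_eq, Set.mem_preimage, Pi.zero_apply, Pi.add_apply, Set.mem_Ioc]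
    refine forall_congr' fun i => ?_
    constructor <;> rintro ⟨a, b⟩ <;> constructor <;> linarith
  rw [this]
  exact (measurePreserving_add_right volume (fun i => (v i : ℝ))).setIntegral_preimage_emb
    (MeasurableEquiv.addRight _).measurableEmbedding f _

lemma isOpenQuotientMap_mk :
    IsOpenQuotientMap (fun (x : ι → ℝ) (i : ι) => (x i : UnitAddCircle)) :=
  IsOpenQuotientMap.piMap (fun _ => QuotientAddGroup.isOpenQuotientMap_mk)

theorem poisson_pi (f : C(ι → ℝ, ℂ)) (hfi : Integrable f) (u : (ι → ℤ) → ℝ) (hu : Summable u)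
    (hb : ∀ (v : ι → ℤ) (x : ι → ℝ), (∀ i, x i ∈ Set.Icc (0 : ℝ) 1) →
      ‖f (x + fun i => (v i : ℝ))‖ ≤ u v)
    (hF : Summable fun n : ι → ℤ =>
      ∫ x : ι → ℝ, mFourier (-n) (fun i => (x i : UnitAddCircle)) * f x) :
    HasSum (fun n : ι → ℤ => ∫ x : ι → ℝ, mFourier (-n) (fun i => (x i : UnitAddCircle)) * f x)
      (∑' v : ι → ℤ, f (fun i => (v i : ℝ))) := by
  classical
  set q : (ι → ℝ) → UnitAddTorus ι := fun x i => (x i : UnitAddCircle) with hq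
  let F0 : (ι → ℝ) → ℂ := fun x => ∑' v : ι → ℤ, f (x + fun i => (v i : ℝ))
  have hper : ∀ x (w : ι → ℤ), F0 (x + fun i => (w i : ℝ)) = F0 x := by
    intro x w
    show (∑' v : ι → ℤ, f (x + (fun i => (w i : ℝ)) + fun i => (v i : ℝ))) =
      ∑' v : ι → ℤ, f (x + fun i => (v i : ℝ))
    rw [← (Equiv.addRight w).tsum_eq (fun v : ι → ℤ => f (x + fun i => (v i : ℝ)))]
    refine tsum_congr fun v => congrArg f ?_
    ext i
    simp
    ring
  have hq_eq : ∀ x y, q x = q y → F0 x = F0 y := by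
    intro x y hxy
    have : ∀ i, ∃ n : ℤ, (n : ℝ) = x i - y i := by
      intro i
      have := congrFun hxy i
      simp only [hq] at this
      rw [← sub_eq_zero, ← AddCircle.coe_sub, AddCircle.coe_eq_zero_iff] at this
      obtain ⟨n, hn⟩ := this
      exact ⟨n, by simpa using hn⟩
    choose n hn using this
    rw [← hper y n]
    congr 1
    ext i
    simp [hn]
  have hcontcube : ContinuousOn F0 {x | ∀ i, x i ∈ Set.Icc (0 : ℝ) 1} := by
    refine continuousOn_tsum (fun v => ?_) hu (fun v x hx => hb v x hx)
    exact (f.continuous.comp (by fun_prop)).continuousOn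
  -- general point bound by translation
  let F1 : UnitAddTorus ι → ℂ := fun t => F0 (Function.surjInv isOpenQuotientMap_mk.surjective t)
  have hF1 : ∀ x, F1 (q x) = F0 x := fun x =>
    hq_eq _ _ (Function.surjInv_eq isOpenQuotientMap_mk.surjective (q x))
  have hcont : Continuous F1 := by
    -- closed-map argument on the compact cube
    have hK : IsCompact {x : ι → ℝ | ∀ i, x i ∈ Set.Icc (0 : ℝ) 1} := by
      have := isCompact_univ_pi (s := fun _ : ι => Set.Icc (0 : ℝ) 1) (fun _ => isCompact_Icc)
      convert this using 1
      ext x; simp only [Set.mem_ofPred_eq, Set.mem_univ_pi]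
    have : CompactSpace {x : ι → ℝ | ∀ i, x i ∈ Set.Icc (0 : ℝ) 1} := isCompact_iff_compactSpace.mp hK
    let r : {x : ι → ℝ | ∀ i, x i ∈ Set.Icc (0 : ℝ) 1} → UnitAddTorus ι := fun x => q x
    have hrc : Continuous r := isOpenQuotientMap_mk.continuous.comp continuous_subtype_val
    have hrs : Function.Surjective r := by
      intro t
      obtain ⟨x, rfl⟩ := isOpenQuotientMap_mk.surjective t
      refine ⟨⟨fun i => Int.fract (x i), fun i => ⟨Int.fract_nonneg _, (Int.fract_lt_one _).le⟩⟩, ?_⟩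
      ext i
      simp only [r, hq]
      rw [← sub_eq_zero, ← AddCircle.coe_sub, AddCircle.coe_eq_zero_iff]
      exact ⟨-⌊x i⌋, by have := Int.self_sub_fract (x i); simp⟩
    have hquot : Topology.IsQuotientMap r :=
      (hrc.isClosedMap).isQuotientMap hrc hrs
    rw [hquot.continuous_iff]
    have : F1 ∘ r = fun x => F0 x.1 := by
      ext x; exact hF1 x
    rw [this]
    exact continuousOn_iff_continuous_domRestrict.mp hcontcube
  let F : C(UnitAddTorus ι, ℂ) := ⟨F1, hcont⟩
  have hmq : ∀ n : ι → ℤ, Continuous fun x => mFourier (-n) (q x) := fun n =>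
    (mFourier (-n)).continuous.comp isOpenQuotientMap_mk.continuous
  have hmper : ∀ (n : ι → ℤ) x (w : ι → ℤ), mFourier (-n) (q (x + fun i => (w i : ℝ))) =
      mFourier (-n) (q x) := by
    intro n x w
    congr 1
    ext i
    simp only [hq]
    rw [← sub_eq_zero, ← AddCircle.coe_sub, AddCircle.coe_eq_zero_iff]
    exact ⟨w i, by simp⟩
  have hnorm : ∀ (n : ι → ℤ) t, ‖mFourier (-n) t‖ = 1 := by
    intro n t
    simp [mFourier, norm_prod, Circle.norm_coe]
  have hcoeff : ∀ n, mFourierCoeff F n = ∫ x : ι → ℝ, mFourier (-n) (q x) * f x := by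
    intro n
    rw [mFourierCoeff_eq_integral _ _ (0 : ι → ℝ)]
    have hintg : Integrable (fun x : ι → ℝ => mFourier (-n) (q x) * f x) := by
      refine hfi.bdd_mul (c := 1) (hmq n).aestronglyMeasurable ?_
      exact Filter.Eventually.of_forall fun x => (hnorm n _).le
    have h1 := integral_eq_tsum_cube _ hintg
    rw [← h1.tsum_eq]
    simp_rw [hmper]
    have hvol : volume (cube ι (0 : ι → ℝ)) = 1 := by
      have : cube ι (0 : ι → ℝ) = Set.univ.pi (fun _ => Set.Ioc (0 : ℝ) 1) := by
        ext x; simp [cube]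
      rw [this, Real.volume_pi_Ioc]
      simp
    have hcubem := measurableSet_cube (0 : ι → ℝ)
    have hbd : ∀ v : ι → ℤ, ∀ x ∈ cube ι 0, ‖mFourier (-n) (q x) * f (x + fun i => (v i : ℝ))‖ ≤ u v := by
      intro v x hx
      rw [norm_mul, hnorm, one_mul]
      refine hb v x fun i => ?_
      have := hx i
      simp only [Pi.zero_apply, zero_add] at this
      exact ⟨this.1.le, this.2⟩
    have hi : ∀ v : ι → ℤ, IntegrableOn (fun x => mFourier (-n) (q x) * f (x + fun i => (v i : ℝ)))
        (cube ι 0) := by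
      intro v
      refine Measure.integrableOn_of_bounded (M := u v) (by simp [hvol]) ?_ ?_
      · exact ((hmq n).mul (f.continuous.comp (by fun_prop))).aestronglyMeasurable
      · exact (ae_restrict_iff' hcubem).mpr (Filter.Eventually.of_forall (hbd v))
    have h2 := hasSum_integral_of_summable_integral_norm (μ := volume.restrict (cube ι 0)) hi ?_
    · rw [h2.tsum_eq]
      refine setIntegral_congr_fun hcubem fun x _ => ?_
      show mFourier (-n) (q x) * F1 (q x) = _
      rw [hF1, ← tsum_mul_left]
    · refine Summable.of_nonneg_of_le (fun v => integral_nonneg fun x => norm_nonneg _) (fun v => ?_) hu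
      have := setIntegral_mono_on (hi v).norm (integrableOn_const (μ := volume) (s := cube ι 0)
        (C := u v) (by simp [hvol])) hcubem (hbd v)
      refine this.trans ?_
      simp [Measure.real, hvol]
  have hs : Summable (mFourierCoeff F) := by
    refine hF.congr fun n => ?_
    rw [hcoeff]
  have := hasSum_mFourier_series_apply_of_summable hs (q 0)
  have h0 : F (q 0) = ∑' v : ι → ℤ, f (fun i => (v i : ℝ)) := by
    show F1 (q 0) = _
    rw [hF1]
    simp [F0]
  rw [h0] at this
  convert this using 1
  funext n
  rw [hcoeff]
  have : mFourier n (q 0) = 1 := by simp [mFourier, hq]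
  rw [this]; simp [hq]

end Poisson
end FiveOrbits
end

section
open MeasureTheory UnitAddTorus Matrix
open scoped Real

namespace FiveOrbits

lemma summable_prod_pi {ι : Type*} [Fintype ι] [DecidableEq ι] (f : ℤ → ℝ) (hf : Summable f)
    (h0 : ∀ n, 0 ≤ f n) : Summable fun v : ι → ℤ => ∏ i, f (v i) := by
  classical
  refine summable_of_sum_le (c := (∑' n, f n) ^ Fintype.card ι)
    (fun v => Finset.prod_nonneg fun i _ => h0 _) fun s => ?_
  have hs : s ⊆ Fintype.piFinset fun i : ι => s.image fun v => v i := by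
    intro v hv
    rw [Fintype.mem_piFinset]
    exact fun i => Finset.mem_image_of_mem (fun v : ι → ℤ => v i) hv
  refine (Finset.sum_le_sum_of_subset_of_nonneg hs
    fun v _ _ => Finset.prod_nonneg fun i _ => h0 _).trans ?_
  rw [← Finset.prod_univ_sum (fun i : ι => s.image fun v => v i) (fun _ n => f n)]
  calc _ ≤ ∏ i : ι, ∑' n, f n := Finset.prod_le_prod
        (fun i _ => Finset.sum_nonneg fun _ _ => h0 _)
        (fun i _ => hf.sum_le_tsum _ fun _ _ => h0 _)
    _ = _ := by simp

lemma summable_exp_sq (a : ℝ) (ha : 0 < a) (b : ℝ) :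
    Summable fun n : ℤ => Real.exp (-a * (n : ℝ) ^ 2 + b) := by
  simp_rw [Real.exp_add]
  refine Summable.mul_right _ ?_
  have hs : Summable fun n : ℤ => Real.exp (-a) ^ n.natAbs := by
    apply Summable.of_nat_of_neg
    · simpa using summable_geometric_of_lt_one (Real.exp_pos (-a)).le (by simpa using ha)
    · simpa using summable_geometric_of_lt_one (Real.exp_pos (-a)).le (by simpa using ha)
  refine Summable.of_nonneg_of_le (fun _ => (Real.exp_pos _).le) (fun n => ?_) hs
  rw [← Real.exp_nat_mul]
  apply Real.exp_le_exp.mpr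
  have h1 : ((n.natAbs : ℕ) : ℝ) ≤ (n : ℝ) ^ 2 := by
    have : ((n.natAbs : ℕ) : ℤ) ≤ n ^ 2 := by
      rw [← Int.natAbs_sq]
      norm_cast
      nlinarith [Nat.zero_le n.natAbs, sq_nonneg (n.natAbs), Nat.le_self_pow (two_ne_zero) n.natAbs]
    have h2 : (((n.natAbs : ℕ) : ℤ) : ℝ) ≤ ((n ^ 2 : ℤ) : ℝ) := Int.cast_le.mpr this
    simpa [Nat.cast_natAbs] using h2
  nlinarith

variable (Λ : EvenUnimodularLattice 24)

/-- The real Gram matrix. -/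
noncomputable def gramR : Matrix (Fin 24) (Fin 24) ℝ := Λ.gram.map (fun z : ℤ => (z : ℝ))

lemma gramR_form (v w : Fin 24 → ℤ) : (fun i => (v i : ℝ)) ⬝ᵥ (gramR Λ) *ᵥ (fun i => (w i : ℝ))
    = (Λ.inner v w : ℤ) := by
  simp [EvenUnimodularLattice.inner, dotProduct, mulVec, gramR]

lemma gramR_det : (gramR Λ).det = 1 := by
  have := Λ.unimodular
  have h2 : (gramR Λ) = (Int.castRingHom ℝ).mapMatrix Λ.gram := by
    ext; simp [gramR]
  rw [h2, ← RingHom.map_det, this]; simp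

lemma gramR_nonneg (x : Fin 24 → ℝ) : 0 ≤ x ⬝ᵥ (gramR Λ) *ᵥ x := by
  have hcont : Continuous fun x : Fin 24 → ℝ => x ⬝ᵥ (gramR Λ) *ᵥ x := by fun_prop
  have hlim : Filter.Tendsto (fun n : ℕ => (fun i => (⌊(n : ℝ) * x i⌋ : ℝ) / n : Fin 24 → ℝ))
      Filter.atTop (nhds x) := by
    rw [tendsto_pi_nhds]
    intro i
    have h0 : Filter.Tendsto (fun n : ℕ => (n : ℝ)⁻¹) Filter.atTop (nhds 0) :=
      tendsto_inv_atTop_nhds_zero_nat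
    have h2 : Filter.Tendsto (fun n : ℕ => x i - (n : ℝ)⁻¹) Filter.atTop (nhds (x i)) := by
      simpa using tendsto_const_nhds.sub h0
    refine tendsto_of_tendsto_of_tendsto_of_le_of_le' h2 tendsto_const_nhds ?_ ?_
    · filter_upwards [Filter.eventually_gt_atTop 0] with n hn
      have hn' : (0 : ℝ) < n := by exact_mod_cast hn
      rw [le_div_iff₀ hn', sub_mul, inv_mul_cancel₀ hn'.ne']
      nlinarith [Int.lt_floor_add_one ((n : ℝ) * x i)]
    · filter_upwards [Filter.eventually_gt_atTop 0] with n hn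
      have hn' : (0 : ℝ) < n := by exact_mod_cast hn
      rw [div_le_iff₀ hn']
      nlinarith [Int.floor_le ((n : ℝ) * x i)]
  refine ge_of_tendsto' ((hcont.tendsto x).comp hlim) fun n => ?_
  simp only [Function.comp_def]
  have h1 : (fun i => (⌊(n : ℝ) * x i⌋ : ℝ) / n : Fin 24 → ℝ) =
      (n : ℝ)⁻¹ • fun i => ((⌊(n : ℝ) * x i⌋ : ℤ) : ℝ) := by
    ext i; simp [div_eq_inv_mul]
  rw [h1, mulVec_smul, dotProduct_smul, smul_dotProduct, gramR_form Λ (fun i => ⌊(n : ℝ) * x i⌋)]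
  have : 0 ≤ Λ.inner (fun i => ⌊(n : ℝ) * x i⌋) (fun i => ⌊(n : ℝ) * x i⌋) := by
    by_cases h : (fun i => ⌊(n : ℝ) * x i⌋) = 0
    · rw [h]; simp [EvenUnimodularLattice.inner]
    · exact (Λ.posdef _ h).le
  have : (0:ℝ) ≤ (Λ.inner (fun i => ⌊(n : ℝ) * x i⌋) (fun i => ⌊(n : ℝ) * x i⌋) : ℤ) := by
    exact_mod_cast this
  simp only [smul_eq_mul]
  positivity

open scoped MatrixOrder in
lemma exists_sqrt : ∃ B : Matrix (Fin 24) (Fin 24) ℝ, gramR Λ = Bᵀ * B ∧ |B.det| = 1 := by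
  have hps : (gramR Λ).PosSemidef := by
    refine Matrix.PosSemidef.of_dotProduct_mulVec_nonneg ?_ fun x => by simpa using gramR_nonneg Λ x
    have := Λ.symm
    ext i j
    have h := congrFun (congrFun this i) j
    simp only [transpose_apply] at h
    simp [gramR, h]
  obtain ⟨B, hB⟩ := (CStarAlgebra.nonneg_iff_eq_star_mul_self (a := gramR Λ)).mp
    (Matrix.nonneg_iff_posSemidef.mpr hps)
  refine ⟨B, ?_, ?_⟩
  · rw [hB, Matrix.star_eq_conjTranspose, conjTranspose_eq_transpose_of_trivial]
  · have h := gramR_det Λ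
    rw [hB, Matrix.star_eq_conjTranspose, conjTranspose_eq_transpose_of_trivial, det_mul,
      det_transpose] at h
    rcases mul_self_eq_one_iff.mp h with h | h <;> simp [h]

lemma exists_bound : ∃ c : ℝ, 0 < c ∧ ∀ x : Fin 24 → ℝ, c * ∑ i, x i ^ 2 ≤ x ⬝ᵥ (gramR Λ) *ᵥ x := by
  obtain ⟨B, hB, hd⟩ := exists_sqrt Λ
  have hu : IsUnit B.det := by
    rw [isUnit_iff_ne_zero]; intro h; simp [h] at hd
  set K : ℝ := ∑ i, ∑ j, (B⁻¹ i j) ^ 2 with hK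
  have hK0 : 0 ≤ K := Finset.sum_nonneg fun i _ => Finset.sum_nonneg fun j _ => sq_nonneg _
  refine ⟨1 / (K + 1), by positivity, fun x => ?_⟩
  have hq : x ⬝ᵥ (gramR Λ) *ᵥ x = ∑ j, (B *ᵥ x) j ^ 2 := by
    rw [hB, ← mulVec_mulVec, dotProduct_mulVec, vecMul_transpose]
    simp [dotProduct, sq]
  rw [hq, one_div, inv_mul_le_iff₀ (by positivity)]
  have hx : x = B⁻¹ *ᵥ (B *ᵥ x) := by rw [mulVec_mulVec, nonsing_inv_mul _ hu, one_mulVec]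
  set y := B *ᵥ x
  have h1 : ∀ i, x i ^ 2 ≤ (∑ j, (B⁻¹ i j) ^ 2) * ∑ j, y j ^ 2 := by
    intro i
    rw [hx]
    exact Finset.sum_mul_sq_le_sq_mul_sq Finset.univ (fun j => B⁻¹ i j) y
  calc _ ≤ ∑ i, (∑ j, (B⁻¹ i j) ^ 2) * ∑ j, y j ^ 2 := Finset.sum_le_sum fun i _ => h1 i
    _ = K * ∑ j, y j ^ 2 := by rw [← Finset.sum_mul]
    _ ≤ _ := by
      have : 0 ≤ ∑ j, y j ^ 2 := Finset.sum_nonneg fun _ _ => sq_nonneg _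
      nlinarith

end FiveOrbits
end

section
open MeasureTheory UnitAddTorus Matrix Complex
open scoped Real

namespace FiveOrbits

variable (Λ : EvenUnimodularLattice 24)

/-- The theta series. -/
noncomputable def theta (τ : ℂ) : ℂ := ∑' v : Fin 24 → ℤ, cexp (π * I * τ * (Λ.inner v v : ℤ))

/-- bounding summand -/
noncomputable def bnd (a b : ℝ) (v : Fin 24 → ℤ) : ℝ := ∏ i, Real.exp (-a * (v i : ℝ) ^ 2 + b)

lemma summable_bnd (a b : ℝ) (ha : 0 < a) : Summable (bnd a b) := by
  have h := summable_prod_pi (ι := Fin 24) _ (summable_exp_sq a ha b) fun _ => (Real.exp_pos _).le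
  refine h.congr fun v => ?_
  rw [bnd]

lemma norm_cexp_form (τ : ℂ) (r : ℝ) : ‖cexp (π * I * τ * r)‖ = Real.exp (-(π * τ.im * r)) := by
  rw [Complex.norm_exp]
  congr 1
  simp [mul_assoc]

lemma exists_theta_bound : ∃ c : ℝ, 0 < c ∧ ∀ τ : ℂ, 0 ≤ τ.im → ∀ v : Fin 24 → ℤ,
    ‖cexp (π * I * τ * (Λ.inner v v : ℤ))‖ ≤ bnd (π * τ.im * c) 0 v := by
  obtain ⟨c, hc, h⟩ := exists_bound Λ
  refine ⟨c, hc, fun τ hτ v => ?_⟩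
  have h1 := h (fun i => (v i : ℝ))
  rw [gramR_form] at h1
  have h2 := norm_cexp_form τ (Λ.inner v v : ℤ)
  rw [Complex.ofReal_intCast] at h2
  rw [h2, bnd, ← Real.exp_sum]
  apply Real.exp_le_exp.mpr
  simp only [add_zero]
  rw [← Finset.mul_sum]
  have : 0 ≤ π * τ.im := by positivity
  nlinarith

lemma summable_theta (τ : ℂ) (hτ : 0 < τ.im) :
    Summable fun v : Fin 24 → ℤ => cexp (π * I * τ * (Λ.inner v v : ℤ)) := by
  obtain ⟨c, hc, h⟩ := exists_theta_bound Λ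
  exact Summable.of_norm_bounded (summable_bnd (π * τ.im * c) 0 (by positivity)) (h τ hτ.le)

lemma differentiableOn_theta : DifferentiableOn ℂ (theta Λ) {τ | 0 < τ.im} := by
  obtain ⟨c, hc, h⟩ := exists_theta_bound Λ
  intro τ hτ
  have hτ' : 0 < τ.im := hτ
  have hop : IsOpen {z : ℂ | τ.im / 2 < z.im} := isOpen_lt continuous_const Complex.continuous_im
  have hd : DifferentiableOn ℂ (theta Λ) {z : ℂ | τ.im / 2 < z.im} := by
    refine differentiableOn_tsum_of_summable_norm
      (summable_bnd (π * (τ.im / 2) * c) 0 (by positivity)) (fun v => ?_) hop fun v z hz => ?_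
    · fun_prop
    · have hz' : τ.im / 2 < z.im := hz
      refine (h z (by linarith) v).trans ?_
      refine Finset.prod_le_prod (fun _ _ => (Real.exp_pos _).le) fun i _ => ?_
      apply Real.exp_le_exp.mpr
      have : 0 ≤ π * c * (v i : ℝ) ^ 2 := by positivity
      nlinarith
  exact ((hd τ (by show τ.im / 2 < τ.im; linarith)).differentiableAt (hop.mem_nhds (by
    show τ.im / 2 < τ.im; linarith))).differentiableWithinAt

/-- multiplication by the Gram matrix as an equivalence -/
noncomputable def gramEquiv : (Fin 24 → ℤ) ≃ (Fin 24 → ℤ) where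
  toFun m := Λ.gram *ᵥ m
  invFun m := Λ.gram⁻¹ *ᵥ m
  left_inv m := by
    simp only [mulVec_mulVec]
    rw [nonsing_inv_mul _ (by rw [Λ.unimodular]; exact isUnit_one), one_mulVec]
  right_inv m := by
    simp only [mulVec_mulVec]
    rw [mul_nonsing_inv _ (by rw [Λ.unimodular]; exact isUnit_one), one_mulVec]

lemma mFourier_eq (n : Fin 24 → ℤ) (x : Fin 24 → ℝ) :
    mFourier n (fun i => (x i : UnitAddCircle)) = cexp (2 * π * I * ∑ i, (n i : ℂ) * x i) := by
  rw [Finset.mul_sum, Complex.exp_sum]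
  simp only [mFourier, ContinuousMap.coe_mk, fourier_coe_apply]
  refine Finset.prod_congr rfl fun i _ => ?_
  congr 1
  simp
  ring

lemma theta_S (τ : ℂ) (hτ : 0 < τ.im) : theta Λ (-1 / τ) = τ ^ 12 * theta Λ τ := by
  have hτ0 : τ ≠ 0 := by rintro rfl; simp at hτ
  obtain ⟨B, hB, hd⟩ := exists_sqrt Λ
  obtain ⟨c, hc, hbd⟩ := exists_bound Λ
  set b : ℂ := -(π * I * τ) with hb
  have hbre : 0 < b.re := by simp [hb]; positivity
  have hmap : Measure.map (toLin' B) (volume : Measure (Fin 24 → ℝ)) = volume := by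
    have hd0 : B.det ≠ 0 := by intro h; simp [h] at hd
    rw [Real.map_matrix_volume_pi_eq_smul_volume_pi hd0, abs_inv, hd]
    simp
  have hcontB : Continuous (toLin' B) := LinearMap.continuous_on_pi _
  have hmp : MeasurePreserving (toLin' B) (volume : Measure (Fin 24 → ℝ)) volume :=
    ⟨hcontB.measurable, hmap⟩
  set f : C(Fin 24 → ℝ, ℂ) := ⟨fun x => cexp (π * I * τ * (x ⬝ᵥ (gramR Λ) *ᵥ x : ℝ)), by fun_prop⟩
    with hf
  have hqf : ∀ x : Fin 24 → ℝ, x ⬝ᵥ (gramR Λ) *ᵥ x = ∑ j, (toLin' B x) j ^ 2 := by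
    intro x
    rw [hB, ← mulVec_mulVec, dotProduct_mulVec, vecMul_transpose]
    simp [dotProduct, sq]
  -- the functions
  set g : (Fin 24 → ℤ) → (Fin 24 → ℝ) → ℂ := fun m y => cexp (-b * ∑ i, (y i : ℂ) ^ 2 +
    ∑ i, (-(2 * π * I * ((toLin' B (fun i => (m i : ℝ))) i : ℝ))) * y i) with hg
  have hfg : ∀ m x, mFourier (-(gramEquiv Λ m)) (fun i => (x i : UnitAddCircle)) * f x =
      g m (toLin' B x) := by
    intro m x
    rw [mFourier_eq]
    simp only [hf, hg, ContinuousMap.coe_mk]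
    rw [← Complex.exp_add, hqf]
    congr 1
    have h1 : ∑ i, (((-(gramEquiv Λ m)) i : ℤ) : ℂ) * x i =
        -∑ i, (((toLin' B (fun i => (m i : ℝ))) i : ℝ) : ℂ) * ((toLin' B x) i : ℝ) := by
      have h2 : ∑ i, ((gramEquiv Λ m) i : ℝ) * x i =
        ∑ i, (toLin' B (fun i => (m i : ℝ))) i * (toLin' B x) i := by
        have h3 : (fun i => ((gramEquiv Λ m) i : ℝ)) = gramR Λ *ᵥ (fun i => (m i : ℝ)) := by
          ext i; simp [gramEquiv, gramR, mulVec, dotProduct]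
        have h4 : ∑ i, ((gramEquiv Λ m) i : ℝ) * x i = (gramR Λ *ᵥ (fun i => (m i : ℝ))) ⬝ᵥ x := by
          rw [← h3]; rfl
        rw [h4, hB, ← mulVec_mulVec, mulVec_transpose, ← dotProduct_mulVec]
        rfl
      have h5 := congrArg (fun r : ℝ => (r : ℂ)) h2
      push_cast at h5
      simp only [Pi.neg_apply, Int.cast_neg, neg_mul, Finset.sum_neg_distrib]
      rw [h5]
    rw [h1, hb]
    push_cast
    simp only [neg_mul, Finset.sum_neg_distrib, mul_assoc, ← Finset.mul_sum]
    ring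
  have hgc : ∀ m, Continuous (g m) := by intro m; simp only [hg]; fun_prop
  have hfi : Integrable f := by
    have h1 : Integrable (g 0) :=
      GaussianFourier.integrable_cexp_neg_mul_sum_add hbre _
    have h2 := hmp.integrable_comp_of_integrable h1
    convert! h2 using 1
    funext x
    have h3 := hfg 0 x
    have h4 : gramEquiv Λ 0 = 0 := by simp [gramEquiv]
    rw [h4] at h3
    have h5 : mFourier (-(0 : Fin 24 → ℤ)) (fun i => (x i : UnitAddCircle)) = 1 := by
      rw [mFourier_eq]; simp
    rw [h5, one_mul] at h3
    exact h3
  have hintg : ∀ m, ∫ x : Fin 24 → ℝ, mFourier (-(gramEquiv Λ m)) (fun i => (x i : UnitAddCircle)) * f x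
      = (τ ^ 12)⁻¹ * cexp (π * I * (-1 / τ) * (Λ.inner m m : ℤ)) := by
    intro m
    simp_rw [hfg]
    have h1 := integral_map (μ := (volume : Measure (Fin 24 → ℝ))) hcontB.measurable.aemeasurable
      ((hgc m).aestronglyMeasurable)
    rw [← h1, hmap]
    simp only [hg]
    rw [GaussianFourier.integral_cexp_neg_mul_sum_add hbre]
    congr 1
    · have e1 : ((Fintype.card (Fin 24) : ℂ) / 2) = ((12 : ℕ) : ℂ) := by norm_num
      rw [e1, Complex.cpow_natCast, hb]
      have e2 : (π : ℂ) / -(π * I * τ) = I * τ⁻¹ := by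
        have : (π : ℂ) ≠ 0 := by exact_mod_cast Real.pi_ne_zero
        field_simp
        linear_combination -I_sq
      rw [e2, mul_pow, inv_pow]
      have : I ^ 12 = 1 := by rw [show 12 = 4 * 3 by norm_num, pow_mul, I_pow_four, one_pow]
      rw [this, one_mul]
    · congr 1
      have h6 : (Λ.inner m m : ℂ) = ∑ i, (((toLin' B (fun i => (m i : ℝ))) i : ℝ) : ℂ) ^ 2 := by
        have h7 := gramR_form Λ m m
        rw [hqf] at h7
        have h8 := congrArg (fun r : ℝ => (r : ℂ)) h7
        push_cast at h8
        exact h8.symm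
      rw [h6, hb]
      simp only [neg_sq, mul_pow, ← Finset.mul_sum, I_sq]
      have : (π : ℂ) ≠ 0 := by exact_mod_cast Real.pi_ne_zero
      field_simp
      linear_combination (4 * ∑ i, (((toLin' B (fun i => (m i : ℝ))) i : ℝ) : ℂ) ^ 2) * I_sq
  have him : 0 < (-1 / τ).im := by
    rw [neg_div, one_div, neg_im, inv_im, neg_div, neg_neg]
    exact div_pos hτ (normSq_pos.mpr hτ0)
  have hsum := (summable_theta Λ (-1 / τ) him).mul_left ((τ ^ 12)⁻¹)
  have hF : Summable fun n : Fin 24 → ℤ =>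
      ∫ x, mFourier (-n) (fun i => (x i : UnitAddCircle)) * f x := by
    rw [← (gramEquiv Λ).summable_iff]
    convert! hsum using 1
    funext m
    exact hintg m
  have key := poisson_pi f hfi (bnd (π * τ.im * c / 2) (π * τ.im * c))
    (summable_bnd _ _ (by positivity)) (fun v x hx => ?_) hF
  · rw [← (gramEquiv Λ).hasSum_iff] at key
    have key2 : HasSum (fun m => (τ ^ 12)⁻¹ * cexp (π * I * (-1 / τ) * (Λ.inner m m : ℤ)))
        (theta Λ τ) := by
      convert! key using 1
      · funext m
        exact (hintg m).symm
      · refine tsum_congr fun v => ?_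
        simp only [hf, ContinuousMap.coe_mk]
        rw [gramR_form]
        simp
    have h9 := key2.unique ((summable_theta Λ (-1 / τ) him).hasSum.mul_left ((τ ^ 12)⁻¹))
    rw [h9]
    rw [mul_inv_cancel_left₀ (pow_ne_zero _ hτ0)]
    rfl
  · simp only [hf, ContinuousMap.coe_mk]
    rw [norm_cexp_form, bnd, ← Real.exp_sum]
    apply Real.exp_le_exp.mpr
    have h1 := hbd (x + fun i => (v i : ℝ))
    have h2 : ∑ i, ((v i : ℝ) ^ 2 / 2 - 1) ≤ ∑ i, (x + fun i => (v i : ℝ)) i ^ 2 := by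
      refine Finset.sum_le_sum fun i _ => ?_
      simp only [Pi.add_apply]
      have := hx i
      nlinarith [sq_nonneg (2 * x i + v i), this.1, this.2]
    have h3 : ∑ i : Fin 24, (-(π * τ.im * c / 2) * (v i : ℝ) ^ 2 + π * τ.im * c) =
      -(π * τ.im * (c * ∑ i, ((v i : ℝ) ^ 2 / 2 - 1))) := by
      rw [Finset.mul_sum, Finset.mul_sum, ← Finset.sum_neg_distrib]
      exact Finset.sum_congr rfl fun i _ => by ring
    rw [h3]
    have : 0 ≤ π * τ.im := by positivity
    apply neg_le_neg
    apply mul_le_mul_of_nonneg_left _ this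
    exact (mul_le_mul_of_nonneg_left h2 hc.le).trans h1

end FiveOrbits
end

section
open Matrix
open Complex hiding I
open UpperHalfPlane hiding I
open ModularForm ModularFormClass MatrixGroups
open scoped Real

namespace FiveOrbits

variable (Λ : EvenUnimodularLattice 24)

/-- half the norm -/
def hn (v : Fin 24 → ℤ) : ℕ := (Λ.inner v v / 2).toNat

lemma inner_nonneg (v : Fin 24 → ℤ) : 0 ≤ Λ.inner v v := by
  by_cases h : v = 0
  · rw [h]; simp [EvenUnimodularLattice.inner]
  · exact (Λ.posdef _ h).le

lemma inner_self_eq (v : Fin 24 → ℤ) : Λ.inner v v = 2 * (hn Λ v : ℤ) := by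
  have h1 := inner_nonneg Λ v
  have h2 : (2 : ℤ) ∣ Λ.inner v v := Λ.even v
  unfold hn
  omega

lemma qParam_pow (τ : ℍ) (n : ℕ) : Function.Periodic.qParam 1 τ ^ n =
    cexp (π * Complex.I * τ * ((2 * (n : ℤ) : ℤ))) := by
  rw [Function.Periodic.qParam, ← Complex.exp_nat_mul]
  congr 1
  push_cast
  ring

lemma finite_fiber (n : ℕ) : Finite {v : Fin 24 → ℤ // hn Λ v = n} := by
  by_contra h
  rw [not_finite_iff_infinite] at h
  have h1 := (summable_theta Λ Complex.I (by simp)).subtype {v : Fin 24 → ℤ | hn Λ v = n}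
  have h2 : Summable fun v : {v : Fin 24 → ℤ // hn Λ v = n} => cexp (π * Complex.I * Complex.I * ((2 * (n : ℤ) : ℤ))) := by
    convert! h1 using 1
    funext v
    have h3 : hn Λ v.1 = n := v.2
    have h4 : Λ.inner v.1 v.1 = 2 * (n : ℤ) := by rw [inner_self_eq, h3]
    simp [h4]
  rw [summable_const_iff] at h2
  exact Complex.exp_ne_zero _ h2

/-- number of vectors of norm `2n` -/
noncomputable def rep (n : ℕ) : ℕ := Nat.card {v : Fin 24 → ℤ // hn Λ v = n}

lemma hasSum_theta (τ : ℍ) : HasSum (fun n => (rep Λ n : ℂ) • Function.Periodic.qParam 1 τ ^ n)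
    (theta Λ τ) := by
  have h1 := (summable_theta Λ τ τ.im_pos).hasSum
  rw [← (Equiv.sigmaFiberEquiv (hn Λ)).hasSum_iff] at h1
  refine HasSum.sigma h1 fun n => ?_
  have := finite_fiber Λ n
  have := Fintype.ofFinite {v : Fin 24 → ℤ // hn Λ v = n}
  have h2 : (fun c : {v : Fin 24 → ℤ // hn Λ v = n} =>
    ((fun v : Fin 24 → ℤ => cexp (π * Complex.I * τ * (Λ.inner v v : ℤ))) ∘ (Equiv.sigmaFiberEquiv (hn Λ))) ⟨n, c⟩)
    = fun c => Function.Periodic.qParam 1 τ ^ n := by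
    funext c
    have h3 : hn Λ c.1 = n := c.2
    have h4 : Λ.inner c.1 c.1 = 2 * (n : ℤ) := by rw [inner_self_eq, h3]
    rw [qParam_pow]
    simp [h4]
  rw [h2]
  convert! hasSum_fintype (fun c : {v : Fin 24 → ℤ // hn Λ v = n} => Function.Periodic.qParam 1 τ ^ n) using 1
  simp [rep, Nat.card_eq_fintype_card]

/-- theta on the upper half plane -/
noncomputable def thetaH (τ : ℍ) : ℂ := theta Λ τ

lemma thetaH_T : (thetaH Λ ∣[(12 : ℤ)] ModularGroup.T) = thetaH Λ := by
  ext z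
  rw [SL_slash_apply, modular_T_smul, ModularGroup.denom_apply]
  have h1 : thetaH Λ ((1 : ℝ) +ᵥ z) = thetaH Λ z := by
    refine tsum_congr fun v => ?_
    rw [inner_self_eq, ]
    push_cast
    rw [UpperHalfPlane.coe_vadd]
    rw [Complex.exp_eq_exp_iff_exists_int]
    refine ⟨hn Λ v, ?_⟩
    push_cast
    ring
  rw [h1]
  simp [ModularGroup.T]

lemma thetaH_S : (thetaH Λ ∣[(12 : ℤ)] ModularGroup.S) = thetaH Λ := by
  ext z
  have h : theta Λ (-1 / (z : ℂ)) = (z : ℂ) ^ 12 * theta Λ z := theta_S Λ z z.im_pos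
  suffices theta Λ (-(↑z)⁻¹) * ((z : ℂ) ^ 12)⁻¹ = theta Λ z by
    rw [SL_slash_apply, UpperHalfPlane.modular_S_smul, ModularGroup.denom_S]
    simpa [thetaH]
  rw [neg_div, one_div] at h
  rw [h]
  field_simp [z.ne_zero]

/-- theta as a modular form -/
noncomputable def thetaForm : ModularForm 𝒮ℒ 12 where
  toFun := thetaH Λ
  slash_action_eq' A hA := by
    obtain ⟨A, rfl⟩ := hA
    exact SlashInvariantForm.slash_action_generators_SL2Z (thetaH_S Λ) (thetaH_T Λ) A
  holo' := by
    rw [UpperHalfPlane.mdifferentiable_iff]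
    refine (differentiableOn_theta Λ).congr fun z hz ↦ ?_
    simp [thetaH, ofComplex_apply_of_im_pos hz]
  bdd_at_cusps' hc := by
    rw [Subgroup.IsArithmetic.isCusp_iff_isCusp_SL2Z] at hc
    rw [OnePoint.isBoundedAt_iff_forall_SL2Z hc]
    intro γ _
    rw [SlashInvariantForm.slash_action_generators_SL2Z (thetaH_S Λ) (thetaH_T Λ)]
    exact isBoundedAtImInfty_of_hasSum_qExpansion one_pos fun τ => hasSum_theta Λ τ

lemma thetaForm_coeff (n : ℕ) : (qExpansion 1 (thetaForm Λ)).coeff n = rep Λ n :=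
  (ModularFormClass.qExpansion_coeff_unique (f := thetaForm Λ) one_pos one_mem_strictPeriods_SL
    (fun τ => hasSum_theta Λ τ) n).symm

lemma rep_zero : rep Λ 0 = 1 := by
  rw [rep, Nat.card_eq_one_iff_unique]
  constructor
  · constructor
    rintro ⟨v, hv⟩ ⟨w, hw⟩
    have h : ∀ v : Fin 24 → ℤ, hn Λ v = 0 → v = 0 := by
      intro v hv
      by_contra h
      have h1 : 0 < Λ.inner v v := Λ.posdef v h
      rw [inner_self_eq, hv] at h1
      simp at h1
    simp [h v hv, h w hw]
  · exact ⟨⟨0, by simp [hn, EvenUnimodularLattice.inner]⟩⟩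

lemma rep_one (h : IsLeech Λ) : rep Λ 1 = 0 := by
  rw [rep, Nat.card_eq_zero]
  left
  constructor
  rintro ⟨v, hv⟩
  apply h v
  rw [inner_self_eq, hv]
  norm_num

open EisensteinSeries

lemma E4_coeff (n : ℕ) : (qExpansion 1 E₄).coeff n =
    if n = 0 then 1 else 240 * (ArithmeticFunction.sigma 3 n : ℂ) := by
  have := EisensteinSeries.E_qExpansion_coeff (k := 4) (by norm_num) ⟨2, rfl⟩ n
  have hb : bernoulli 4 = -1/30 := by decide +kernel
  rw [hb] at this
  rw [E₄, this]
  split_ifs <;> norm_num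

lemma E6_coeff (n : ℕ) : (qExpansion 1 E₆).coeff n =
    if n = 0 then 1 else -504 * (ArithmeticFunction.sigma 5 n : ℂ) := by
  have := EisensteinSeries.E_qExpansion_coeff (k := 6) (by norm_num) ⟨3, rfl⟩ n
  have hb : bernoulli 6 = 1/42 := by decide +kernel
  rw [hb] at this
  rw [E₆, this]
  split_ifs <;> norm_num

/-- the expected form -/
noncomputable def expForm : ModularForm 𝒮ℒ 12 :=
  (7/12 : ℂ) • ModularForm.mcast (by decide) (E₄.pow 3) + (5/12 : ℂ) • ModularForm.mcast (by decide) (E₆.pow 2)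

lemma expForm_q : qExpansion 1 expForm =
    (7/12 : ℂ) • (qExpansion 1 E₄)^3 + (5/12 : ℂ) • (qExpansion 1 E₆)^2 := by
  unfold expForm
  rw [FunLike.coe_add, ModularForm.qExpansion_add one_pos one_mem_strictPeriods_SL,
    FunLike.coe_smul, FunLike.coe_smul,
    ModularForm.qExpansion_smul one_pos one_mem_strictPeriods_SL,
    ModularForm.qExpansion_smul one_pos one_mem_strictPeriods_SL, coe_mcast, coe_mcast,
    ModularForm.qExpansion_pow one_pos one_mem_strictPeriods_SL,
    ModularForm.qExpansion_pow one_pos one_mem_strictPeriods_SL]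

lemma pow3_coeffs (P : PowerSeries ℂ) (n : ℕ) : (P ^ 3).coeff n =
    ∑ p ∈ Finset.HasAntidiagonal.antidiagonal n, P.coeff p.1 * ∑ q ∈ Finset.HasAntidiagonal.antidiagonal p.2, P.coeff q.1 * P.coeff q.2 := by
  rw [pow_succ', pow_two, PowerSeries.coeff_mul]
  refine Finset.sum_congr rfl fun p _ => ?_
  rw [PowerSeries.coeff_mul]

lemma pow2_coeffs (P : PowerSeries ℂ) (n : ℕ) : (P ^ 2).coeff n =
    ∑ q ∈ Finset.HasAntidiagonal.antidiagonal n, P.coeff q.1 * P.coeff q.2 := by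
  rw [pow_two, PowerSeries.coeff_mul]

lemma expForm_coeffs : (qExpansion 1 expForm).coeff 0 = 1 ∧ (qExpansion 1 expForm).coeff 1 = 0 ∧
    (qExpansion 1 expForm).coeff 2 = 196560 ∧ (qExpansion 1 expForm).coeff 3 = 16773120 ∧
    (qExpansion 1 expForm).coeff 4 = 398034000 := by
  have s1 : ArithmeticFunction.sigma 3 1 = 1 := by decide
  have s2 : ArithmeticFunction.sigma 3 2 = 9 := by decide
  have s3 : ArithmeticFunction.sigma 3 3 = 28 := by decide
  have s4 : ArithmeticFunction.sigma 3 4 = 73 := by decide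
  have t1 : ArithmeticFunction.sigma 5 1 = 1 := by decide
  have t2 : ArithmeticFunction.sigma 5 2 = 33 := by decide
  have t3 : ArithmeticFunction.sigma 5 3 = 244 := by decide
  have t4 : ArithmeticFunction.sigma 5 4 = 1057 := by decide
  rw [expForm_q]
  simp only [map_add, PowerSeries.coeff_smul, pow3_coeffs, pow2_coeffs, E4_coeff, E6_coeff]
  refine ⟨?_, ?_, ?_, ?_, ?_⟩ <;>
  norm_num [Finset.Nat.antidiagonal_succ, s1, s2, s3, s4, t1, t2, t3, t4]

lemma thetaForm_eq (h : IsLeech Λ) : thetaForm Λ = expForm := by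
  rw [← sub_eq_zero]
  apply ModularForm.sturm_bound_levelOne
  rw [FunLike.coe_sub, ModularForm.qExpansion_sub one_pos one_mem_strictPeriods_SL]
  have h2 : ((1 + 1 : ℕ) : ℕ∞) ≤ (qExpansion 1 (thetaForm Λ) - qExpansion 1 expForm).order := by
    apply PowerSeries.nat_le_order
    intro i hi
    rw [map_sub, thetaForm_coeff]
    interval_cases i
    · rw [expForm_coeffs.1, rep_zero]; simp
    · rw [expForm_coeffs.2.1, rep_one Λ h]; simp
  refine lt_of_lt_of_le ?_ h2
  have h3 : Int.toNat 12 / 12 = 1 := by decide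
  rw [h3]
  norm_num

theorem rep_values (h : IsLeech Λ) : rep Λ 2 = 196560 ∧ rep Λ 3 = 16773120 ∧ rep Λ 4 = 398034000 := by
  have h1 := thetaForm_coeff Λ
  rw [thetaForm_eq Λ h] at h1
  obtain ⟨-, -, h2, h3, h4⟩ := expForm_coeffs
  rw [h1] at h2 h3 h4
  exact ⟨by exact_mod_cast h2, by exact_mod_cast h3, by exact_mod_cast h4⟩

end FiveOrbits
end

section
open Matrix

namespace FiveOrbits

variable (Λ : EvenUnimodularLattice 24)

/-- the underlying module -/
abbrev V := Fin 24 → ℤ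

/-- the form as a bilinear map -/
noncomputable def ip : V →ₗ[ℤ] V →ₗ[ℤ] ℤ := Matrix.toLinearMap₂' ℤ Λ.gram

lemma inner_eq_ip (x y : V) : Λ.inner x y = ip Λ x y := by
  rw [ip, Matrix.toLinearMap₂'_apply', EvenUnimodularLattice.inner]

lemma ip_comm (x y : V) : ip Λ x y = ip Λ y x := by
  rw [← inner_eq_ip, ← inner_eq_ip, EvenUnimodularLattice.inner, EvenUnimodularLattice.inner,
    dotProduct_mulVec, dotProduct_comm, ← mulVec_transpose, Λ.symm]

lemma ip_even (x : V) : (2 : ℤ) ∣ ip Λ x x := by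
  rw [← inner_eq_ip]; exact Λ.even x

lemma ip_pos {x : V} (hx : x ≠ 0) : 0 < ip Λ x x := by
  rw [← inner_eq_ip]; exact Λ.posdef x hx

lemma four_le (h : IsLeech Λ) {x : V} (hx : x ≠ 0) : 4 ≤ ip Λ x x := by
  have h1 := ip_pos Λ hx
  have h2 := ip_even Λ x
  have h3 := h x
  rw [inner_eq_ip] at h3
  omega

lemma red_eq_iff (x y : V) : Λ.red x = Λ.red y ↔ ∃ z : V, x - y = (2 : ℤ) • z := by
  simp only [EvenUnimodularLattice.red, funext_iff]
  constructor
  · intro h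
    have h2 : ∀ i, ∃ z : ℤ, x i - y i = 2 * z := by
      intro i
      have := (ZMod.intCast_eq_intCast_iff_dvd_sub (y i) (x i) 2).mp (h i).symm
      exact_mod_cast this
    choose z hz using h2
    exact ⟨z, fun i => by simp [hz i]⟩
  · rintro ⟨z, hz⟩ i
    refine ((ZMod.intCast_eq_intCast_iff_dvd_sub (y i) (x i) 2).mpr ⟨z i, ?_⟩).symm
    simpa using hz i

lemma red_add_of_sub {x y : V} (h : ∃ z : V, x - y = (2 : ℤ) • z) : ∃ z : V, x + y = (2 : ℤ) • z := by
  obtain ⟨z, hz⟩ := h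
  refine ⟨z + y, ?_⟩
  rw [smul_add, ← hz, two_smul]; abel

lemma short_classes (h : IsLeech Λ) {x y : V} (hr : Λ.red x = Λ.red y) (h1 : x ≠ y) (h2 : x ≠ -y)
    (hx : ip Λ x x ≤ 8) (hy : ip Λ y y ≤ 8) : ip Λ x x = 8 ∧ ip Λ y y = 8 ∧ ip Λ x y = 0 := by
  rw [red_eq_iff] at hr
  obtain ⟨w, hw⟩ := red_add_of_sub hr
  obtain ⟨z, hz⟩ := hr
  have hz0 : z ≠ 0 := by
    rintro rfl; rw [smul_zero, sub_eq_zero] at hz; exact h1 hz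
  have hw0 : w ≠ 0 := by
    rintro rfl; rw [smul_zero] at hw; exact h2 (eq_neg_of_add_eq_zero_left hw)
  have e1 := congrArg (fun t => ip Λ t t) hz
  have e2 := congrArg (fun t => ip Λ t t) hw
  simp only [map_sub, map_add, map_smul, LinearMap.sub_apply, LinearMap.add_apply,
    LinearMap.smul_apply, smul_eq_mul] at e1 e2
  have := four_le Λ h hz0
  have := four_le Λ h hw0
  have := ip_comm Λ x y
  omega

lemma finite_shell (n : ℕ) : {v : V | hn Λ v = n}.Finite := by
  have := finite_fiber Λ n
  exact Set.finite_coe_iff.mp this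

/-- vectors with half norm n -/
noncomputable def shell (n : ℕ) : Finset V := (finite_shell Λ n).toFinset

lemma mem_shell {n : ℕ} {v : V} : v ∈ shell Λ n ↔ ip Λ v v = 2 * n := by
  simp only [shell, Set.Finite.mem_toFinset]
  have := inner_self_eq Λ v
  rw [inner_eq_ip] at this
  show hn Λ v = n ↔ _
  omega

lemma card_shell (n : ℕ) : (shell Λ n).card = rep Λ n := by
  rw [rep, shell, ← Nat.card_eq_card_finite_toFinset]
  rfl

open scoped Classical in
/-- vectors with half norm n in a class mod 2 -/
noncomputable def cls (n : ℕ) (c : Fin 24 → ZMod 2) : Finset V :=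
  (shell Λ n).filter fun v => Λ.red v = c

lemma mem_cls {n : ℕ} {c : Fin 24 → ZMod 2} {v : V} :
    v ∈ cls Λ n c ↔ ip Λ v v = 2 * n ∧ Λ.red v = c := by
  classical
  rw [cls, Finset.mem_filter, mem_shell]

lemma sum_cls (n : ℕ) : ∑ c, (cls Λ n c).card = rep Λ n := by
  classical
  rw [← card_shell]
  exact (Finset.card_eq_sum_card_fiberwise (f := Λ.red) (t := Finset.univ) (fun _ _ => by simp)).symm

lemma card_le_of_orth (P : Finset V) (h0 : ∀ v ∈ P, ip Λ v v ≠ 0)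
    (h1 : ∀ v ∈ P, ∀ w ∈ P, v ≠ w → ip Λ v w = 0) : P.card ≤ 24 := by
  have hl : LinearIndependent ℤ (fun v : P => (v : V)) := by
    rw [Fintype.linearIndependent_iff]
    intro g hg w
    have h2 := congrArg (fun t => ip Λ t w) hg
    simp only [map_sum, LinearMap.sum_apply, map_smul, LinearMap.smul_apply, smul_eq_mul, map_zero,
      LinearMap.zero_apply] at h2
    rw [Finset.sum_eq_single w (fun v _ hv => by
      rw [h1 v v.2 w w.2 (fun h => hv (Subtype.ext h)), mul_zero]) (by simp)] at h2
    exact (mul_eq_zero.mp h2).resolve_right (h0 w w.2)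
  have := hl.fintype_card_le_finrank
  simpa using this

lemma neg_mem_cls {n : ℕ} {c : Fin 24 → ZMod 2} {v : V} (h : v ∈ cls Λ n c) : -v ∈ cls Λ n c := by
  rw [mem_cls] at h ⊢
  refine ⟨by simpa using h.1, ?_⟩
  rw [← h.2, red_eq_iff]
  exact ⟨-v, by rw [two_smul]; abel⟩

open scoped Classical in
/-- the positive half of a set of vectors -/
noncomputable def half (s : Finset V) : Finset V := s.filter fun v => WellOrderingRel v (-v)

lemma half_card (s : Finset V) (hs : ∀ v ∈ s, -v ∈ s) (h0 : (0 : V) ∉ s) :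
    s.card = 2 * (half s).card := by
  classical
  have h1 : (half s).card = (s.filter fun v => ¬ WellOrderingRel v (-v)).card := by
    refine Finset.card_bij (fun v _ => -v) ?_ ?_ ?_
    · intro v hv
      rw [half, Finset.mem_filter] at hv
      rw [Finset.mem_filter]
      refine ⟨hs v hv.1, ?_⟩
      rw [neg_neg]
      exact asymm_of WellOrderingRel hv.2
    · intro v _ w _ h; simpa using h
    · intro w hw
      rw [Finset.mem_filter] at hw
      refine ⟨-w, ?_, by simp⟩
      rw [half, Finset.mem_filter]
      refine ⟨hs w hw.1, ?_⟩
      rw [neg_neg]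
      have hne : w ≠ -w := by
        intro h
        apply h0
        have : w = 0 := self_eq_neg.mp h
        rw [← this]; exact hw.1
      rcases trichotomous_of WellOrderingRel w (-w) with h | h | h
      · exact absurd h hw.2
      · exact absurd h hne
      · exact h
  have h2 := Finset.card_filter_add_card_filter_not (s := s) (fun v => WellOrderingRel v (-v))
  rw [← h1] at h2
  change (half s).card + _ = _ at h2
  omega

lemma half_ne_neg {s : Finset V} {v w : V} (hv : v ∈ half s) (hw : w ∈ half s) : v ≠ -w := by
  classical
  rintro rfl
  rw [half, Finset.mem_filter] at hv hw
  have h1 := hv.2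
  rw [neg_neg] at h1
  exact asymm_of WellOrderingRel h1 hw.2

lemma mem_of_half {s : Finset V} {v : V} (hv : v ∈ half s) : v ∈ s := by
  classical
  rw [half, Finset.mem_filter] at hv
  exact hv.1

lemma zero_notMem_cls {n : ℕ} (hn : 0 < n) (c : Fin 24 → ZMod 2) : (0 : V) ∉ cls Λ n c := by
  rw [mem_cls]
  simp
  omega

/-- Main counting statement on classes modulo two. -/
lemma cls_bound (h : IsLeech Λ) (c : Fin 24 → ZMod 2) :
    48 * (cls Λ 0 c).card + 24 * (cls Λ 2 c).card + 24 * (cls Λ 3 c).card + (cls Λ 4 c).card ≤ 48 ∧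
    ((cls Λ 4 c).card ≠ 0 → (cls Λ 0 c).card = 0 ∧ (cls Λ 2 c).card = 0 ∧ (cls Λ 3 c).card = 0) := by
  have key : ∀ m n : ℕ, ∀ v w : V, m ≤ 4 → n ≤ 4 → v ∈ cls Λ m c → w ∈ cls Λ n c → v ≠ w → v ≠ -w →
      m = 4 ∧ n = 4 ∧ ip Λ v w = 0 := by
    intro m n v w hm hn hv hw h1 h2
    rw [mem_cls] at hv hw
    have := short_classes Λ h (hv.2.trans hw.2.symm) h1 h2 (by omega) (by omega)
    omega
  have hdis : ∀ m n : ℕ, m ≤ 4 → n ≤ 4 → m ≠ n → cls Λ m c = ∅ ∨ cls Λ n c = ∅ := by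
    intro m n hm hn hmn
    by_contra! hne
    obtain ⟨⟨v, hv⟩, ⟨w, hw⟩⟩ := hne
    have hv' := (mem_cls Λ).mp hv
    have hw' := (mem_cls Λ).mp hw
    have h1 : v ≠ w := by
      rintro rfl; omega
    have h2 : v ≠ -w := by
      rintro rfl
      simp only [map_neg, LinearMap.neg_apply, neg_neg] at hv'
      omega
    have := key m n v w hm hn hv hw h1 h2
    omega
  have hsmall : ∀ n, 0 < n → n < 4 → (cls Λ n c).card ≤ 2 := by
    intro n h0 hn
    rw [half_card (cls Λ n c) (fun v hv => neg_mem_cls Λ hv) (zero_notMem_cls Λ h0 c)]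
    have : (half (cls Λ n c)).card ≤ 1 := by
      rw [Finset.card_le_one]
      intro v hv w hw
      by_contra hne
      have := key n n v w hn.le hn.le (mem_of_half hv) (mem_of_half hw) hne (half_ne_neg hv hw)
      omega
    omega
  have h0 : (cls Λ 0 c).card ≤ 1 := by
    rw [Finset.card_le_one]
    have hz : ∀ v ∈ cls Λ 0 c, v = 0 := by
      intro v hv
      by_contra hne
      have := ip_pos Λ hne
      rw [mem_cls] at hv
      omega
    intro v hv w hw
    rw [hz v hv, hz w hw]
  have h4 : (cls Λ 4 c).card ≤ 48 := by
    rw [half_card (cls Λ 4 c) (fun v hv => neg_mem_cls Λ hv) (zero_notMem_cls Λ (by norm_num) c)]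
    have : (half (cls Λ 4 c)).card ≤ 24 := by
      apply card_le_of_orth Λ
      · intro v hv
        have := ((mem_cls Λ).mp (mem_of_half hv)).1
        omega
      · intro v hv w hw hne
        exact (key 4 4 v w le_rfl le_rfl (mem_of_half hv) (mem_of_half hw) hne (half_ne_neg hv hw)).2.2
    omega
  have h2 := hsmall 2 (by norm_num) (by norm_num)
  have h3 := hsmall 3 (by norm_num) (by norm_num)
  simp only [← Finset.card_eq_zero] at hdis
  have a1 := hdis 0 2 (by norm_num) (by norm_num) (by norm_num)
  have a2 := hdis 0 3 (by norm_num) (by norm_num) (by norm_num)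
  have a3 := hdis 0 4 (by norm_num) (by norm_num) (by norm_num)
  have a4 := hdis 2 3 (by norm_num) (by norm_num) (by norm_num)
  have a5 := hdis 2 4 (by norm_num) (by norm_num) (by norm_num)
  have a6 := hdis 3 4 (by norm_num) (by norm_num) (by norm_num)
  clear hdis hsmall key
  omega

lemma cls_eq (h : IsLeech Λ) (c : Fin 24 → ZMod 2) :
    48 * (cls Λ 0 c).card + 24 * (cls Λ 2 c).card + 24 * (cls Λ 3 c).card + (cls Λ 4 c).card = 48 := by
  have hs : ∑ c, (48 * (cls Λ 0 c).card + 24 * (cls Λ 2 c).card + 24 * (cls Λ 3 c).card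
      + (cls Λ 4 c).card) = ∑ c : Fin 24 → ZMod 2, 48 := by
    simp only [Finset.sum_add_distrib, ← Finset.mul_sum, sum_cls]
    obtain ⟨r2, r3, r4⟩ := rep_values Λ h
    rw [r2, r3, r4, rep_zero]
    simp [ZMod.card]
  exact (Finset.sum_eq_sum_iff_of_le (fun c _ => (cls_bound Λ h c).1)).mp hs c (Finset.mem_univ c)

/-- a class containing a norm 8 vector contains exactly 48 of them. -/
lemma cls4_card (h : IsLeech Λ) (c : Fin 24 → ZMod 2) (hc : (cls Λ 4 c).Nonempty) :
    (cls Λ 4 c).card = 48 := by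
  have h1 := cls_eq Λ h c
  have h2 := Finset.card_pos.mpr hc
  have h3 := (cls_bound Λ h c).2
  omega

open scoped Classical in
/-- The frame classes. -/
noncomputable def frameClasses : Finset (Fin 24 → ZMod 2) :=
  Finset.univ.filter fun c => (cls Λ 4 c).Nonempty

lemma mem_frameClasses {c : Fin 24 → ZMod 2} : c ∈ frameClasses Λ ↔ (cls Λ 4 c).Nonempty := by
  classical
  simp [frameClasses]

theorem card_frameClasses (h : IsLeech Λ) : (frameClasses Λ).card = 8292375 := by
  classical
  have h1 := sum_cls Λ 4
  rw [(rep_values Λ h).2.2] at h1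
  have h2 : ∑ c, (cls Λ 4 c).card = ∑ c ∈ frameClasses Λ, 48 := by
    rw [frameClasses, Finset.sum_filter]
    refine Finset.sum_congr rfl fun c _ => ?_
    split_ifs with hc
    · exact cls4_card Λ h c hc
    · rw [Finset.not_nonempty_iff_eq_empty] at hc
      simp [hc]
  rw [h2, Finset.sum_const, smul_eq_mul] at h1
  omega

/-- A coordinate frame. -/
structure IsFrame (f : Fin 24 → V) : Prop where
  self : ∀ i, ip Λ (f i) (f i) = 8
  orth : ∀ i j, i ≠ j → ip Λ (f i) (f j) = 0
  red : ∀ i j, Λ.red (f i) = Λ.red (f j)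

theorem exists_frame (h : IsLeech Λ) {c : Fin 24 → ZMod 2} (hc : c ∈ frameClasses Λ) :
    ∃ f, IsFrame Λ f ∧ ∀ i, Λ.red (f i) = c := by
  rw [mem_frameClasses] at hc
  have h1 := cls4_card Λ h c hc
  have h2 := half_card (cls Λ 4 c) (fun v hv => neg_mem_cls Λ hv) (zero_notMem_cls Λ (by norm_num) c)
  have h3 : (half (cls Λ 4 c)).card = 24 := by omega
  let e := (half (cls Λ 4 c)).equivFinOfCardEq h3
  have hm : ∀ i, ((e.symm i : V)) ∈ cls Λ 4 c := fun i => mem_of_half (e.symm i).2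
  refine ⟨fun i => e.symm i, ⟨fun i => ?_, fun i j hij => ?_, fun i j => ?_⟩, fun i => ?_⟩
  · have := ((mem_cls Λ).mp (hm i)).1
    omega
  · have hi := (mem_cls Λ).mp (hm i)
    have hj := (mem_cls Λ).mp (hm j)
    refine (short_classes Λ h (hi.2.trans hj.2.symm) ?_ (half_ne_neg (e.symm i).2 (e.symm j).2)
      (by omega) (by omega)).2.2
    intro h
    exact hij (e.symm.injective (Subtype.ext h))
  · rw [((mem_cls Λ).mp (hm i)).2, ((mem_cls Λ).mp (hm j)).2]
  · exact ((mem_cls Λ).mp (hm i)).2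

lemma frameClasses_nonempty (h : IsLeech Λ) : (frameClasses Λ).Nonempty := by
  rw [← Finset.card_pos, card_frameClasses Λ h]; norm_num

end FiveOrbits
end

section
open Matrix

namespace FiveOrbits

/-- binary words -/
abbrev W := Fin 24 → ZMod 2

/-- coordinates of the Leech lattice for a code `C` -/
def LeechSet (C : Submodule (ZMod 2) W) (x : Fin 24 → ℤ) : Prop :=
  ∃ m : ℤ, (m = 0 ∨ m = 1) ∧ (∀ i, 2 ∣ x i - m) ∧
    (fun i => (((x i - m) / 2 : ℤ) : ZMod 2)) ∈ C ∧ 8 ∣ ∑ i, x i - 4 * m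

/-- abstract properties of the coordinate lattice -/
structure IsLeechCoord (L : Submodule ℤ (Fin 24 → ℤ)) : Prop where
  int : ∀ x ∈ L, ∀ y ∈ L, (8 : ℤ) ∣ x ⬝ᵥ y
  even : ∀ x ∈ L, (16 : ℤ) ∣ x ⬝ᵥ x
  min : ∀ x ∈ L, x ≠ 0 → (32 : ℤ) ≤ x ⬝ᵥ x
  dual : ∀ x, (∀ y ∈ L, (8 : ℤ) ∣ x ⬝ᵥ y) → x ∈ L
  sub : ∀ i j, i ≠ j → (Pi.single i 4 - Pi.single j 4 : Fin 24 → ℤ) ∈ L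
  add : ∀ i j, i ≠ j → (Pi.single i 4 + Pi.single j 4 : Fin 24 → ℤ) ∈ L

namespace IsLeechCoord

variable {L : Submodule ℤ (Fin 24 → ℤ)}

lemma parity (hL : IsLeechCoord L) {x : Fin 24 → ℤ} (hx : x ∈ L) (i j : Fin 24) : 2 ∣ x i - x j := by
  by_cases hij : i = j
  · simp [hij]
  have h := hL.int x hx _ (hL.sub i j hij)
  rw [dotProduct_sub, dotProduct_single, dotProduct_single] at h
  omega

lemma sub' (hL : IsLeechCoord L) (i j : Fin 24) : (Pi.single i 4 - Pi.single j 4 : Fin 24 → ℤ) ∈ L := by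
  by_cases hij : i = j
  · simp [hij]
  · exact hL.sub i j hij

lemma eight (hL : IsLeechCoord L) (i : Fin 24) : (Pi.single i 8 : Fin 24 → ℤ) ∈ L := by
  obtain ⟨j, hj⟩ := exists_ne i
  have h := L.add_mem (hL.sub i j hj.symm) (hL.add i j hj.symm)
  have e : (Pi.single i 4 - Pi.single j 4 + (Pi.single i 4 + Pi.single j 4) : Fin 24 → ℤ) =
      Pi.single i 8 := by
    have : (Pi.single i 8 : Fin 24 → ℤ) = Pi.single i 4 + Pi.single i 4 := by
      rw [← Pi.single_add]; norm_num
    rw [this]; abel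
  rwa [e] at h

lemma four_mul (hL : IsLeechCoord L) {x : Fin 24 → ℤ} (h4 : ∀ i, 4 ∣ x i) (h8 : 8 ∣ ∑ i, x i) : x ∈ L := by
  choose y hy using h4
  have e : x = ∑ i, y i • (Pi.single i 4 - Pi.single 0 4 : Fin 24 → ℤ) +
      ((∑ i, y i) / 2) • (Pi.single 0 8 : Fin 24 → ℤ) := by
    have h2 : (Pi.single 0 8 : Fin 24 → ℤ) = (2 : ℤ) • Pi.single 0 4 := by
      rw [← Pi.single_smul]; norm_num
    have h3 : (∑ i, y i) / 2 * 2 = ∑ i, y i := by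
      simp only [hy, ← Finset.mul_sum] at h8
      omega
    rw [h2, smul_smul, h3]
    simp only [smul_sub, Finset.sum_sub_distrib, ← Finset.sum_smul, sub_add_cancel]
    ext i
    simp [Finset.sum_apply, Pi.single_apply, hy i, mul_comm]
  rw [e]
  refine L.add_mem (L.sum_mem fun i _ => L.smul_mem _ (hL.sub' i 0)) (L.smul_mem _ (hL.eight 0))

/-- the code attached to the lattice -/
def code (L : Submodule ℤ (Fin 24 → ℤ)) : Submodule (ZMod 2) W where
  carrier := {c | ∃ y : Fin 24 → ℤ, (2 : ℤ) • y ∈ L ∧ ∀ i, c i = (y i : ZMod 2)}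
  zero_mem' := ⟨0, by simp, by simp⟩
  add_mem' := by
    rintro a b ⟨y, hy, hy'⟩ ⟨z, hz, hz'⟩
    refine ⟨y + z, by rw [smul_add]; exact L.add_mem hy hz, fun i => ?_⟩
    simp [hy', hz']
  smul_mem' := by
    rintro c a ⟨y, hy, hy'⟩
    refine ⟨(c.val : ℤ) • y, by rw [smul_comm]; exact L.smul_mem _ hy, fun i => ?_⟩
    simp [hy']

lemma mem_code {c : W} : c ∈ code L ↔ ∃ y : Fin 24 → ℤ, (2 : ℤ) • y ∈ L ∧ ∀ i, c i = (y i : ZMod 2) :=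
  Iff.rfl

lemma exists_odd (hL : IsLeechCoord L) : ∃ u ∈ L, ∀ i, ¬ 2 ∣ u i := by
  by_contra! h
  have h2 : (Pi.single 0 4 : Fin 24 → ℤ) ∈ L := by
    apply hL.dual
    intro y hy
    rw [single_dotProduct]
    obtain ⟨i, hi⟩ := h y hy
    have := hL.parity hy 0 i
    omega
  have h3 := hL.min _ h2 (by simp)
  rw [dotProduct_single] at h3
  simp at h3

lemma code_orth (hL : IsLeechCoord L) {c d : W} (hc : c ∈ code L) (hd : d ∈ code L) : c ⬝ᵥ d = 0 := by
  obtain ⟨y, hy, hcy⟩ := hc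
  obtain ⟨z, hz, hdz⟩ := hd
  have h := hL.int _ hy _ hz
  rw [smul_dotProduct, dotProduct_smul, smul_eq_mul, smul_eq_mul] at h
  have h2 : (2 : ℤ) ∣ y ⬝ᵥ z := by omega
  have h3 := (ZMod.intCast_zmod_eq_zero_iff_dvd (y ⬝ᵥ z) 2).mpr h2
  simp only [dotProduct, Int.cast_sum, Int.cast_mul] at h3
  simp only [dotProduct, hcy, hdz]
  exact h3

lemma ones_mem (hL : IsLeechCoord L) : (fun _ => 1 : W) ∈ code L := by
  obtain ⟨u, hu, ho⟩ := hL.exists_odd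
  refine ⟨u, L.smul_mem _ hu, fun i => ?_⟩
  have : ((u i - 1 : ℤ) : ZMod 2) = 0 := by
    rw [ZMod.intCast_zmod_eq_zero_iff_dvd]
    have := ho i
    push_cast
    omega
  push_cast at this
  exact (sub_eq_zero.mp this).symm

lemma orth_code (hL : IsLeechCoord L) {d : W} (hd : ∀ c ∈ code L, c ⬝ᵥ d = 0) : d ∈ code L := by
  obtain ⟨u, hu, ho⟩ := hL.exists_odd
  let D : Fin 24 → ℤ := fun i => (d i).val
  have hDd : ∀ i, d i = (D i : ZMod 2) := fun i => by simp [D]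
  have hpar : ∀ c ∈ code L, ∀ y : Fin 24 → ℤ, (∀ i, c i = (y i : ZMod 2)) → (2 : ℤ) ∣ D ⬝ᵥ y := by
    intro c hc y hy
    have h := hd c hc
    have h2 : ((D ⬝ᵥ y : ℤ) : ZMod 2) = 0 := by
      rw [dotProduct_comm] at h
      simp only [dotProduct, hDd, hy] at h
      simp only [dotProduct, Int.cast_sum, Int.cast_mul]
      exact h
    exact_mod_cast (ZMod.intCast_zmod_eq_zero_iff_dvd _ 2).mp h2
  have hu2 : (2 : ℤ) ∣ D ⬝ᵥ u := by
    refine hpar _ hL.ones_mem u fun i => ?_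
    have : ((u i - 1 : ℤ) : ZMod 2) = 0 := by
      rw [ZMod.intCast_zmod_eq_zero_iff_dvd]
      have := ho i
      push_cast
      omega
    push_cast at this
    exact (sub_eq_zero.mp this).symm
  obtain ⟨k, hk⟩ := hu2
  -- x = 2 (D + 2 k e_0)
  refine ⟨D + Pi.single 0 (2 * k), ?_, fun i => ?_⟩
  · apply hL.dual
    intro y hy
    rw [smul_dotProduct, add_dotProduct, single_dotProduct, smul_eq_mul]
    have heven : ∀ y ∈ L, 2 ∣ y 0 → (8 : ℤ) ∣ 2 * (D ⬝ᵥ y) := by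
      intro y hy h0
      have h1 : ∀ i, ∃ z, y i = 2 * z := fun i => by
        have := hL.parity hy i 0
        have h3 : 2 ∣ y i := by omega
        exact h3
      choose z hz using h1
      have hyz : y = (2 : ℤ) • z := by ext i; simp [hz]
      have h2 := hpar (fun i => (z i : ZMod 2)) ⟨z, by rwa [← hyz], fun i => rfl⟩ z fun i => rfl
      rw [hyz, dotProduct_smul, smul_eq_mul]
      omega
    by_cases h0 : 2 ∣ y 0
    · have h2 := heven y hy h0
      have h3 : (8 : ℤ) ∣ 2 * (2 * k * y 0) := by
        obtain ⟨t, ht⟩ := h0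
        rw [ht]; exact ⟨k * t, by ring⟩
      rw [mul_add]
      exact dvd_add h2 h3
    · have hu0 := ho 0
      have h2 := heven (y - u) (L.sub_mem hy hu) (by simp only [Pi.sub_apply]; omega)
      rw [dotProduct_sub, hk] at h2
      have h3 : (8 : ℤ) ∣ 2 * (2 * k + 2 * k * y 0) := by
        obtain ⟨t, ht⟩ : ∃ t, y 0 = 2 * t + 1 := ⟨y 0 / 2, by omega⟩
        rw [ht]; exact ⟨k + k * t, by ring⟩
      have := dvd_add h2 h3
      convert! this using 1
      ring
  · rw [hDd i]
    by_cases hi : i = 0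
    · subst hi
      have h20 : (2 : ZMod 2) = 0 := by decide
      simp [h20]
    · simp [hi]

lemma code_weight (hL : IsLeechCoord L) {c : W} (hc : c ∈ code L) (h0 : c ≠ 0) :
    8 ≤ (Finset.univ.filter fun i => c i ≠ 0).card := by
  obtain ⟨y, hy, hcy⟩ := hc
  obtain ⟨k, hk⟩ : ∃ k, c k ≠ 0 := by
    by_contra! h; exact h0 (funext h)
  -- reduced vector
  let D : Fin 24 → ℤ := fun i => (c i).val
  have hD : ∀ i, 2 ∣ y i - D i := by
    intro i
    have : ((y i - D i : ℤ) : ZMod 2) = 0 := by simp [D, hcy]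
    exact_mod_cast (ZMod.intCast_zmod_eq_zero_iff_dvd _ 2).mp this
  choose t ht using hD
  have hDk : D k = 1 := by
    have : ∀ a : ZMod 2, a ≠ 0 → a.val = 1 := by decide
    show ((c k).val : ℤ) = 1
    rw [this _ hk]; rfl
  have hmem : ∃ ε : ℤ, (ε = 0 ∨ ε = 1) ∧ (2 : ℤ) • (D - Pi.single k (2 * ε)) ∈ L := by
    refine ⟨(∑ i, t i) % 2, by omega, ?_⟩
    have : (2 : ℤ) • (D - Pi.single k (2 * ((∑ i, t i) % 2))) = (2 : ℤ) • y -
        (((2 : ℤ) • (2 : ℤ) • t) + Pi.single k (4 * ((∑ i, t i) % 2))) := by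
      ext i
      have h1 := ht i
      by_cases hik : i = k
      · subst hik; simp; omega
      · simp [hik]; omega
    rw [this]
    refine L.sub_mem hy (hL.four_mul (fun i => ?_) ?_)
    · by_cases hik : i = k
      · subst hik; simp; omega
      · simp [hik]; omega
    · simp only [Pi.add_apply, Finset.sum_add_distrib, Pi.smul_apply, smul_eq_mul, ← Finset.mul_sum,
        Finset.sum_pi_single', Finset.mem_univ, if_true]
      omega
  obtain ⟨ε, hε, hm⟩ := hmem
  have hsq : ∀ i, (D - Pi.single k (2 * ε) : Fin 24 → ℤ) i * (D - Pi.single k (2 * ε) : Fin 24 → ℤ) i =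
      if c i ≠ 0 then 1 else 0 := by
    intro i
    have hval : D i = if c i ≠ 0 then 1 else 0 := by
      have : ∀ a : ZMod 2, (a.val : ℤ) = if a ≠ 0 then 1 else 0 := by decide
      exact this _
    by_cases hik : i = k
    · subst hik
      rcases hε with rfl | rfl <;> simp [hDk, hk]
    · simp [hik, hval]
  have hnorm : ((2 : ℤ) • (D - Pi.single k (2 * ε))) ⬝ᵥ ((2 : ℤ) • (D - Pi.single k (2 * ε))) =
      4 * ((Finset.univ.filter fun i => c i ≠ 0).card : ℤ) := by
    rw [smul_dotProduct, dotProduct_smul, smul_eq_mul, smul_eq_mul, dotProduct,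
      Finset.sum_congr rfl fun i _ => hsq i]
    rw [Finset.sum_boole]
    ring
  have hne : (2 : ℤ) • (D - Pi.single k (2 * ε)) ≠ 0 := by
    intro h
    have := congrFun h k
    simp [hDk] at this
    omega
  have := hL.min _ hm hne
  rw [hnorm] at this
  omega

end IsLeechCoord

lemma finrank_of_selfdual (C : Submodule (ZMod 2) W) (h1 : ∀ c ∈ C, ∀ d ∈ C, c ⬝ᵥ d = 0)
    (h2 : ∀ d, (∀ c ∈ C, c ⬝ᵥ d = 0) → d ∈ C) : Module.finrank (ZMod 2) C = 12 := by
  let B : LinearMap.BilinForm (ZMod 2) W := Matrix.toBilin' (1 : Matrix (Fin 24) (Fin 24) (ZMod 2))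
  have hB : ∀ x y, B x y = x ⬝ᵥ y := fun x y => by simp [B, Matrix.toBilin'_apply']
  have hnd : B.Nondegenerate := by
    apply LinearMap.BilinForm.nondegenerate_toBilin'_of_det_ne_zero'
    simp
  have hrefl : B.IsRefl := by
    intro x y h
    rw [hB, dotProduct_comm, ← hB]; exact h
  have h3 := LinearMap.BilinForm.finrank_orthogonal hnd C
  have h4 : B.orthogonal C = C := by
    ext d
    rw [LinearMap.BilinForm.mem_orthogonal_iff]
    constructor
    · intro h
      exact h2 d fun c hc => by rw [← hB]; exact h c hc
    · intro hd c hc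
      show B c d = 0
      rw [hB]; exact h1 c hc d hd
  rw [h4] at h3
  have h5 : Module.finrank (ZMod 2) W = 24 := by simp
  rw [h5] at h3
  have h6 : Module.finrank (ZMod 2) C ≤ 24 := by
    exact (Submodule.finrank_le C).trans_eq h5
  omega

lemma IsLeechCoord.golay {L : Submodule ℤ (Fin 24 → ℤ)} (hL : IsLeechCoord L) :
    IsGolayCode (code L) :=
  ⟨finrank_of_selfdual _ (fun _ hc _ hd => hL.code_orth hc hd) fun _ h => hL.orth_code h,
    fun _ hc h0 => hL.code_weight hc h0⟩

lemma IsLeechCoord.mem_iff {L : Submodule ℤ (Fin 24 → ℤ)} (hL : IsLeechCoord L)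
    {u : Fin 24 → ℤ} (hu : u ∈ L) (hu1 : ∀ i, 4 ∣ u i - 1) (x : Fin 24 → ℤ) :
    x ∈ L ↔ LeechSet (code L) x := by
  choose t ht using hu1
  have hut : ∀ i, u i = 1 + 4 * t i := fun i => by have := ht i; omega
  have hsumu : (8 : ℤ) ∣ ∑ i, u i - 4 := by
    have h := hL.even u hu
    have h2 : u ⬝ᵥ u = 24 + 8 * ∑ i, t i + 16 * ∑ i, t i ^ 2 := by
      rw [dotProduct, Finset.mul_sum, Finset.mul_sum,
        show (24 : ℤ) = ∑ i : Fin 24, 1 by simp, ← Finset.sum_add_distrib, ← Finset.sum_add_distrib]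
      exact Finset.sum_congr rfl fun i _ => by rw [hut i]; ring
    have h3 : ∑ i, u i = 24 + 4 * ∑ i, t i := by
      rw [Finset.mul_sum, show (24 : ℤ) = ∑ i : Fin 24, 1 by simp, ← Finset.sum_add_distrib]
      exact Finset.sum_congr rfl fun i _ => hut i
    omega
  have heven_sum : ∀ y ∈ L, (∀ i, 2 ∣ y i) → (8 : ℤ) ∣ ∑ i, y i := by
    intro y hy h2
    have h := hL.int y hy u hu
    choose z hz using h2
    have h3 : y ⬝ᵥ u = ∑ i, y i + 8 * ∑ i, z i * t i := by
      rw [dotProduct, Finset.mul_sum, ← Finset.sum_add_distrib]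
      exact Finset.sum_congr rfl fun i _ => by rw [hut i, hz i]; ring
    omega
  have heven : ∀ y ∈ L, (∀ i, 2 ∣ y i) → (fun i => ((y i / 2 : ℤ) : ZMod 2)) ∈ code L := by
    intro y hy h2
    refine ⟨fun i => y i / 2, ?_, fun i => rfl⟩
    convert! hy using 1
    ext i
    have := h2 i
    simp
    omega
  have heven' : ∀ y : Fin 24 → ℤ, (∀ i, 2 ∣ y i) → (fun i => ((y i / 2 : ℤ) : ZMod 2)) ∈ code L →
      8 ∣ ∑ i, y i → y ∈ L := by
    rintro y h2 ⟨z, hz, hyz⟩ h8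
    have h3 : y = (2 : ℤ) • z + (y - (2 : ℤ) • z) := by abel
    rw [h3]
    refine L.add_mem hz (hL.four_mul (fun i => ?_) ?_)
    · have h4 : ((y i / 2 - z i : ℤ) : ZMod 2) = 0 := by
        have := hyz i
        push_cast
        rw [sub_eq_zero]
        simpa using this
      have h5 := (ZMod.intCast_zmod_eq_zero_iff_dvd _ 2).mp h4
      have := h2 i
      simp
      omega
    · have := heven_sum _ hz (fun i => by simp)
      simp only [Pi.sub_apply, Finset.sum_sub_distrib]
      omega
  have hdiv : ∀ i, (x - u) i / 2 = (x i - 1) / 2 - 2 * t i := by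
    intro i; simp [hut i]; omega
  have h20 : (2 : ZMod 2) = 0 := by decide
  constructor
  · intro hx
    by_cases h0 : 2 ∣ x 0
    · have h2 : ∀ i, 2 ∣ x i := fun i => by have := hL.parity hx i 0; omega
      refine ⟨0, Or.inl rfl, by simpa using h2, ?_, ?_⟩
      · simpa using heven x hx h2
      · simpa using heven_sum x hx h2
    · have h2 : ∀ i, 2 ∣ (x - u) i := fun i => by
        have := hL.parity hx i 0
        simp [hut i]
        omega
      have hxu := L.sub_mem hx hu
      refine ⟨1, Or.inr rfl, fun i => ?_, ?_, ?_⟩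
      · have := hL.parity hx i 0
        omega
      · have h3 := heven _ hxu h2
        convert! h3 using 1
        funext i
        rw [hdiv i]
        push_cast
        rw [h20]; ring
      · have h3 := heven_sum _ hxu h2
        simp only [Pi.sub_apply, Finset.sum_sub_distrib] at h3
        omega
  · rintro ⟨m, rfl | rfl, h2, h3, h4⟩
    · exact heven' x (by simpa using h2) (by simpa using h3) (by simpa using h4)
    · have : x - u ∈ L := by
        refine heven' (x - u) (fun i => ?_) ?_ ?_
        · have := h2 i
          simp [hut i]
          omega
        · convert! h3 using 1
          funext i
          rw [hdiv i]
          push_cast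
          rw [h20]; ring
        · simp only [Pi.sub_apply, Finset.sum_sub_distrib]
          omega
      have := L.add_mem this hu
      simpa using this

end FiveOrbits
end

section
open Matrix

namespace FiveOrbits

variable (Λ : EvenUnimodularLattice 24)

lemma exists_rep (φ : V →ₗ[ℤ] ℤ) : ∃ w, ∀ v, ip Λ w v = φ v := by
  have hdet : IsUnit Λ.gram.det := by rw [Λ.unimodular]; exact isUnit_one
  refine ⟨Λ.gram⁻¹ *ᵥ (fun i => φ (Pi.single i 1)), fun v => ?_⟩
  rw [ip_comm, ← inner_eq_ip, EvenUnimodularLattice.inner, mulVec_mulVec,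
    Matrix.mul_nonsing_inv _ hdet, one_mulVec, dotProduct]
  conv_rhs => rw [LinearMap.pi_apply_eq_sum_univ φ v]
  simp only [smul_eq_mul]
  refine Finset.sum_congr rfl fun i _ => ?_
  congr 2
  funext j
  simp [Pi.single_apply, eq_comm]

/-- coordinates with respect to a frame -/
noncomputable def coord (f : Fin 24 → V) : V →ₗ[ℤ] V := LinearMap.pi fun i => (ip Λ).flip (f i)

@[simp] lemma coord_apply (f : Fin 24 → V) (v : V) (i : Fin 24) : coord Λ f v i = ip Λ v (f i) := rfl

variable {Λ}

namespace IsFrame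

variable {f : Fin 24 → V}

lemma ip_eq (hf : IsFrame Λ f) (i j : Fin 24) : ip Λ (f i) (f j) = if i = j then 8 else 0 := by
  split_ifs with h
  · subst h; exact hf.self i
  · exact hf.orth i j h

lemma injective (hf : IsFrame Λ f) : Function.Injective f := by
  intro i j h
  by_contra hij
  have := hf.orth i j hij
  rw [h, hf.self] at this
  omega

lemma eq_zero (hf : IsFrame Λ f) {w : V} (hw : ∀ i, ip Λ w (f i) = 0) : w = 0 := by
  classical
  by_contra h0
  have hpos := ip_pos Λ h0
  have hnm : w ∉ Finset.univ.image f := by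
    intro h
    obtain ⟨i, -, rfl⟩ := Finset.mem_image.mp h
    rw [hw i] at hpos
    omega
  have h1 := card_le_of_orth Λ (insert w (Finset.univ.image f)) ?_ ?_
  · rw [Finset.card_insert_of_notMem hnm, Finset.card_image_of_injective _ hf.injective] at h1
    simp at h1
  · intro v hv
    rcases Finset.mem_insert.mp hv with rfl | hv
    · exact hpos.ne'
    · obtain ⟨i, -, rfl⟩ := Finset.mem_image.mp hv
      rw [hf.self]; norm_num
  · intro v hv u hu hvu
    rcases Finset.mem_insert.mp hv with rfl | hv
    · rcases Finset.mem_insert.mp hu with rfl | hu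
      · exact absurd rfl hvu
      · obtain ⟨i, -, rfl⟩ := Finset.mem_image.mp hu
        exact hw i
    · obtain ⟨i, -, rfl⟩ := Finset.mem_image.mp hv
      rcases Finset.mem_insert.mp hu with rfl | hu
      · rw [ip_comm]; exact hw i
      · obtain ⟨j, -, rfl⟩ := Finset.mem_image.mp hu
        exact hf.orth i j fun h => hvu (h ▸ rfl)

lemma ip_sum (hf : IsFrame Λ f) (x : Fin 24 → ℤ) (j : Fin 24) :
    ip Λ (∑ i, x i • f i) (f j) = 8 * x j := by
  rw [map_sum, LinearMap.sum_apply, Finset.sum_eq_single j]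
  · rw [map_smul, LinearMap.smul_apply, hf.self, smul_eq_mul]; ring
  · intro i _ hij; rw [map_smul, LinearMap.smul_apply, hf.orth i j hij, smul_zero]
  · simp

lemma parseval (hf : IsFrame Λ f) (v : V) : (8 : ℤ) • v = ∑ i, coord Λ f v i • f i := by
  rw [← sub_eq_zero]
  apply hf.eq_zero
  intro j
  rw [map_sub, LinearMap.sub_apply, hf.ip_sum, map_smul, LinearMap.smul_apply, smul_eq_mul,
    coord_apply, sub_self]

lemma ip_coord (hf : IsFrame Λ f) (v w : V) : 8 * ip Λ v w = coord Λ f v ⬝ᵥ coord Λ f w := by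
  have h := congrArg (fun t => ip Λ t w) (hf.parseval v)
  simp only [map_smul, LinearMap.smul_apply, smul_eq_mul, map_sum, LinearMap.sum_apply] at h
  rw [h, dotProduct]
  refine Finset.sum_congr rfl fun i _ => ?_
  rw [coord_apply _ _ w, ip_comm _ w]

lemma coord_injective (hf : IsFrame Λ f) : Function.Injective (coord Λ f) := by
  rw [injective_iff_map_eq_zero]
  intro v hv
  exact hf.eq_zero fun i => congrFun hv i

lemma coord_frame (hf : IsFrame Λ f) (i : Fin 24) : coord Λ f (f i) = Pi.single i 8 := by
  funext j
  rw [coord_apply, hf.ip_eq, Pi.single_apply]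
  simp only [eq_comm]

lemma isLeechCoord (hΛ : IsLeech Λ) (hf : IsFrame Λ f) : IsLeechCoord (LinearMap.range (coord Λ f)) where
  int := by
    rintro _ ⟨v, rfl⟩ _ ⟨w, rfl⟩
    rw [← hf.ip_coord]; exact dvd_mul_right _ _
  even := by
    rintro _ ⟨v, rfl⟩
    rw [← hf.ip_coord]
    have := ip_even Λ v
    omega
  min := by
    rintro _ ⟨v, rfl⟩ h0
    rw [← hf.ip_coord]
    have hv : v ≠ 0 := by rintro rfl; simp at h0
    have := four_le Λ hΛ hv
    omega
  dual := by
    intro x hx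
    have h1 : ∀ v, ∃ z, x ⬝ᵥ coord Λ f v = 8 * z := fun v => hx _ ⟨v, rfl⟩
    choose φ hφ using h1
    let φ' : V →ₗ[ℤ] ℤ :=
      { toFun := φ
        map_add' := fun v w => by
          have h1 := hφ v; have h2 := hφ w; have h3 := hφ (v + w)
          rw [map_add, dotProduct_add] at h3
          omega
        map_smul' := fun a v => by
          have h1 := hφ v; have h3 := hφ (a • v)
          rw [map_smul, dotProduct_smul, h1, smul_eq_mul] at h3
          simp only [smul_eq_mul, RingHom.id_apply]
          apply mul_left_cancel₀ (show (8 : ℤ) ≠ 0 by norm_num)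
          rw [← h3]; ring }
    obtain ⟨w, hw⟩ := exists_rep Λ φ'
    refine ⟨w, ?_⟩
    funext i
    rw [coord_apply, hw]
    have := hφ (f i)
    rw [hf.coord_frame, dotProduct_single] at this
    show φ (f i) = x i
    omega
  sub := by
    intro i j hij
    obtain ⟨z, hz⟩ := (red_eq_iff Λ _ _).mp (hf.red i j)
    refine ⟨z, ?_⟩
    have h := congrArg (coord Λ f) hz
    rw [map_sub, map_smul, hf.coord_frame, hf.coord_frame] at h
    funext k
    have := congrFun h k
    simp only [Pi.sub_apply, Pi.single_apply, Pi.smul_apply, smul_eq_mul] at this ⊢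
    split_ifs at this ⊢ <;> omega
  add := by
    intro i j hij
    obtain ⟨z, hz⟩ := red_add_of_sub ((red_eq_iff Λ _ _).mp (hf.red i j))
    refine ⟨z, ?_⟩
    have h := congrArg (coord Λ f) hz
    rw [map_add, map_smul, hf.coord_frame, hf.coord_frame] at h
    funext k
    have := congrFun h k
    simp only [Pi.add_apply, Pi.single_apply, Pi.smul_apply, smul_eq_mul] at this ⊢
    split_ifs at this ⊢ <;> omega

/-- any norm 8 vector in the class of the frame is plus or minus a frame vector -/
lemma eq_or_neg (hΛ : IsLeech Λ) (hf : IsFrame Λ f) {v : V} (h8 : ip Λ v v = 8)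
    (hr : Λ.red v = Λ.red (f 0)) : ∃ i, v = f i ∨ v = - f i := by
  by_contra! h
  have h0 : v = 0 := by
    apply hf.eq_zero
    intro i
    exact (short_classes Λ hΛ (hr.trans (hf.red 0 i)) (h i).1 (h i).2 (by omega)
      (by rw [hf.self])).2.2
  subst h0
  simp at h8

end IsFrame

lemma red_neg (v : V) : Λ.red (-v) = Λ.red v := by
  rw [red_eq_iff]
  exact ⟨-v, by rw [two_smul]; abel⟩

/-- A frame adapted to a code. -/
structure IsGood (Λ : EvenUnimodularLattice 24) (f : Fin 24 → V) (C : Submodule (ZMod 2) W) : Prop where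
  frame : IsFrame Λ f
  golay : IsGolayCode C
  mem_iff : ∀ x, x ∈ LinearMap.range (coord Λ f) ↔ LeechSet C x

theorem exists_good (hΛ : IsLeech Λ) {c : W} (hc : c ∈ frameClasses Λ) :
    ∃ f C, IsGood Λ f C ∧ ∀ i, Λ.red (f i) = c := by
  obtain ⟨f, hf, hfc⟩ := exists_frame Λ hΛ hc
  obtain ⟨u, hu, ho⟩ := (hf.isLeechCoord hΛ).exists_odd
  let f' : Fin 24 → V := fun i => if 4 ∣ u i - 1 then f i else - f i
  have hself : ∀ i, ip Λ (f' i) (f' i) = 8 := by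
    intro i; simp only [f']; split_ifs <;> simp [hf.self]
  have hred : ∀ i, Λ.red (f' i) = c := by
    intro i; simp only [f']; split_ifs
    · exact hfc i
    · rw [red_neg]; exact hfc i
  have hf' : IsFrame Λ f' := by
    refine ⟨hself, fun i j hij => ?_, fun i j => by rw [hred, hred]⟩
    simp only [f']
    split_ifs <;> simp [hf.orth i j hij]
  refine ⟨f', _, ⟨hf', (hf'.isLeechCoord hΛ).golay, ?_⟩, hred⟩
  obtain ⟨v, rfl⟩ := hu
  refine (hf'.isLeechCoord hΛ).mem_iff (u := coord Λ f' v) ⟨v, rfl⟩ ?_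
  intro i
  have := ho i
  rw [coord_apply] at this ⊢
  by_cases h : 4 ∣ coord Λ f v i - 1
  · have e : f' i = f i := if_pos h
    rw [e]; exact h
  · have e : f' i = - f i := if_neg h
    rw [coord_apply] at h
    rw [e, map_neg]; omega

end FiveOrbits
end

section
open Matrix

namespace FiveOrbits

/-- indicator word -/
def ind (S : Finset (Fin 24)) : W := fun i => if i ∈ S then 1 else 0

/-- support of a word -/
def supp (c : W) : Finset (Fin 24) := Finset.univ.filter fun i => c i ≠ 0

lemma mem_supp {c : W} {i : Fin 24} : i ∈ supp c ↔ c i ≠ 0 := by simp [supp]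

@[simp] lemma supp_ind (S : Finset (Fin 24)) : supp (ind S) = S := by
  ext i; simp [supp, ind]

@[simp] lemma ind_supp (c : W) : ind (supp c) = c := by
  funext i
  have : ∀ a : ZMod 2, (if a ≠ 0 then (1 : ZMod 2) else 0) = a := by decide
  simpa [ind, supp] using this (c i)

lemma ind_symmDiff (S T : Finset (Fin 24)) : ind (symmDiff S T) = ind S + ind T := by
  funext i
  simp only [ind, Finset.mem_symmDiff, Pi.add_apply]
  by_cases h1 : i ∈ S <;> by_cases h2 : i ∈ T <;> simp [h1, h2]
  decide

lemma ind_empty : ind ∅ = 0 := by funext i; simp [ind]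

lemma ind_injective : Function.Injective ind := fun S T h => by
  rw [← supp_ind S, h, supp_ind]

lemma card_symmDiff' (S T : Finset (Fin 24)) :
    (symmDiff S T).card + 2 * (S ∩ T).card = S.card + T.card := by
  have h1 : (symmDiff S T).card = (S \ T).card + (T \ S).card := by
    rw [symmDiff_def]
    exact Finset.card_union_of_disjoint disjoint_sdiff_sdiff
  have h2 := Finset.card_sdiff_add_card_inter S T
  have h3 := Finset.card_sdiff_add_card_inter T S
  rw [Finset.inter_comm] at h3
  omega

section
variable {C : Submodule (ZMod 2) W} (hC : IsGolayCode C)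

/-- membership of sets in the code -/
def InC (C : Submodule (ZMod 2) W) (S : Finset (Fin 24)) : Prop := ind S ∈ C

lemma InC.symmDiff {S T : Finset (Fin 24)} (h1 : InC C S) (h2 : InC C T) : InC C (symmDiff S T) := by
  unfold InC; rw [ind_symmDiff]; exact C.add_mem h1 h2

lemma InC.eq_empty (hC : IsGolayCode C) {S : Finset (Fin 24)} (h : InC C S) (hS : S.card < 8) :
    S = ∅ := by
  by_contra h0
  have h1 : ind S ≠ 0 := by rw [← ind_empty]; exact fun h => h0 (ind_injective h)
  have h2 := hC.2 _ h h1
  have h3 : (Finset.univ.filter fun i => ind S i ≠ 0) = S := supp_ind S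
  rw [h3] at h2
  omega

lemma eq_of_symmDiff (hC : IsGolayCode C) {S T : Finset (Fin 24)} (h : InC C (symmDiff S T))
    (hS : (symmDiff S T).card < 8) : S = T :=
  symmDiff_eq_bot.mp (by simpa using h.eq_empty hC hS)

/-- coset map -/
def cst (C : Submodule (ZMod 2) W) (S : Finset (Fin 24)) : W ⧸ C := Submodule.Quotient.mk (ind S)

lemma cst_eq {S T : Finset (Fin 24)} : cst C S = cst C T ↔ InC C (symmDiff S T) := by
  unfold cst InC
  rw [Submodule.Quotient.eq, ind_symmDiff, CharTwo.sub_eq_add]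

lemma card_code (hC : IsGolayCode C) : Nat.card C = 4096 := by
  have : Nat.card C = Nat.card (ZMod 2) ^ Module.finrank (ZMod 2) C := Module.natCard_eq_pow_finrank
  rw [this, hC.1]; simp

lemma card_quot (hC : IsGolayCode C) : Nat.card (W ⧸ C) = 4096 := by
  have h1 : Module.finrank (ZMod 2) (W ⧸ C) = 12 := by
    have := Submodule.finrank_quotient_add_finrank C
    rw [hC.1] at this
    simp at this
    omega
  have : Nat.card (W ⧸ C) = Nat.card (ZMod 2) ^ Module.finrank (ZMod 2) (W ⧸ C) :=
    Module.natCard_eq_pow_finrank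
  rw [this, h1]; simp

open scoped Classical in
/-- 4-sets equivalent to a given one -/
noncomputable def tet (C : Submodule (ZMod 2) W) (q : W ⧸ C) : Finset (Finset (Fin 24)) :=
  (Finset.powersetCard 4 Finset.univ).filter fun T => cst C T = q

lemma mem_tet {q : W ⧸ C} {T : Finset (Fin 24)} : T ∈ tet C q ↔ T.card = 4 ∧ cst C T = q := by
  classical
  rw [tet, Finset.mem_filter, Finset.mem_powersetCard_univ]

lemma tet_disj (hC : IsGolayCode C) (q : W ⧸ C) :
    ∀ S ∈ tet C q, ∀ T ∈ tet C q, S ≠ T → Disjoint S T := by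
  intro S hS T hT hne
  rw [mem_tet] at hS hT
  have h1 := cst_eq.mp (hS.2.trans hT.2.symm)
  by_contra hd
  have h2 : 0 < (S ∩ T).card := by
    rw [Finset.card_pos, Finset.nonempty_iff_ne_empty]
    exact fun h => hd (Finset.disjoint_iff_inter_eq_empty.mpr h)
  have h3 := card_symmDiff' S T
  exact hne (eq_of_symmDiff hC h1 (by omega))

lemma tet_union (hC : IsGolayCode C) (q : W ⧸ C) : ((tet C q).biUnion id).card = 4 * (tet C q).card := by
  rw [Finset.card_biUnion (t := id) (fun S hS T hT h => tet_disj hC q S hS T hT h), Finset.sum_const_nat (m := 4)]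
  · ring
  · intro T hT; exact (mem_tet.mp hT).1

lemma tet_card_le (hC : IsGolayCode C) (q : W ⧸ C) : (tet C q).card ≤ 6 := by
  have h := tet_union hC q
  have h2 := Finset.card_le_univ ((tet C q).biUnion id)
  rw [Fintype.card_fin] at h2
  omega

open scoped Classical in
theorem tet_card (hC : IsGolayCode C) {S : Finset (Fin 24)} (hS : S.card = 4) :
    (tet C (cst C S)).card = 6 := by
  have : Fintype (W ⧸ C) := Fintype.ofFinite _
  set A : Finset (Finset (Fin 24)) := (Finset.range 4).biUnion fun k => Finset.powersetCard k Finset.univ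
    with hA
  set B : Finset (Finset (Fin 24)) := Finset.powersetCard 4 Finset.univ with hB
  have hAm : ∀ S, S ∈ A ↔ S.card < 4 := by
    intro S; simp [hA, Finset.mem_powersetCard]
  have hAc : A.card = 2325 := by
    rw [hA, Finset.card_biUnion]
    · simp [Finset.sum_range_succ, Finset.card_powersetCard, Nat.choose]
    · intro x _ y _ hxy
      exact Finset.pairwise_disjoint_powersetCard _ hxy
  have hBc : B.card = 10626 := by
    rw [hB, Finset.card_powersetCard]; simp [Nat.choose]
  have hq : (Finset.univ : Finset (W ⧸ C)).card = 4096 := by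
    rw [← card_quot hC, Finset.card_univ, Nat.card_eq_fintype_card]
  have hAi : (A.image (cst C)).card = 2325 := by
    rw [← hAc]
    apply Finset.card_image_of_injOn
    intro S hS T hT h
    have hS' := (hAm S).mp hS
    have hT' := (hAm T).mp hT
    have h3 := card_symmDiff' S T
    exact eq_of_symmDiff hC (cst_eq.mp h) (by omega)
  have hdis : Disjoint (A.image (cst C)) (B.image (cst C)) := by
    rw [Finset.disjoint_left]
    intro q h1 h2
    obtain ⟨S, hS, rfl⟩ := Finset.mem_image.mp h1
    obtain ⟨T, hT, h⟩ := Finset.mem_image.mp h2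
    have hS' := (hAm S).mp hS
    have hT' : T.card = 4 := Finset.mem_powersetCard_univ.mp hT
    have h3 := card_symmDiff' T S
    have := eq_of_symmDiff hC (cst_eq.mp h) (by omega)
    subst this
    omega
  have hBi : (B.image (cst C)).card ≤ 1771 := by
    have := Finset.card_le_univ (A.image (cst C) ∪ B.image (cst C))
    rw [Finset.card_union_of_disjoint hdis, hAi, ← Finset.card_univ, hq] at this
    omega
  have hsum : B.card = ∑ q ∈ B.image (cst C), (tet C q).card :=
    Finset.card_eq_sum_card_fiberwise fun x hx => Finset.mem_image_of_mem _ hx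
  have hmem : cst C S ∈ B.image (cst C) :=
    Finset.mem_image_of_mem _ (Finset.mem_powersetCard_univ.mpr hS)
  rw [← Finset.add_sum_erase _ _ hmem] at hsum
  have h4 : ∑ q ∈ (B.image (cst C)).erase (cst C S), (tet C q).card ≤
      ((B.image (cst C)).erase (cst C S)).card * 6 :=
    Finset.sum_le_card_nsmul _ _ _ fun q _ => tet_card_le hC q
  rw [Finset.card_erase_of_mem hmem] at h4
  have h5 := tet_card_le hC (cst C S)
  have h6 := Finset.card_pos.mpr ⟨_, hmem⟩
  omega

/-- octads -/
def IsOct (C : Submodule (ZMod 2) W) (O : Finset (Fin 24)) : Prop := O.card = 8 ∧ InC C O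

lemma IsOct.eq (hC : IsGolayCode C) {S T : Finset (Fin 24)} (hS : IsOct C S) (hT : IsOct C T)
    (h : 5 ≤ (S ∩ T).card) : S = T := by
  have h3 := card_symmDiff' S T
  rw [hS.1, hT.1] at h3
  exact eq_of_symmDiff hC (hS.2.symmDiff hT.2) (by omega)

theorem steiner' (hC : IsGolayCode C) {S : Finset (Fin 24)} (hS : S.card = 4) {p : Fin 24} (hp : p ∉ S) :
    ∃ O, IsOct C O ∧ S ⊆ O ∧ p ∈ O := by
  classical
  have h1 := tet_card hC hS
  have h2 := tet_union hC (cst C S)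
  rw [h1] at h2
  have h3 : (tet C (cst C S)).biUnion id = Finset.univ := by
    rw [← Finset.card_eq_iff_eq_univ, h2]; simp
  have h4 : p ∈ (tet C (cst C S)).biUnion id := by rw [h3]; simp
  obtain ⟨T, hT, hpT⟩ := Finset.mem_biUnion.mp h4
  have hSm : S ∈ tet C (cst C S) := mem_tet.mpr ⟨hS, rfl⟩
  have hne : S ≠ T := by rintro rfl; exact hp hpT
  have hd := tet_disj hC _ S hSm T hT hne
  have hT' := mem_tet.mp hT
  have h5 : symmDiff S T = S ∪ T := by
    rw [← Finset.sup_eq_union]; exact hd.symmDiff_eq_sup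
  refine ⟨S ∪ T, ⟨?_, ?_⟩, Finset.subset_union_left, Finset.mem_union_right _ hpT⟩
  · rw [Finset.card_union_of_disjoint hd, hS, hT'.1]
  · rw [← h5]; exact cst_eq.mp hT'.2.symm

theorem steiner (hC : IsGolayCode C) {F : Finset (Fin 24)} (hF : F.card = 5) :
    ∃ O, IsOct C O ∧ F ⊆ O := by
  obtain ⟨p, hp⟩ : F.Nonempty := Finset.card_pos.mp (by omega)
  obtain ⟨O, h1, h2, h3⟩ := steiner' hC (S := F.erase p) (p := p)
    (by rw [Finset.card_erase_of_mem hp, hF]) (by simp)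
  refine ⟨O, h1, ?_⟩
  rw [← Finset.insert_erase hp, Finset.insert_subset_iff]
  exact ⟨h3, h2⟩

theorem no_three (hC : IsGolayCode C) {S T : Finset (Fin 24)} (hS : IsOct C S) (hT : IsOct C T) :
    (S ∩ T).card ≠ 3 := by
  intro h3
  have hST := Finset.card_sdiff_add_card_inter S T
  have hTS := Finset.card_sdiff_add_card_inter T S
  rw [Finset.inter_comm, h3, hT.1] at hTS
  rw [h3, hS.1] at hST
  obtain ⟨d, hd⟩ : (S \ T).Nonempty := Finset.card_pos.mp (by omega)
  rw [Finset.mem_sdiff] at hd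
  set F := insert d (S ∩ T) with hF
  have hdn : d ∉ S ∩ T := fun h => hd.2 (Finset.mem_inter.mp h).2
  have hFc : F.card = 4 := by rw [hF, Finset.card_insert_of_notMem hdn, h3]
  have hFS : F ⊆ S := by
    rw [hF, Finset.insert_subset_iff]; exact ⟨hd.1, Finset.inter_subset_left⟩
  have hex : ∀ p : Fin 24, ∃ O, p ∈ T \ S → IsOct C O ∧ F ⊆ O ∧ p ∈ O := by
    intro p
    by_cases hp : p ∈ T \ S
    · obtain ⟨O, hO⟩ := steiner' hC hFc (p := p) (fun h => (Finset.mem_sdiff.mp hp).2 (hFS h))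
      exact ⟨O, fun _ => hO⟩
    · exact ⟨∅, fun h => absurd h hp⟩
  choose Q hQ using hex
  -- the octads `Q p` meet `T` only in `S ∩ T` and `p`
  have hQS : ∀ p ∈ T \ S, Disjoint (Q p \ F) S := by
    intro p hp
    rw [Finset.disjoint_left]
    intro x hx hxS
    rw [Finset.mem_sdiff] at hx
    have h5 : insert x F ⊆ Q p ∩ S := by
      rw [Finset.insert_subset_iff]
      exact ⟨Finset.mem_inter.mpr ⟨hx.1, hxS⟩, Finset.subset_inter (hQ p hp).2.1 hFS⟩
    have h6 := Finset.card_le_card h5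
    rw [Finset.card_insert_of_notMem hx.2, hFc] at h6
    have h7 := (hQ p hp).1.eq hC hS h6
    have h8 := (hQ p hp).2.2
    rw [h7] at h8
    exact (Finset.mem_sdiff.mp hp).2 h8
  have hQT : ∀ p ∈ T \ S, ∀ p' ∈ T \ S, p' ∈ Q p → p' = p := by
    intro p hp p' hp' hm
    by_contra hne
    have h5 : insert p (insert p' (S ∩ T)) ⊆ Q p ∩ T := by
      rw [Finset.insert_subset_iff, Finset.insert_subset_iff]
      refine ⟨Finset.mem_inter.mpr ⟨(hQ p hp).2.2, (Finset.mem_sdiff.mp hp).1⟩,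
        Finset.mem_inter.mpr ⟨hm, (Finset.mem_sdiff.mp hp').1⟩, Finset.subset_inter
          ((Finset.subset_insert _ _).trans (hQ p hp).2.1) Finset.inter_subset_right⟩
    have h6 := Finset.card_le_card h5
    have hp1 := (Finset.mem_sdiff.mp hp).2
    have hp2 := (Finset.mem_sdiff.mp hp').2
    rw [Finset.card_insert_of_notMem, Finset.card_insert_of_notMem, h3] at h6
    · have h7 := (hQ p hp).1.eq hC hT h6
      have h8 : d ∈ Q p := (hQ p hp).2.1 (Finset.mem_insert_self _ _)
      rw [h7] at h8
      exact hd.2 h8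
    · exact fun h => hp2 (Finset.mem_inter.mp h).1
    · intro h
      rcases Finset.mem_insert.mp h with h | h
      · exact hne h.symm
      · exact hp1 (Finset.mem_inter.mp h).1
  have hdisj : ∀ p ∈ T \ S, ∀ p' ∈ T \ S, p ≠ p' → Disjoint (Q p \ F) (Q p' \ F) := by
    intro p hp p' hp' hne
    rw [Finset.disjoint_left]
    intro x hx hx'
    rw [Finset.mem_sdiff] at hx hx'
    have h5 : insert x F ⊆ Q p ∩ Q p' := by
      rw [Finset.insert_subset_iff]
      exact ⟨Finset.mem_inter.mpr ⟨hx.1, hx'.1⟩, Finset.subset_inter (hQ p hp).2.1 (hQ p' hp').2.1⟩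
    have h6 := Finset.card_le_card h5
    rw [Finset.card_insert_of_notMem hx.2, hFc] at h6
    have h7 := (hQ p hp).1.eq hC (hQ p' hp').1 h6
    have h8 := (hQ p' hp').2.2
    rw [← h7] at h8
    exact hne (hQT p hp p' hp' h8).symm
  have hU : ((T \ S).biUnion fun p => Q p \ F).card = 5 * 4 := by
    rw [Finset.card_biUnion hdisj, Finset.sum_const_nat (m := 4)]
    · rw [show (T \ S).card = 5 by omega]
    · intro p hp
      rw [Finset.card_sdiff_of_subset (hQ p hp).2.1, (hQ p hp).1.1, hFc]
  have hsub : ((T \ S).biUnion fun p => Q p \ F) ⊆ Sᶜ := by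
    intro x hx
    obtain ⟨p, hp, hxp⟩ := Finset.mem_biUnion.mp hx
    rw [Finset.mem_compl]
    exact Finset.disjoint_left.mp (hQS p hp) hxp
  have := Finset.card_le_card hsub
  rw [hU, Finset.card_compl, hS.1] at this
  simp at this

end

end FiveOrbits
end

section
open Matrix

namespace FiveOrbits

/-! ### Bit masks -/

/-- the bit `i` of the mask `m` -/
def tb (m i : ℕ) : Bool := Nat.beq (Nat.mod (Nat.shiftRight m i) 2) 1

lemma tb_eq (m i : ℕ) : tb m i = m.testBit i := by
  rw [Nat.testBit_eq_decide_div_mod_eq, ← Nat.shiftRight_eq_div_pow]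
  show Nat.beq ((m >>> i) % 2) 1 = _
  rw [Bool.eq_iff_iff, Nat.beq_eq, decide_eq_true_iff]

/-- the word of a mask -/
def wd (m : ℕ) : W := fun i => if m.testBit i then 1 else 0

/-- the set of a mask -/
def ms (m : ℕ) : Finset (Fin 24) := Finset.univ.filter fun i => m.testBit i

lemma mem_ms {m : ℕ} {i : Fin 24} : i ∈ ms m ↔ m.testBit i = true := by simp [ms]

lemma ind_ms (m : ℕ) : ind (ms m) = wd m := by
  funext i; simp [ind, wd, mem_ms]

lemma wd_xor (a b : ℕ) : wd (a ^^^ b) = wd a + wd b := by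
  funext i
  simp only [wd, Nat.testBit_xor, Pi.add_apply]
  cases a.testBit i <;> cases b.testBit i <;> simp <;> decide

lemma wd_zero : wd 0 = 0 := by funext i; simp [wd]

/-- number of bits of `u` at the positions of the list -/
def cnt (u : ℕ) : List ℕ → ℕ
  | [] => 0
  | i :: l => Nat.add (Nat.mod (Nat.shiftRight u i) 2) (cnt u l)

lemma cnt_cons (u i : ℕ) (l : List ℕ) : cnt u (i :: l) = (if u.testBit i then 1 else 0) + cnt u l := by
  show (u >>> i) % 2 + cnt u l = _
  congr 1
  rw [Nat.testBit_eq_decide_div_mod_eq, ← Nat.shiftRight_eq_div_pow]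
  have := Nat.mod_two_eq_zero_or_one (u >>> i)
  rcases this with h | h <;> simp [h]

/-- set of points in a list -/
def ls (l : List ℕ) : Finset (Fin 24) := Finset.univ.filter fun i => (i : ℕ) ∈ l

lemma mem_ls {l : List ℕ} {i : Fin 24} : i ∈ ls l ↔ (i : ℕ) ∈ l := by simp [ls]

lemma ls_cons (x : Fin 24) (l : List ℕ) : ls ((x : ℕ) :: l) = insert x (ls l) := by
  ext i; simp [mem_ls, Fin.ext_iff]

lemma cnt_eq (u : ℕ) : ∀ (l : List ℕ), l.Nodup → (∀ i ∈ l, i < 24) → cnt u l = (ms u ∩ ls l).card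
  | [], _, _ => by simp [cnt, ls]
  | i :: l, h1, h2 => by
    rw [List.nodup_cons] at h1
    have hi : i < 24 := h2 i (by simp)
    have e : i = ((⟨i, hi⟩ : Fin 24) : ℕ) := rfl
    rw [cnt_cons, cnt_eq u l h1.2 (fun j hj => h2 j (by simp [hj])), e, ls_cons]
    have hn : (⟨i, hi⟩ : Fin 24) ∉ ms u ∩ ls l := by
      simp [mem_ls, h1.1]
    split_ifs with h
    · rw [Finset.inter_insert_of_mem (mem_ms.mpr h), Finset.card_insert_of_notMem hn]; ring
    · rw [Finset.inter_insert_of_notMem (fun h' => h (mem_ms.mp h')), zero_add]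

lemma ls_card (l : List ℕ) (h1 : l.Nodup) (h2 : ∀ i ∈ l, i < 24) : (ls l).card = l.length := by
  have h := cnt_eq (2 ^ 24 - 1) l h1 h2
  have e : ms (2 ^ 24 - 1) = Finset.univ := by
    ext i; simp only [mem_ms, Finset.mem_univ, iff_true]
    rw [Nat.testBit_two_pow_sub_one]; simp
  rw [e, Finset.univ_inter] at h
  rw [← h]
  clear h h1
  induction l with
  | nil => rfl
  | cons i l ih =>
    rw [cnt_cons, ih (fun j hj => h2 j (by simp [hj])), Nat.testBit_two_pow_sub_one]
    simp [h2 i (by simp), add_comm]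

/-- mask of a list -/
def mk : List ℕ → ℕ
  | [] => 0
  | i :: l => Nat.xor (Nat.pow 2 i) (mk l)

lemma testBit_mk : ∀ (l : List ℕ), l.Nodup → ∀ i, (mk l).testBit i = decide (i ∈ l)
  | [], _, i => by simp [mk]
  | j :: l, h, i => by
    rw [List.nodup_cons] at h
    show (2 ^ j ^^^ mk l).testBit i = _
    rw [Nat.testBit_xor, testBit_mk l h.2, Nat.testBit_two_pow]
    by_cases hij : j = i
    · subst hij; simp [h.1]
    · simp [hij, Ne.symm hij]

lemma ms_mk (l : List ℕ) (h : l.Nodup) : ms (mk l) = ls l := by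
  ext i; simp [mem_ms, mem_ls, testBit_mk l h]

/-! ### Swaps -/

/-- swap two bits -/
def sw (m a b : ℕ) : ℕ :=
  if Nat.beq (Nat.mod (Nat.shiftRight m a) 2) (Nat.mod (Nat.shiftRight m b) 2) then m
  else Nat.xor m (Nat.xor (Nat.pow 2 a) (Nat.pow 2 b))

lemma testBit_sw (m a b i : ℕ) : (sw m a b).testBit i = m.testBit (Equiv.swap a b i) := by
  unfold sw
  have hc : (Nat.beq (Nat.mod (Nat.shiftRight m a) 2) (Nat.mod (Nat.shiftRight m b) 2) = true) ↔
      m.testBit a = m.testBit b := by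
    rw [Nat.beq_eq, Nat.testBit_eq_decide_div_mod_eq, Nat.testBit_eq_decide_div_mod_eq,
      ← Nat.shiftRight_eq_div_pow, ← Nat.shiftRight_eq_div_pow]
    show (m >>> a) % 2 = (m >>> b) % 2 ↔ _
    have h1 := Nat.mod_two_eq_zero_or_one (m >>> a)
    have h2 := Nat.mod_two_eq_zero_or_one (m >>> b)
    rcases h1 with h1 | h1 <;> rcases h2 with h2 | h2 <;> simp [h1, h2]
  by_cases h : m.testBit a = m.testBit b
  · rw [if_pos (hc.mpr h)]
    by_cases h1 : i = a
    · subst h1; rw [Equiv.swap_apply_left]; exact h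
    · by_cases h2 : i = b
      · subst h2; rw [Equiv.swap_apply_right]; exact h.symm
      · rw [Equiv.swap_apply_of_ne_of_ne h1 h2]
  · rw [if_neg (fun h' => h (hc.mp h'))]
    show (m ^^^ (2 ^ a ^^^ 2 ^ b)).testBit i = _
    rw [Nat.testBit_xor, Nat.testBit_xor, Nat.testBit_two_pow, Nat.testBit_two_pow]
    have hab : a ≠ b := by rintro rfl; exact h rfl
    by_cases h1 : i = a
    · subst h1; rw [Equiv.swap_apply_left]
      revert h
      cases m.testBit i <;> cases m.testBit b <;> simp [hab.symm]
    · by_cases h2 : i = b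
      · subst h2; rw [Equiv.swap_apply_right]
        revert h
        cases m.testBit i <;> cases m.testBit a <;> simp [hab]
      · rw [Equiv.swap_apply_of_ne_of_ne h1 h2]
        simp [Ne.symm h1, Ne.symm h2]

/-- evaluate a natural number before continuing -/
def force {α : Type} (x : ℕ) (f : ℕ → α) : α :=
  match x with
  | 0 => f 0
  | n + 1 => f (Nat.succ n)

lemma force_eq {α : Type} (x : ℕ) (f : ℕ → α) : force x f = f x := by
  cases x <;> rfl

/-- apply swaps in order -/
def ap : List (ℕ × ℕ) → ℕ → ℕ
  | [], m => m
  | s :: l, m => force (sw m s.1 s.2) (ap l)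

/-- pull back of a code by a permutation -/
def pull (σ : Equiv.Perm (Fin 24)) (C : Submodule (ZMod 2) W) : Submodule (ZMod 2) W :=
  C.comap (LinearMap.funLeft (ZMod 2) (ZMod 2) σ)

lemma mem_pull {σ : Equiv.Perm (Fin 24)} {C : Submodule (ZMod 2) W} {c : W} :
    c ∈ pull σ C ↔ (fun i => c (σ i)) ∈ C := Iff.rfl

lemma pull_one (C : Submodule (ZMod 2) W) : pull 1 C = C := rfl

lemma pull_mul (σ τ : Equiv.Perm (Fin 24)) (C : Submodule (ZMod 2) W) :
    pull (σ * τ) C = pull σ (pull τ C) := rfl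

lemma pull_golay {C : Submodule (ZMod 2) W} (hC : IsGolayCode C) (σ : Equiv.Perm (Fin 24)) :
    IsGolayCode (pull σ C) := by
  constructor
  · rw [← hC.1]
    have e : pull σ C = C.comap (LinearEquiv.funCongrLeft (ZMod 2) (ZMod 2) σ).toLinearMap := rfl
    rw [e, Submodule.comap_equiv_eq_map_symm, LinearEquiv.finrank_map_eq]
  · intro c hc h0
    have h1 : (fun i => c (σ i)) ≠ 0 := by
      intro h
      apply h0
      funext i
      simpa using congrFun h (σ.symm i)
    have h2 := hC.2 _ hc h1
    refine h2.trans (le_of_eq ?_)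
    apply Finset.card_bij (fun i _ => σ i)
    · intro i hi; simp only [Finset.mem_filter, Finset.mem_univ, true_and] at hi ⊢; exact hi
    · intro i _ j _ h; exact σ.injective h
    · intro i hi
      refine ⟨σ.symm i, ?_, by simp⟩
      simp only [Finset.mem_filter, Finset.mem_univ, true_and] at hi ⊢
      show c (σ (σ.symm i)) ≠ 0
      rw [Equiv.apply_symm_apply]; exact hi

/-- permutations respecting the flag `0, 1, {2,3}` -/
def Flag (σ : Equiv.Perm (Fin 24)) : Prop :=
  σ 0 = 0 ∧ σ 1 = 1 ∧ (σ 2 = 2 ∨ σ 2 = 3) ∧ (σ 3 = 2 ∨ σ 3 = 3)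

lemma Flag.mul {σ τ : Equiv.Perm (Fin 24)} (h1 : Flag σ) (h2 : Flag τ) : Flag (σ * τ) := by
  obtain ⟨a, b, c, d⟩ := h1
  obtain ⟨a', b', c', d'⟩ := h2
  refine ⟨?_, ?_, ?_, ?_⟩ <;> rw [Equiv.Perm.mul_apply]
  · rw [a', a]
  · rw [b', b]
  · rcases c' with h | h <;> rw [h] <;> assumption
  · rcases d' with h | h <;> rw [h] <;> assumption

/-- admissible swaps -/
def okSwap (s : ℕ × ℕ) : Bool :=
  (Nat.ble 4 s.1 && Nat.ble 4 s.2 && Nat.ble s.1 23 && Nat.ble s.2 23) || (Nat.beq s.1 2 && Nat.beq s.2 3)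

lemma exists_perm : ∀ (l : List (ℕ × ℕ)), l.all okSwap = true →
    ∃ σ, Flag σ ∧ ∀ m, wd (ap l m) = fun i => wd m (σ i)
  | [], _ => ⟨1, ⟨rfl, rfl, Or.inl rfl, Or.inr rfl⟩, fun _ => rfl⟩
  | s :: l, h => by
    rw [List.all_cons, Bool.and_eq_true] at h
    obtain ⟨σ, hσ, h2⟩ := exists_perm l h.2
    have h3 := h.1
    obtain ⟨a, b⟩ := s
    simp only [okSwap, Bool.or_eq_true, Bool.and_eq_true, Nat.ble_eq, Nat.beq_eq] at h3
    have ha : a < 24 := by omega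
    have hb : b < 24 := by omega
    refine ⟨Equiv.swap ⟨a, ha⟩ ⟨b, hb⟩ * σ, Flag.mul ?_ hσ, fun m => ?_⟩
    · rcases h3 with h3 | ⟨rfl, rfl⟩
      · have : ∀ i : Fin 24, (i : ℕ) < 4 → Equiv.swap (⟨a, ha⟩ : Fin 24) ⟨b, hb⟩ i = i := by
          intro i hi
          apply Equiv.swap_apply_of_ne_of_ne
          · rintro rfl; simp at hi; omega
          · rintro rfl; simp at hi; omega
        exact ⟨this 0 (by decide), this 1 (by decide), Or.inl (this 2 (by decide)),
          Or.inr (this 3 (by decide))⟩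
      · refine ⟨?_, ?_, ?_, ?_⟩ <;> decide +revert
    · show wd (force (sw m a b) (ap l)) = _
      rw [force_eq, h2]
      funext i
      simp only [wd, Equiv.Perm.mul_apply]
      rw [testBit_sw]
      have : Equiv.swap a b (σ i : ℕ) = ((Equiv.swap (⟨a, ha⟩ : Fin 24) ⟨b, hb⟩ (σ i) : Fin 24) : ℕ) := by
        simp only [Equiv.swap_apply_def, Fin.ext_iff]
        split_ifs <;> rfl
      rw [this]
      rfl

/-! ### Reduction modulo a list of words with pivots -/

/-- reduce modulo words -/
def rd : List (ℕ × ℕ) → ℕ → ℕ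
  | [], x => x
  | w :: t, x => if tb x w.2 then force (Nat.xor x w.1) (rd t) else rd t x

lemma rd_sound {C : Submodule (ZMod 2) W} : ∀ (ws : List (ℕ × ℕ)), (∀ w ∈ ws, wd w.1 ∈ C) → ∀ x,
    (wd (rd ws x) ∈ C ↔ wd x ∈ C)
  | [], _, x => Iff.rfl
  | w :: t, h, x => by
    have ih := rd_sound t fun w hw => h w (by simp [hw])
    unfold rd
    split_ifs with hb
    · rw [force_eq, ih]
      show wd (x ^^^ w.1) ∈ C ↔ _
      rw [wd_xor]
      exact Submodule.add_mem_iff_left _ (h w (by simp))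
    · exact ih x

/-- forbidden intersection numbers of octads -/
def badc (n : ℕ) : Bool := Nat.beq n 3 || Nat.beq n 5 || Nat.beq n 6 || Nat.beq n 7

/-- iterate over ordered triples of points -/
def allT (f : ℕ → ℕ → ℕ → Bool) : Bool :=
  (List.range 24).all fun i => (List.range i).all fun j => (List.range j).all fun k => f k j i

lemma allT_spec {f : ℕ → ℕ → ℕ → Bool} (h : allT f = true) {k j i : ℕ} (h1 : k < j) (h2 : j < i)
    (h3 : i < 24) : f k j i = true := by
  simp only [allT, List.all_eq_true, List.mem_range] at h
  exact h i h3 j h2 k h1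

/-- test for a single candidate -/
def chk1 (ws : List (ℕ × ℕ)) (tgt : ℕ) (m : ℕ) (s : List (ℕ × ℕ)) : Bool :=
  s.all okSwap && Nat.beq (rd ws (Nat.xor m (ap s tgt))) 0 &&
    ws.all fun w => force (ap s w.1) fun x =>
      Nat.beq (rd ws x) 0 || Nat.beq (rd ws (Nat.xor m x)) 0

/-- the test for one step -/
def chk (ws : List (ℕ × ℕ)) (tests : List ℕ) (F : List ℕ) (tgt : ℕ)
    (sl : ℕ → ℕ → ℕ → List (List (ℕ × ℕ))) : Bool :=
  (tests.all fun u => Nat.beq (cnt u (List.range 24)) 8 && Nat.beq (rd ws u) 0) &&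
  allT fun k j i => tb (mk F) i || tb (mk F) j || tb (mk F) k ||
    (tests.any fun u => badc (cnt u (k :: j :: i :: F))) ||
    force (mk (k :: j :: i :: F)) fun m => (sl k j i).any (chk1 ws tgt m)

theorem step {C : Submodule (ZMod 2) W} (hC : IsGolayCode C) (ws : List (ℕ × ℕ))
    (hws : ∀ w ∈ ws, wd w.1 ∈ C) (tests : List ℕ) (F : List ℕ) (tgt : ℕ)
    (sl : ℕ → ℕ → ℕ → List (List (ℕ × ℕ))) (hF : F.Nodup ∧ (∀ i ∈ F, i < 24) ∧ F.length = 5)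
    (h : chk ws tests F tgt sl = true) :
    ∃ σ, Flag σ ∧ wd tgt ∈ pull σ C ∧ ∀ w ∈ ws, wd w.1 ∈ pull σ C := by
  rw [chk, Bool.and_eq_true] at h
  obtain ⟨ht, h⟩ := h
  obtain ⟨O, hO, hFO⟩ := steiner hC (F := ls F) (by rw [ls_card F hF.1 hF.2.1, hF.2.2])
  have hc : (O \ ls F).card = 3 := by
    rw [Finset.card_sdiff_of_subset hFO, hO.1, ls_card F hF.1 hF.2.1, hF.2.2]
  let e := (O \ ls F).orderEmbOfFin hc
  have hm : ∀ a, e a ∈ O \ ls F := fun a => Finset.orderEmbOfFin_mem _ hc a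
  have h01 : e 0 < e 1 := e.strictMono (by decide)
  have h12 : e 1 < e 2 := e.strictMono (by decide)
  have hnF : ∀ a, ((e a : Fin 24) : ℕ) ∉ F := fun a ha =>
    (Finset.mem_sdiff.mp (hm a)).2 (mem_ls.mpr ha)
  have h := allT_spec h h01 h12 (e 2).2
  set k : ℕ := ((e 0 : Fin 24) : ℕ) with hk
  set j : ℕ := ((e 1 : Fin 24) : ℕ) with hj
  set i : ℕ := ((e 2 : Fin 24) : ℕ) with hi
  have hkj : k < j := h01
  have hji : j < i := h12
  have hnd : (k :: j :: i :: F).Nodup := by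
    simp only [List.nodup_cons, List.mem_cons, not_or]
    exact ⟨⟨by omega, by omega, hnF 0⟩, ⟨by omega, hnF 1⟩, hnF 2, hF.1⟩
  have hlt : ∀ x ∈ (k :: j :: i :: F), x < 24 := by
    intro x hx
    simp only [List.mem_cons] at hx
    rcases hx with rfl | rfl | rfl | hx
    · exact (e 0).2
    · exact (e 1).2
    · exact (e 2).2
    · exact hF.2.1 x hx
  have hOl : ls (k :: j :: i :: F) = O := by
    apply Finset.eq_of_subset_of_card_le
    · rw [hk, hj, hi, ls_cons, ls_cons, ls_cons, Finset.insert_subset_iff, Finset.insert_subset_iff,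
        Finset.insert_subset_iff]
      exact ⟨(Finset.mem_sdiff.mp (hm 0)).1, (Finset.mem_sdiff.mp (hm 1)).1,
        (Finset.mem_sdiff.mp (hm 2)).1, hFO⟩
    · rw [ls_card _ hnd hlt, hO.1]; simp [hF.2.2]
  have hnF' : ∀ a, tb (mk F) (e a : Fin 24) = false := fun a => by
    rw [tb_eq, testBit_mk F hF.1]; simpa using hnF a
  have hk' := hnF' 0
  have hj' := hnF' 1
  have hi' := hnF' 2
  rw [← hk] at hk'
  rw [← hj] at hj'
  rw [← hi] at hi'
  rw [hk', hj', hi', Bool.false_or, Bool.false_or, Bool.false_or, Bool.or_eq_true, force_eq] at h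
  have hmO : wd (mk (k :: j :: i :: F)) ∈ C := by
    rw [← ind_ms, ms_mk _ hnd, hOl]; exact hO.2
  rcases h with h | h
  · exfalso
    obtain ⟨u, hu, hb⟩ := List.any_eq_true.mp h
    have hu' := List.all_eq_true.mp ht u hu
    rw [Bool.and_eq_true, Nat.beq_eq, Nat.beq_eq] at hu'
    have huC : wd u ∈ C := by
      rw [← rd_sound ws hws, hu'.2, wd_zero]; exact C.zero_mem
    have h24 : ls (List.range 24) = Finset.univ := by
      ext x; simp [mem_ls]
    have huo : IsOct C (ms u) := by
      refine ⟨?_, ?_⟩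
      · have := cnt_eq u (List.range 24) List.nodup_range (by simp)
        rw [h24, Finset.inter_univ, hu'.1] at this
        exact this.symm
      · unfold InC; rw [ind_ms]; exact huC
    rw [cnt_eq u _ hnd hlt, hOl] at hb
    simp only [badc, Bool.or_eq_true, Nat.beq_eq] at hb
    have h3 := no_three hC huo hO
    by_cases h5 : 5 ≤ (ms u ∩ O).card
    · have h6 := huo.eq hC hO h5
      rw [h6, Finset.inter_self, hO.1] at hb
      omega
    · omega
  · obtain ⟨s, hs, hb⟩ := List.any_eq_true.mp h
    rw [chk1, Bool.and_eq_true, Bool.and_eq_true, Nat.beq_eq] at hb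
    obtain ⟨⟨h1, h2⟩, h3⟩ := hb
    obtain ⟨σ, hσ, hap⟩ := exists_perm s h1
    have hx : ∀ x, rd ws (Nat.xor (mk (k :: j :: i :: F)) x) = 0 → wd x ∈ C := by
      intro x hx
      have h4 : wd (Nat.xor (mk (k :: j :: i :: F)) x) ∈ C := by
        rw [← rd_sound ws hws, hx, wd_zero]; exact C.zero_mem
      have h5 : wd ((mk (k :: j :: i :: F)) ^^^ x) ∈ C := h4
      rw [wd_xor] at h5
      exact (Submodule.add_mem_iff_right _ hmO).mp h5
    refine ⟨σ, hσ, ?_, ?_⟩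
    · rw [mem_pull, ← hap]
      exact hx _ h2
    · intro w hw
      have h4 := List.all_eq_true.mp h3 w hw
      rw [force_eq, Bool.or_eq_true, Nat.beq_eq, Nat.beq_eq] at h4
      rw [mem_pull, ← hap]
      rcases h4 with h4 | h4
      · rw [← rd_sound ws hws, h4, wd_zero]; exact C.zero_mem
      · exact hx _ h4

end FiveOrbits
end

section
open Matrix

namespace FiveOrbits

/-! ### Uniqueness of the Golay code -/

lemma uq1 {C : Submodule (ZMod 2) W} (hC : IsGolayCode C) :
    ∃ σ, Flag σ ∧ ∀ w ∈ ([(255, 7)] : List (ℕ × ℕ)), wd w.1 ∈ pull σ C := by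
  have h : ∀ w ∈ ([] : List (ℕ × ℕ)), wd w.1 ∈ C := by simp
  obtain ⟨τ, hτ, h1⟩ : ∃ σ, Flag σ ∧ ∀ w ∈ ([] : List (ℕ × ℕ)), wd w.1 ∈ pull σ C :=
    ⟨1, ⟨rfl, rfl, Or.inl rfl, Or.inr rfl⟩, h⟩
  obtain ⟨σ, hσ, h2, h3⟩ := step (pull_golay hC τ) [] h1 [] [0, 1, 2, 3, 4] 255
    (fun k j i => [[(i, 7), (j, 6), (k, 5)]]) (by decide +kernel) (by decide +kernel)
  refine ⟨σ * τ, hσ.mul hτ, ?_⟩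
  rw [pull_mul]
  simp only [List.forall_mem_cons] at h3 ⊢
  tauto

lemma uq2 {C : Submodule (ZMod 2) W} (hC : IsGolayCode C) :
    ∃ σ, Flag σ ∧ ∀ w ∈ ([(255, 7), (3855, 11)] : List (ℕ × ℕ)), wd w.1 ∈ pull σ C := by
  obtain ⟨τ, hτ, h1⟩ := uq1 hC
  obtain ⟨σ, hσ, h2, h3⟩ := step (pull_golay hC τ) [(255, 7)] h1 [255] [0, 1, 2, 3, 8] 3855
    (fun k j i => [[(i, 11), (j, 10), (k, 9)]]) (by decide +kernel) (by decide +kernel)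
  refine ⟨σ * τ, hσ.mul hτ, ?_⟩
  rw [pull_mul]
  simp only [List.forall_mem_cons] at h3 ⊢
  tauto

lemma uq3 {C : Submodule (ZMod 2) W} (hC : IsGolayCode C) :
    ∃ σ, Flag σ ∧ ∀ w ∈ ([(255, 7), (3855, 11), (61455, 15)] : List (ℕ × ℕ)), wd w.1 ∈ pull σ C := by
  obtain ⟨τ, hτ, h1⟩ := uq2 hC
  obtain ⟨σ, hσ, h2, h3⟩ := step (pull_golay hC τ) [(255, 7), (3855, 11)] h1 [255, 3855] [0, 1, 2, 3, 12] 61455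
    (fun k j i => [[(i, 15), (j, 14), (k, 13)]]) (by decide +kernel) (by decide +kernel)
  refine ⟨σ * τ, hσ.mul hτ, ?_⟩
  rw [pull_mul]
  simp only [List.forall_mem_cons] at h3 ⊢
  tauto

lemma uq4 {C : Submodule (ZMod 2) W} (hC : IsGolayCode C) :
    ∃ σ, Flag σ ∧ ∀ w ∈ ([(255, 7), (3855, 11), (61455, 15), (983055, 17)] : List (ℕ × ℕ)), wd w.1 ∈ pull σ C := by
  obtain ⟨τ, hτ, h1⟩ := uq3 hC
  obtain ⟨σ, hσ, h2, h3⟩ := step (pull_golay hC τ) [(255, 7), (3855, 11), (61455, 15)] h1 [255, 3855, 61455] [0, 1, 2, 3, 16] 983055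
    (fun k j i => [[(i, 19), (j, 18), (k, 17)]]) (by decide +kernel) (by decide +kernel)
  refine ⟨σ * τ, hσ.mul hτ, ?_⟩
  rw [pull_mul]
  simp only [List.forall_mem_cons] at h3 ⊢
  tauto

lemma uq5 {C : Submodule (ZMod 2) W} (hC : IsGolayCode C) :
    ∃ σ, Flag σ ∧ ∀ w ∈ ([(255, 7), (3855, 11), (61455, 15), (983055, 17), (15728655, 21)] : List (ℕ × ℕ)), wd w.1 ∈ pull σ C := by
  obtain ⟨τ, hτ, h1⟩ := uq4 hC
  obtain ⟨σ, hσ, h2, h3⟩ := step (pull_golay hC τ) [(255, 7), (3855, 11), (61455, 15), (983055, 17)] h1 [255, 3855, 61455, 983055] [0, 1, 2, 3, 20] 15728655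
    (fun k j i => [[(i, 23), (j, 22), (k, 21)]]) (by decide +kernel) (by decide +kernel)
  refine ⟨σ * τ, hσ.mul hτ, ?_⟩
  rw [pull_mul]
  simp only [List.forall_mem_cons] at h3 ⊢
  tauto

lemma uq6 {C : Submodule (ZMod 2) W} (hC : IsGolayCode C) :
    ∃ σ, Flag σ ∧ ∀ w ∈ ([(255, 7), (3855, 11), (61455, 15), (983055, 17), (15728655, 21), (1118494, 8)] : List (ℕ × ℕ)), wd w.1 ∈ pull σ C := by
  obtain ⟨τ, hτ, h1⟩ := uq5 hC
  obtain ⟨σ, hσ, h2, h3⟩ := step (pull_golay hC τ) [(255, 7), (3855, 11), (61455, 15), (983055, 17), (15728655, 21)] h1 [255, 3855, 61455, 983055] [1, 2, 3, 4, 8] 1118494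
    (fun k j i => [[(i, 20), (j, 16), (k, 12)]]) (by decide +kernel) (by decide +kernel)
  refine ⟨σ * τ, hσ.mul hτ, ?_⟩
  rw [pull_mul]
  simp only [List.forall_mem_cons] at h3 ⊢
  tauto

lemma uq7 {C : Submodule (ZMod 2) W} (hC : IsGolayCode C) :
    ∃ σ, Flag σ ∧ ∀ w ∈ ([(255, 7), (3855, 11), (61455, 15), (3354627, 13), (983055, 17), (15728655, 21), (1118494, 8)] : List (ℕ × ℕ)), wd w.1 ∈ pull σ C := by
  obtain ⟨τ, hτ, h1⟩ := uq6 hC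
  obtain ⟨σ, hσ, h2, h3⟩ := step (pull_golay hC τ) [(255, 7), (3855, 11), (61455, 15), (983055, 17), (15728655, 21), (1118494, 8)] h1 [61455, 1118494, 983055, 15728655] [0, 1, 12, 16, 20] 3354627
    (fun k j i => [[(i, 21), (j, 17), (k, 13)]]) (by decide +kernel) (by decide +kernel)
  refine ⟨σ * τ, hσ.mul hτ, ?_⟩
  rw [pull_mul]
  simp only [List.forall_mem_cons] at h3 ⊢
  tauto

lemma uq8 {C : Submodule (ZMod 2) W} (hC : IsGolayCode C) :
    ∃ σ, Flag σ ∧ ∀ w ∈ ([(255, 7), (3855, 11), (61455, 15), (3354627, 13), (5591045, 14), (983055, 17), (15728655, 21), (1118494, 8)] : List (ℕ × ℕ)), wd w.1 ∈ pull σ C := by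
  obtain ⟨τ, hτ, h1⟩ := uq7 hC
  obtain ⟨σ, hσ, h2, h3⟩ := step (pull_golay hC τ) [(255, 7), (3855, 11), (61455, 15), (3354627, 13), (983055, 17), (15728655, 21), (1118494, 8)] h1 [61455, 3354627, 1118689, 1121809, 983055, 255] [0, 2, 12, 16, 20] 5591045
    (fun k j i => [[(i, 22), (j, 18), (k, 14)]]) (by decide +kernel) (by decide +kernel)
  refine ⟨σ * τ, hσ.mul hτ, ?_⟩
  rw [pull_mul]
  simp only [List.forall_mem_cons] at h3 ⊢
  tauto

lemma uq9 {C : Submodule (ZMod 2) W} (hC : IsGolayCode C) :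
    ∃ σ, Flag σ ∧ ∀ w ∈ ([(255, 7), (3855, 11), (61455, 15), (9777200, 5), (3354627, 13), (5591045, 14), (983055, 17), (15728655, 21), (1118494, 8)] : List (ℕ × ℕ)), wd w.1 ∈ pull σ C := by
  obtain ⟨τ, hτ, h1⟩ := uq8 hC
  obtain ⟨σ, hσ, h2, h3⟩ := step (pull_golay hC τ) [(255, 7), (3855, 11), (61455, 15), (3354627, 13), (5591045, 14), (983055, 17), (15728655, 21), (1118494, 8)] h1 [61680, 1171729, 5591045, 10063881, 983280, 255] [4, 12, 13, 16, 20] 9777200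
    (fun k _ _ => [[(k, 5)], [(k, 5), (2, 3), (14, 15), (18, 19), (22, 23)]]) (by decide +kernel) (by decide +kernel)
  refine ⟨σ * τ, hσ.mul hτ, ?_⟩
  rw [pull_mul]
  simp only [List.forall_mem_cons] at h3 ⊢
  tauto

lemma uq10 {C : Submodule (ZMod 2) W} (hC : IsGolayCode C) :
    ∃ σ, Flag σ ∧ ∀ w ∈ ([(255, 7), (3855, 11), (61455, 15), (9777200, 5), (3756112, 6), (3354627, 13), (5591045, 14), (983055, 17), (15728655, 21), (1118494, 8)] : List (ℕ × ℕ)), wd w.1 ∈ pull σ C := by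
  obtain ⟨τ, hτ, h1⟩ := uq9 hC
  obtain ⟨σ, hσ, h2, h3⟩ := step (pull_golay hC τ) [(255, 7), (3855, 11), (61455, 15), (9777200, 5), (3354627, 13), (5591045, 14), (983055, 17), (15728655, 21), (1118494, 8)] h1 [61680, 9777200, 10833930, 1118494, 3944460, 61455] [4, 12, 14, 16, 20] 3756112
    (fun k _ _ => [[(k, 6)], [(k, 6), (2, 3), (14, 15), (18, 19), (22, 23)]]) (by decide +kernel) (by decide +kernel)
  refine ⟨σ * τ, hσ.mul hτ, ?_⟩
  rw [pull_mul]
  simp only [List.forall_mem_cons] at h3 ⊢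
  tauto

lemma uq11 {C : Submodule (ZMod 2) W} (hC : IsGolayCode C) :
    ∃ σ, Flag σ ∧ ∀ w ∈ ([(255, 7), (3855, 11), (61455, 15), (9777200, 5), (3756112, 6), (5845760, 9), (3354627, 13), (5591045, 14), (983055, 17), (15728655, 21), (1118494, 8)] : List (ℕ × ℕ)), wd w.1 ∈ pull σ C := by
  obtain ⟨τ, hτ, h1⟩ := uq10 hC
  obtain ⟨σ, hσ, h2, h3⟩ := step (pull_golay hC τ) [(255, 7), (3855, 11), (61455, 15), (9777200, 5), (3756112, 6), (3354627, 13), (5591045, 14), (983055, 17), (15728655, 21), (1118494, 8)] h1 [65280, 1171729, 3756112, 11608392, 6905865] [8, 12, 13, 16, 20] 5845760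
    (fun k _ _ => [[(k, 9)]]) (by decide +kernel) (by decide +kernel)
  refine ⟨σ * τ, hσ.mul hτ, ?_⟩
  rw [pull_mul]
  simp only [List.forall_mem_cons] at h3 ⊢
  tauto

lemma uq12 {C : Submodule (ZMod 2) W} (hC : IsGolayCode C) :
    ∃ σ, Flag σ ∧ ∀ w ∈ ([(255, 7), (3855, 11), (61455, 15), (9777200, 5), (3756112, 6), (5845760, 9), (9655552, 10), (3354627, 13), (5591045, 14), (983055, 17), (15728655, 21), (1118494, 8)] : List (ℕ × ℕ)), wd w.1 ∈ pull σ C := by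
  obtain ⟨τ, hτ, h1⟩ := uq11 hC
  obtain ⟨σ, hσ, h2, h3⟩ := step (pull_golay hC τ) [(255, 7), (3855, 11), (61455, 15), (9777200, 5), (3756112, 6), (5845760, 9), (3354627, 13), (5591045, 14), (983055, 17), (15728655, 21), (1118494, 8)] h1 [65280, 5845760, 5918730, 1118494, 12791820, 61455] [8, 12, 14, 16, 20] 9655552
    (fun k _ _ => [[(k, 10)]]) (by decide +kernel) (by decide +kernel)
  refine ⟨σ * τ, hσ.mul hτ, ?_⟩
  rw [pull_mul]
  simp only [List.forall_mem_cons] at h3 ⊢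
  tauto

/-- basis of the standard Golay code, with pivots -/
def bas : List (ℕ × ℕ) := [(255, 7), (3855, 11), (61455, 15), (9777200, 5), (3756112, 6), (5845760, 9), (9655552, 10), (3354627, 13), (5591045, 14), (983055, 17), (15728655, 21), (1118494, 8)]

end FiveOrbits
end

section
open Matrix

namespace FiveOrbits

/-- span of the words in a list -/
def spn (ws : List (ℕ × ℕ)) : Submodule (ZMod 2) W :=
  Submodule.span (ZMod 2) {x | ∃ w ∈ ws, x = wd w.1}

/-- triangularity -/
def tri : List (ℕ × ℕ) → Bool
  | [] => true
  | w :: t => Nat.ble w.2 23 && tb w.1 w.2 && (t.all fun v => !tb v.1 w.2) && tri t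

lemma spn_cons (w : ℕ × ℕ) (t : List (ℕ × ℕ)) :
    spn (w :: t) = Submodule.span (ZMod 2) {wd w.1} ⊔ spn t := by
  unfold spn
  rw [← Submodule.span_union]
  congr 1
  ext x
  simp

lemma finrank_spn : ∀ ws : List (ℕ × ℕ), tri ws = true → Module.finrank (ZMod 2) (spn ws) = ws.length
  | [], _ => by
    have : spn [] = ⊥ := by simp [spn]
    rw [this]; simp
  | w :: t, h => by
    simp only [tri, Bool.and_eq_true, Nat.ble_eq, List.all_eq_true, tb_eq, Bool.not_eq_true'] at h
    obtain ⟨⟨⟨h0, h1⟩, h2⟩, h3⟩ := h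
    have ih := finrank_spn t h3
    have hp : w.2 < 24 := by omega
    have hz : ∀ x ∈ spn t, x ⟨w.2, hp⟩ = 0 := by
      intro x hx
      unfold spn at hx
      induction hx using Submodule.span_induction with
      | mem x hx =>
        obtain ⟨v, hv, rfl⟩ := hx
        simp [wd, h2 v hv]
      | zero => rfl
      | add x y _ _ hx hy => rw [Pi.add_apply, hx, hy, add_zero]
      | smul a x _ hx => rw [Pi.smul_apply, hx, smul_zero]
    have hw : wd w.1 ⟨w.2, hp⟩ = 1 := by simp [wd, h1]
    have hne : wd w.1 ≠ 0 := by intro h; rw [h] at hw; simp at hw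
    have hd : Submodule.span (ZMod 2) {wd w.1} ⊓ spn t = ⊥ := by
      rw [Submodule.eq_bot_iff]
      rintro x ⟨hx1, hx2⟩
      obtain ⟨a, rfl⟩ := Submodule.mem_span_singleton.mp hx1
      have := hz _ hx2
      rw [Pi.smul_apply, hw, smul_eq_mul, mul_one] at this
      rw [this, zero_smul]
    have := Submodule.finrank_sup_add_finrank_inf_eq (Submodule.span (ZMod 2) {wd w.1}) (spn t)
    rw [hd, finrank_bot, finrank_span_singleton hne, ih] at this
    rw [spn_cons, List.length_cons]
    omega

/-- the standard Golay code -/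
def C0 : Submodule (ZMod 2) W := spn bas

lemma finrank_C0 : Module.finrank (ZMod 2) C0 = 12 := finrank_spn bas (by decide +kernel)

lemma wd_mem_C0 : ∀ w ∈ bas, wd w.1 ∈ C0 := fun w hw => Submodule.subset_span ⟨w, hw, rfl⟩

theorem uniq {C : Submodule (ZMod 2) W} (hC : IsGolayCode C) : ∃ σ, Flag σ ∧ pull σ C = C0 := by
  obtain ⟨σ, hσ, h⟩ := uq12 hC
  refine ⟨σ, hσ, (Submodule.eq_of_le_of_finrank_eq ?_ ?_).symm⟩
  · unfold C0 spn
    rw [Submodule.span_le]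
    rintro x ⟨w, hw, rfl⟩
    exact h w hw
  · rw [finrank_C0, (pull_golay hC σ).1]

/-- enumeration of the span -/
def enl : List (ℕ × ℕ) → ℕ → List ℕ
  | [], a => [a]
  | w :: t, a => enl t a ++ enl t (a ^^^ w.1)

/-- check over the span -/
def allC (f : ℕ → Bool) : List (ℕ × ℕ) → ℕ → Bool
  | [], a => f a
  | w :: t, a => allC f t a && force (Nat.xor a w.1) (allC f t)

/-- count over the span -/
def cntC (f : ℕ → Bool) : List (ℕ × ℕ) → ℕ → ℕ
  | [], a => cond (f a) 1 0
  | w :: t, a => Nat.add (cntC f t a) (force (Nat.xor a w.1) (cntC f t))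

lemma allC_iff (f : ℕ → Bool) : ∀ (ws : List (ℕ × ℕ)) (a : ℕ), allC f ws a = true ↔ ∀ m ∈ enl ws a, f m = true
  | [], a => by simp [allC, enl]
  | w :: t, a => by
    simp only [allC, enl, Bool.and_eq_true, force_eq, List.forall_mem_append]
    rw [allC_iff f t, allC_iff f t]; rfl

lemma cntC_eq (f : ℕ → Bool) : ∀ (ws : List (ℕ × ℕ)) (a : ℕ), cntC f ws a = (enl ws a).countP f
  | [], a => by
    simp only [cntC, enl, List.countP_cons, List.countP_nil, zero_add]
    cases f a <;> rfl
  | w :: t, a => by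
    simp only [cntC, enl, force_eq, List.countP_append]
    rw [cntC_eq f t, cntC_eq f t]; rfl

lemma length_enl : ∀ (ws : List (ℕ × ℕ)) (a : ℕ), (enl ws a).length = 2 ^ ws.length
  | [], a => by simp [enl]
  | w :: t, a => by
    simp only [enl, List.length_append, length_enl t, List.length_cons, pow_succ]; ring

lemma mem_enl : ∀ (ws : List (ℕ × ℕ)) (a : ℕ) (x : W), x + wd a ∈ spn ws ↔ ∃ m ∈ enl ws a, x = wd m
  | [], a, x => by
    have : spn [] = ⊥ := by simp [spn]
    rw [this]
    simp only [Submodule.mem_bot, enl, List.mem_singleton, exists_eq_left]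
    exact CharTwo.add_eq_zero
  | w :: t, a, x => by
    have h1 := mem_enl t a x
    have h2 := mem_enl t (a ^^^ w.1) x
    simp only [enl, List.mem_append, or_and_right, exists_or]
    rw [← h1, ← h2, wd_xor, spn_cons, Submodule.mem_sup]
    constructor
    · rintro ⟨y, hy, z, hz, h⟩
      obtain ⟨c, rfl⟩ := Submodule.mem_span_singleton.mp hy
      obtain hc | hc : c = 0 ∨ c = 1 := by
        have : ∀ c : ZMod 2, c = 0 ∨ c = 1 := by decide
        exact this c
      · subst hc; rw [zero_smul, zero_add] at h; left; rwa [← h]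
      · subst hc; right
        rw [← add_assoc, ← h, one_smul, add_comm, ← add_assoc, CharTwo.add_self_eq_zero, zero_add]
        exact hz
    · rintro (h | h)
      · exact ⟨0, Submodule.zero_mem _, _, h, zero_add _⟩
      · refine ⟨wd w.1, Submodule.mem_span_singleton_self _, _, h, ?_⟩
        rw [add_comm, add_assoc, add_assoc, CharTwo.add_self_eq_zero, add_zero]

lemma mem_C0_iff (x : W) (a : ℕ) : x + wd a ∈ C0 ↔ ∃ m ∈ enl bas a, x = wd m := mem_enl bas a x

lemma natcard_C0 : Nat.card C0 = 4096 := by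
  have : Nat.card C0 = Nat.card (ZMod 2) ^ Module.finrank (ZMod 2) C0 := Module.natCard_eq_pow_finrank
  rw [this, finrank_C0]; simp

/-- counting the sets in a coset of the standard code -/
theorem count_coset (a : ℕ) (f : ℕ → Bool) (P : Finset (Fin 24) → Prop) (hP : ∀ m, f m = true ↔ P (ms m)) :
    Nat.card {S : Finset (Fin 24) // ind S + wd a ∈ C0 ∧ P S} = cntC f bas a := by
  classical
  let l : List (Finset (Fin 24)) := (enl bas a).map ms
  have hl : l.length = 4096 := by
    rw [List.length_map, length_enl]; rfl
  have hmem : ∀ S, S ∈ l ↔ ind S + wd a ∈ C0 := by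
    intro S
    rw [mem_C0_iff, List.mem_map]
    refine exists_congr fun m => and_congr_right fun _ => ?_
    rw [← ind_ms]
    exact ⟨fun h => by rw [h], fun h => (ind_injective h).symm⟩
  have hcard : l.toFinset.card = 4096 := by
    rw [← natcard_C0, ← Nat.subtype_card l.toFinset (p := fun S => S ∈ l.toFinset) (fun _ => Iff.rfl)]
    apply Nat.card_congr
    refine Equiv.ofBijective (fun S => ⟨ind S.1 + wd a, (hmem _).mp (List.mem_toFinset.mp S.2)⟩) ⟨?_, ?_⟩
    · intro S T h
      have := congrArg Subtype.val h
      exact Subtype.ext (ind_injective (add_right_cancel this))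
    · rintro ⟨c, hc⟩
      have e : ind (supp (c + wd a)) + wd a = c := by
        rw [ind_supp, add_assoc, CharTwo.add_self_eq_zero, add_zero]
      exact ⟨⟨supp (c + wd a), List.mem_toFinset.mpr ((hmem _).mpr (by rw [e]; exact hc))⟩,
        Subtype.ext e⟩
  have hnd : l.Nodup := by
    have := Multiset.toFinset_card_eq_card_iff_nodup (m := (Multiset.ofList l))
    apply this.mp
    simpa using hcard.trans hl.symm
  rw [cntC_eq]
  have : (enl bas a).countP f = l.countP (fun S => decide (P S)) := by
    rw [List.countP_map]
    apply List.countP_congr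
    intro m _
    simp [hP]
  rw [this, List.countP_eq_length_filter, ← List.toFinset_card_of_nodup (hnd.filter _)]
  apply Nat.subtype_card
  intro S
  simp [hmem]

end FiveOrbits
end

section
open Matrix

namespace FiveOrbits

/-! ### Code automorphisms -/

/-- `g` preserves the code -/
def IsAut (C : Submodule (ZMod 2) W) (g : Equiv.Perm (Fin 24)) : Prop := pull g C = C

lemma finrank_pull (C : Submodule (ZMod 2) W) (σ : Equiv.Perm (Fin 24)) :
    Module.finrank (ZMod 2) (pull σ C) = Module.finrank (ZMod 2) C := by
  have e : pull σ C = C.comap (LinearEquiv.funCongrLeft (ZMod 2) (ZMod 2) σ).toLinearMap := rfl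
  rw [e, Submodule.comap_equiv_eq_map_symm, LinearEquiv.finrank_map_eq]

lemma isAut_iff {C : Submodule (ZMod 2) W} {g : Equiv.Perm (Fin 24)} :
    IsAut C g ↔ ∀ c ∈ C, (fun i => c (g i)) ∈ C := by
  constructor
  · intro h c hc
    rw [← h] at hc
    exact hc
  · intro h
    exact (Submodule.eq_of_le_of_finrank_eq (S₁ := C) (S₂ := pull g C) h (finrank_pull C g).symm).symm

lemma IsAut.mul {C : Submodule (ZMod 2) W} {g h : Equiv.Perm (Fin 24)} (hg : IsAut C g) (hh : IsAut C h) :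
    IsAut C (g * h) := by
  unfold IsAut at *; rw [pull_mul, hh, hg]

lemma IsAut.inv {C : Submodule (ZMod 2) W} {g : Equiv.Perm (Fin 24)} (hg : IsAut C g) : IsAut C g⁻¹ := by
  unfold IsAut at *
  conv_lhs => rw [← hg]
  rw [← pull_mul, inv_mul_cancel, pull_one]

lemma m24_iff {C : Submodule (ZMod 2) W} {S T : Finset (Fin 24)} :
    M24Equiv C S T ↔ ∃ g, IsAut C g ∧ S.image g = T := by
  unfold M24Equiv
  simp only [isAut_iff]

lemma M24.refl (C : Submodule (ZMod 2) W) (S : Finset (Fin 24)) : M24Equiv C S S :=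
  m24_iff.mpr ⟨1, pull_one C, by simp⟩

lemma M24.symm {C : Submodule (ZMod 2) W} {S T : Finset (Fin 24)} (h : M24Equiv C S T) : M24Equiv C T S := by
  obtain ⟨g, hg, rfl⟩ := m24_iff.mp h
  refine m24_iff.mpr ⟨g⁻¹, hg.inv, ?_⟩
  rw [Finset.image_image]
  simp [Function.comp_def]

lemma M24.trans {C : Submodule (ZMod 2) W} {S T U : Finset (Fin 24)} (h : M24Equiv C S T)
    (h' : M24Equiv C T U) : M24Equiv C S U := by
  obtain ⟨g, hg, rfl⟩ := m24_iff.mp h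
  obtain ⟨k, hk, rfl⟩ := m24_iff.mp h'
  refine m24_iff.mpr ⟨k * g, hk.mul hg, ?_⟩
  rw [Finset.image_image]
  rfl

lemma M24.card {C : Submodule (ZMod 2) W} {S T : Finset (Fin 24)} (h : M24Equiv C S T) : S.card = T.card := by
  obtain ⟨g, hg, rfl⟩ := m24_iff.mp h
  rw [Finset.card_image_of_injective _ g.injective]

lemma ind_image (g : Equiv.Perm (Fin 24)) (S : Finset (Fin 24)) : (fun i => ind (S.image g) (g i)) = ind S := by
  funext i
  simp [ind]

lemma inC_image {C : Submodule (ZMod 2) W} {g : Equiv.Perm (Fin 24)} (S : Finset (Fin 24)) :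
    InC C S ↔ InC (pull g C) (S.image g) := by
  unfold InC
  rw [mem_pull, ind_image]

lemma IsAut.inC {C : Submodule (ZMod 2) W} {g : Equiv.Perm (Fin 24)} (hg : IsAut C g) (S : Finset (Fin 24)) :
    InC C (S.image g) ↔ InC C S := by
  rw [inC_image (g := g) (C := C) S, hg]

lemma image_symmDiff' (g : Equiv.Perm (Fin 24)) (S T : Finset (Fin 24)) :
    (symmDiff S T).image g = symmDiff (S.image g) (T.image g) :=
  Finset.image_symmDiff _ _ g.injective

/-- transport of equivalence -/
lemma m24_pull {C : Submodule (ZMod 2) W} (σ : Equiv.Perm (Fin 24)) (S T : Finset (Fin 24)) :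
    M24Equiv (pull σ C) (S.image σ) (T.image σ) ↔ M24Equiv C S T := by
  simp only [m24_iff]
  constructor
  · rintro ⟨g, hg, h⟩
    refine ⟨σ⁻¹ * g * σ, ?_, ?_⟩
    · unfold IsAut at *
      rw [pull_mul, pull_mul, hg, ← pull_mul, inv_mul_cancel, pull_one]
    · have : S.image (σ⁻¹ * g * σ) = ((S.image σ).image g).image (σ⁻¹ : Equiv.Perm (Fin 24)) := by
        rw [Finset.image_image, Finset.image_image]; rfl
      rw [this, h, Finset.image_image]; simp [Function.comp_def]
  · rintro ⟨g, hg, rfl⟩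
    refine ⟨σ * g * σ⁻¹, ?_, ?_⟩
    · unfold IsAut at *
      rw [pull_mul, pull_mul, ← pull_mul σ⁻¹ σ, inv_mul_cancel, pull_one, hg]
    · rw [Finset.image_image, Finset.image_image]
      congr 1
      funext i
      simp

/-! ### Permutations given by lists -/

/-- the word `m ∘ l` -/
def apm : List ℕ → ℕ → ℕ
  | [], _ => 0
  | h :: l, m => Nat.add (Nat.mod (Nat.shiftRight m h) 2) (Nat.mul 2 (apm l m))

lemma testBit_apm (m : ℕ) : ∀ (l : List ℕ) (i : ℕ) (hi : i < l.length), (apm l m).testBit i = m.testBit l[i]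
  | [], i, hi => by simp at hi
  | h :: l, i, hi => by
    have e : apm (h :: l) m = (m >>> h) % 2 + 2 * apm l m := rfl
    rw [e]
    have h2 := Nat.mod_two_eq_zero_or_one (m >>> h)
    cases i with
    | zero =>
      rw [Nat.testBit_zero]
      have : m.testBit h = decide ((m >>> h) % 2 = 1) := by
        rw [Nat.testBit_eq_decide_div_mod_eq, ← Nat.shiftRight_eq_div_pow]
      simp only [List.getElem_cons_zero, this]
      congr 1
      apply propext
      omega
    | succ i =>
      have h3 : ((m >>> h) % 2 + 2 * apm l m) / 2 = apm l m := by omega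
      rw [Nat.testBit_succ, h3]
      simp only [List.getElem_cons_succ]
      exact testBit_apm m l i (by simpa using hi)

/-- test that a list is an automorphism of the standard code -/
def okp (l : List ℕ) : Bool :=
  Nat.beq l.length 24 && (l.all fun i => Nat.ble i 23) && decide l.Nodup &&
    bas.all fun w => Nat.beq (rd bas (apm l w.1)) 0

lemma exists_aut {l : List ℕ} (h : okp l = true) : ∃ g, IsAut C0 g ∧
    (∀ (i : Fin 24) (hi : (i : ℕ) < l.length), ((g i : Fin 24) : ℕ) = l[(i : ℕ)]) := by
  simp only [okp, Bool.and_eq_true, Nat.beq_eq, List.all_eq_true, Nat.ble_eq, decide_eq_true_iff] at h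
  obtain ⟨⟨⟨h1, h2⟩, h3⟩, h4⟩ := h
  let f : Fin 24 → Fin 24 := fun i => ⟨l[(i : ℕ)]'(by rw [h1]; exact i.2), by
    have := h2 _ (List.getElem_mem (l := l) (n := i) (by rw [h1]; exact i.2)); omega⟩
  have hf : Function.Injective f := by
    intro i j hij
    have := congrArg Fin.val hij
    exact Fin.ext ((List.Nodup.getElem_inj_iff h3).mp this)
  let g : Equiv.Perm (Fin 24) := Equiv.ofBijective f (Finite.injective_iff_bijective.mp hf)
  have hg : ∀ (i : Fin 24) (hi : (i : ℕ) < l.length), ((g i : Fin 24) : ℕ) = l[(i : ℕ)] := fun i hi => rfl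
  refine ⟨g, ?_, hg⟩
  rw [isAut_iff]
  have : C0 ≤ pull g C0 := by
    conv_lhs => unfold C0 spn
    rw [Submodule.span_le]
    rintro x ⟨w, hw, rfl⟩
    show (fun i => wd w.1 (g i)) ∈ C0
    have e : (fun i => wd w.1 (g i)) = wd (apm l w.1) := by
      funext i
      have hi : (i : ℕ) < l.length := by rw [h1]; exact i.2
      simp only [wd]
      rw [testBit_apm _ _ _ hi, hg i hi]
    rw [e, ← rd_sound bas wd_mem_C0, h4 w hw, wd_zero]
    exact C0.zero_mem
  exact this

lemma okp_equiv {l : List ℕ} (h : okp l = true) (m : ℕ) : M24Equiv C0 (ms m) (ms (apm l m)) := by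
  obtain ⟨g, hg, hl⟩ := exists_aut h
  simp only [okp, Bool.and_eq_true, Nat.beq_eq] at h
  have h1 := h.1.1.1
  apply M24.symm
  refine m24_iff.mpr ⟨g, hg, ?_⟩
  ext i
  rw [Finset.mem_image]
  constructor
  · rintro ⟨j, hj, rfl⟩
    have hi : (j : ℕ) < l.length := by rw [h1]; exact j.2
    rw [mem_ms, testBit_apm _ _ _ hi] at hj
    rw [mem_ms, hl j hi, hj]
  · intro hi
    refine ⟨g⁻¹ i, ?_, by simp⟩
    have hj : ((g⁻¹ i : Fin 24) : ℕ) < l.length := by rw [h1]; exact (g⁻¹ i).2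
    rw [mem_ms, testBit_apm _ _ _ hj, ← hl _ hj]
    rw [mem_ms] at hi
    simpa using hi

/-- bounded search for a smaller equivalent mask -/
def low (gs : List (List ℕ)) (good : ℕ → Bool) (x : ℕ) : ℕ → ℕ → Bool
  | 0, _ => false
  | d + 1, y => gs.any fun g => force (apm g y) fun z => (Nat.ble (Nat.succ z) x && good z) || low gs good x d z

lemma low_sound {gs : List (List ℕ)} {good : ℕ → Bool} (hgs : gs.all okp = true) {x : ℕ} :
    ∀ (d y : ℕ), low gs good x d y = true → ∃ z, z < x ∧ good z = true ∧ M24Equiv C0 (ms y) (ms z)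
  | 0, y, h => by simp [low] at h
  | d + 1, y, h => by
    rw [low, List.any_eq_true] at h
    obtain ⟨g, hg, h⟩ := h
    rw [force_eq, Bool.or_eq_true, Bool.and_eq_true, Nat.ble_eq] at h
    have hgy := okp_equiv (List.all_eq_true.mp hgs g hg) y
    rcases h with ⟨h1, h2⟩ | h
    · exact ⟨_, h1, h2, hgy⟩
    · obtain ⟨z, h1, h2, h3⟩ := low_sound hgs d _ h
      exact ⟨z, h1, h2, M24.trans hgy h3⟩

/-- membership in the searched set -/
def inX (a : ℕ) (ext : ℕ → Bool) (z : ℕ) : Bool := ext z && Nat.beq (rd bas (Nat.xor z a)) 0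

/-- the full check -/
def chkX (gs : List (List ℕ)) (a : ℕ) (ext : ℕ → Bool) (roots : List ℕ) : Bool :=
  allC (fun m => Nat.ble m 16777215 &&
    (!ext m || !(Nat.beq (cnt m (List.range 24)) 12) || (roots.any fun r => Nat.beq m r) ||
      low gs (inX a ext) m 1 m || low gs (inX a ext) m 2 m || low gs (inX a ext) m 3 m)) bas a

lemma cnt24 (m : ℕ) : cnt m (List.range 24) = (ms m).card := by
  have h24 : ls (List.range 24) = Finset.univ := by
    ext x; simp [mem_ls]
  rw [cnt_eq m (List.range 24) List.nodup_range (by simp), h24, Finset.inter_univ]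

lemma ms_of_wd {m z : ℕ} (h : wd m = wd z) : ms m = ms z := by
  apply ind_injective; rw [ind_ms, ind_ms, h]

lemma le_of_wd {m z : ℕ} (h : wd m = wd z) (hm : m < 2 ^ 24) : m ≤ z := by
  have : m = z % 2 ^ 24 := by
    apply Nat.eq_of_testBit_eq
    intro i
    rw [Nat.testBit_mod_two_pow]
    by_cases hi : i < 24
    · have := ms_of_wd h
      have h2 := Finset.ext_iff.mp this ⟨i, hi⟩
      rw [mem_ms, mem_ms] at h2
      simp only [hi, decide_true, Bool.true_and]
      exact Bool.eq_iff_iff.mpr h2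
    · rw [Nat.testBit_lt_two_pow (lt_of_lt_of_le hm (Nat.pow_le_pow_right (by norm_num) (by omega)))]
      simp [hi]
  rw [this]
  exact Nat.mod_le _ _

theorem descent (gs : List (List ℕ)) (a : ℕ) (ext : ℕ → Bool) (roots : List ℕ)
    (hext : ∀ m z, wd m = wd z → ext m = ext z) (hgs : gs.all okp = true)
    (h : chkX gs a ext roots = true) (S : Finset (Fin 24)) (hS : ind S + wd a ∈ C0) (h12 : S.card = 12)
    (hSe : ∀ m, ms m = S → ext m = true) : ∃ r ∈ roots, M24Equiv C0 S (ms r) := by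
  rw [chkX, allC_iff] at h
  have key : ∀ n, ∀ m ∈ enl bas a, m ≤ n → ext m = true → (ms m).card = 12 →
      ∃ r ∈ roots, M24Equiv C0 (ms m) (ms r) := by
    intro n
    induction n using Nat.strong_induction_on with
    | _ n ih =>
      intro m hm hmn he hc
      have h1 := h m hm
      simp only [Bool.and_eq_true, Bool.or_eq_true, cnt24, he, hc, Bool.not_true, Bool.false_eq_true,
        false_or, List.any_eq_true, Nat.beq_eq, Bool.not_eq_true'] at h1
      obtain ⟨h0, h1⟩ := h1
      have fin : (∃ z, z < m ∧ inX a ext z = true ∧ M24Equiv C0 (ms m) (ms z)) →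
          ∃ r ∈ roots, M24Equiv C0 (ms m) (ms r) := by
        rintro ⟨z, hz, hx, hmz⟩
        rw [inX, Bool.and_eq_true, Nat.beq_eq] at hx
        have hzC : wd z + wd a ∈ C0 := by
          rw [← wd_xor, ← rd_sound bas wd_mem_C0]
          show wd (rd bas (Nat.xor z a)) ∈ C0
          rw [hx.2, wd_zero]
          exact C0.zero_mem
        obtain ⟨m', hm', hzm⟩ := (mem_C0_iff _ _).mp hzC
        have h0' := h m' hm'
        rw [Bool.and_eq_true, Nat.ble_eq] at h0'
        have hle := le_of_wd hzm.symm (show m' < 2 ^ 24 by have := h0'.1; omega)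
        have hms := ms_of_wd hzm
        obtain ⟨r, hr, h3⟩ := ih z (by omega) m' hm' hle (by rw [← hext _ _ hzm]; exact hx.1)
          (by rw [← hms, ← M24.card hmz, hc])
        exact ⟨r, hr, M24.trans hmz (by rw [hms]; exact h3)⟩
      rcases h1 with (((h1 | h1) | h1) | h1) | h1
      · exact absurd h1 (by decide)
      · obtain ⟨r, hr, rfl⟩ := h1
        exact ⟨m, hr, M24.refl _ _⟩
      · exact fin (low_sound hgs _ _ h1)
      · exact fin (low_sound hgs _ _ h1)
      · exact fin (low_sound hgs _ _ h1)
  obtain ⟨m, hm, hSm⟩ := (mem_C0_iff _ _).mp hS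
  have hms : ms m = S := by apply ind_injective; rw [ind_ms, hSm]
  rw [← hms]
  exact key m m hm le_rfl (hSe m hms) (by rw [hms, h12])

end FiveOrbits
end

section
open Matrix

namespace FiveOrbits

/-- automorphisms fixing the points 0 and 1 -/
def gs1 : List (List ℕ) :=
  [[0, 1, 7, 4, 6, 5, 2, 3, 17, 16, 8, 10, 11, 9, 19, 18, 23, 12, 14, 20, 15, 21, 13, 22],
    [0, 1, 6, 15, 21, 2, 17, 10, 8, 7, 14, 9, 18, 12, 16, 4, 23, 13, 5, 20, 22, 19, 3, 11],
    [0, 1, 19, 12, 3, 4, 21, 10, 5, 7, 17, 15, 6, 2, 20, 9, 13, 22, 18, 23, 16, 8, 11, 14],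
    [0, 1, 14, 9, 10, 18, 17, 12, 6, 8, 7, 15, 5, 19, 23, 3, 13, 11, 22, 20, 2, 21, 4, 16],
    [0, 1, 10, 15, 11, 14, 4, 5, 20, 22, 12, 8, 9, 13, 16, 19, 18, 3, 7, 23, 6, 21, 2, 17],
    [0, 1, 3, 2, 9, 8, 10, 11, 5, 4, 6, 7, 12, 13, 15, 14, 17, 16, 18, 19, 21, 20, 22, 23]]

/-- automorphisms preserving the standard sextet -/
def gs2 : List (List ℕ) :=
  [[2, 1, 3, 0, 18, 16, 17, 19, 23, 22, 21, 20, 7, 4, 6, 5, 10, 9, 11, 8, 15, 12, 14, 13],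
    [19, 18, 17, 16, 0, 2, 3, 1, 10, 11, 8, 9, 15, 12, 14, 13, 5, 6, 4, 7, 20, 22, 23, 21],
    [14, 15, 13, 12, 11, 8, 9, 10, 18, 19, 17, 16, 6, 4, 7, 5, 23, 21, 22, 20, 3, 0, 1, 2],
    [16, 19, 18, 17, 6, 7, 5, 4, 14, 13, 12, 15, 10, 8, 11, 9, 20, 21, 23, 22, 2, 0, 3, 1],
    [6, 5, 7, 4, 13, 12, 15, 14, 11, 9, 8, 10, 20, 21, 22, 23, 0, 3, 1, 2, 17, 19, 18, 16],
    [3, 1, 0, 2, 19, 16, 18, 17, 13, 12, 15, 14, 5, 6, 4, 7, 21, 23, 22, 20, 11, 10, 9, 8]]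

/-- contains 0 but not 1 -/
def ext1 (m : ℕ) : Bool := tb m 0 && !tb m 1

/-- number of full columns -/
def fc (m : ℕ) : ℕ :=
  Nat.add (cond (Nat.beq (Nat.land m 15) 15) 1 0)
  (Nat.add (cond (Nat.beq (Nat.land m 240) 240) 1 0)
  (Nat.add (cond (Nat.beq (Nat.land m 3840) 3840) 1 0)
  (Nat.add (cond (Nat.beq (Nat.land m 61440) 61440) 1 0)
  (Nat.add (cond (Nat.beq (Nat.land m 983040) 983040) 1 0)
  (cond (Nat.beq (Nat.land m 15728640) 15728640) 1 0)))))

lemma gs1_ok : gs1.all okp = true := by decide +kernel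

lemma gs2_ok : gs2.all okp = true := by decide +kernel

lemma chkX1 : chkX gs1 0 ext1 [221129] = true := by decide +kernel

lemma chkX2 : chkX gs2 15 (fun _ => true) [4095, 210607, 3364458] = true := by decide +kernel

/-- contains 1 but not 0 -/
def ext3 (m : ℕ) : Bool := tb m 1 && !tb m 0

lemma chkX3 : chkX gs1 3 ext3 [221130] = true := by decide +kernel

/-- admissible weights -/
def wts (n : ℕ) : Bool := Nat.beq n 0 || Nat.beq n 8 || Nat.beq n 12 || Nat.beq n 16 || Nat.beq n 24

lemma chk_wt : allC (fun m => wts (cnt m (List.range 24))) bas 0 = true := by decide +kernel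

lemma cnt_dod : cntC (fun m => Nat.beq (cnt m (List.range 24)) 12) bas 0 = 2576 := by decide +kernel

lemma cnt_fc3 : cntC (fun m => Nat.beq (cnt m (List.range 24)) 12 && Nat.beq (fc m) 3) bas 15 = 20 := by
  decide +kernel

lemma cnt_fc1 : cntC (fun m => Nat.beq (cnt m (List.range 24)) 12 && Nat.beq (fc m) 1) bas 15 = 720 := by
  decide +kernel

lemma cnt_fc0 : cntC (fun m => Nat.beq (cnt m (List.range 24)) 12 && Nat.beq (fc m) 0) bas 15 = 576 := by
  decide +kernel

end FiveOrbits
end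

section
open Matrix

namespace FiveOrbits

lemma wt_C0 {S : Finset (Fin 24)} (h : InC C0 S) :
    S.card = 0 ∨ S.card = 8 ∨ S.card = 12 ∨ S.card = 16 ∨ S.card = 24 := by
  have h1 : ind S + wd 0 ∈ C0 := by rw [wd_zero, add_zero]; exact h
  obtain ⟨m, hm, hSm⟩ := (mem_C0_iff _ _).mp h1
  have h2 := (allC_iff _ _ _).mp chk_wt m hm
  have hms : ms m = S := by apply ind_injective; rw [ind_ms, hSm]
  rw [cnt24, hms] at h2
  simpa [wts, Nat.beq_eq, or_assoc, Bool.or_eq_true] using h2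

theorem golay_C0 : IsGolayCode C0 := by
  refine ⟨finrank_C0, fun c hc h0 => ?_⟩
  have h1 : InC C0 (supp c) := by unfold InC; rw [ind_supp]; exact hc
  have h2 := wt_C0 h1
  have h3 : (supp c).card ≠ 0 := by
    intro h
    apply h0
    rw [← ind_supp c, Finset.card_eq_zero.mp h, ind_empty]
  show 8 ≤ (supp c).card
  omega

/-! ### Transitivity -/

lemma exists_aut_of (τ : Equiv.Perm (Fin 24)) : ∃ σ, Flag σ ∧ IsAut C0 (σ * τ) := by
  obtain ⟨σ, h1, h2⟩ := uniq (pull_golay golay_C0 τ)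
  exact ⟨σ, h1, by unfold IsAut; rw [pull_mul, h2]⟩

lemma trans_pair {a b : Fin 24} (hab : a ≠ b) : ∃ g, IsAut C0 g ∧ g a = 0 ∧ g b = 1 := by
  set x := Equiv.swap 0 a b with hx
  have hx0 : x ≠ 0 := by
    intro h
    have : Equiv.swap 0 a b = Equiv.swap 0 a a := by rw [Equiv.swap_apply_right]; exact h
    exact hab ((Equiv.swap 0 a).injective this).symm
  obtain ⟨σ, h1, h2⟩ := exists_aut_of (Equiv.swap 1 x * Equiv.swap 0 a)
  refine ⟨_, h2, ?_, ?_⟩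
  · rw [Equiv.Perm.mul_apply, Equiv.Perm.mul_apply, Equiv.swap_apply_right,
      Equiv.swap_apply_of_ne_of_ne (by decide) hx0.symm, h1.1]
  · rw [Equiv.Perm.mul_apply, Equiv.Perm.mul_apply, ← hx, Equiv.swap_apply_right, h1.2.1]

lemma ms15 : ms 15 = {0, 1, 2, 3} := by decide

lemma trans_four {t : Finset (Fin 24)} (ht : t.card = 4) : ∃ g, IsAut C0 g ∧ t.image g = ms 15 := by
  have h15 : (ms 15).card = 4 := by decide
  let e : {x // x ∈ t} ≃ {x // x ∈ ms 15} := Finset.equivOfCardEq (ht.trans h15.symm)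
  obtain ⟨σ, h1, h2⟩ := exists_aut_of (Equiv.extendSubtype e)
  refine ⟨_, h2, ?_⟩
  apply Finset.eq_of_subset_of_card_le
  · intro y hy
    obtain ⟨x, hx, rfl⟩ := Finset.mem_image.mp hy
    rw [Equiv.Perm.mul_apply, Equiv.extendSubtype_apply_of_mem e x hx]
    have h3 := (e ⟨x, hx⟩).2
    generalize ((e ⟨x, hx⟩ : {x // x ∈ ms 15}) : Fin 24) = v at h3 ⊢
    rw [ms15] at h3 ⊢
    simp only [Finset.mem_insert, Finset.mem_singleton] at h3 ⊢
    obtain ⟨a, b, c, d⟩ := h1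
    rcases h3 with h | h | h | h <;> rw [h] <;> tauto
  · rw [Finset.card_image_of_injective _ (Equiv.injective _), ht, h15]

/-- covering radius -/
lemma exists_leader {C : Submodule (ZMod 2) W} (hC : IsGolayCode C) : ∀ (n : ℕ) (S : Finset (Fin 24)), S.card = n →
    ∃ R : Finset (Fin 24), R.card ≤ 4 ∧ R.card % 2 = S.card % 2 ∧ InC C (symmDiff S R) := by
  intro n
  induction n using Nat.strong_induction_on with
  | _ n ih =>
    intro S hS
    by_cases h : n ≤ 4
    · refine ⟨S, by omega, rfl, ?_⟩
      rw [symmDiff_self]; unfold InC; rw [Finset.bot_eq_empty, ind_empty]; exact C.zero_mem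
    · obtain ⟨F, hFS, hF⟩ := Finset.exists_subset_card_eq (s := S) (n := 5) (by omega)
      obtain ⟨O, hO, hFO⟩ := steiner hC hF
      have h1 := card_symmDiff' S O
      have h2 : F.card ≤ (S ∩ O).card := Finset.card_le_card (Finset.subset_inter hFS hFO)
      rw [hO.1] at h1
      obtain ⟨R, hR1, hR2, hR3⟩ := ih (symmDiff S O).card (by omega) _ rfl
      refine ⟨R, hR1, by omega, ?_⟩
      have := hR3.symmDiff hO.2
      rwa [symmDiff_assoc, symmDiff_comm R O, symmDiff_assoc, ← symmDiff_assoc O O, symmDiff_self, bot_symmDiff] at this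

/-! ### The five classes -/

/-- the tetrads in the coset of `T` -/
noncomputable def tets (C : Submodule (ZMod 2) W) (T : Finset (Fin 24)) : Finset (Finset (Fin 24)) :=
  tet C (cst C T)

lemma mem_tets {C : Submodule (ZMod 2) W} {T t : Finset (Fin 24)} :
    t ∈ tets C T ↔ t.card = 4 ∧ InC C (symmDiff t T) := by
  rw [tets, mem_tet, cst_eq]

/-- dodecads in a sextet coset containing `n` of the tetrads -/
def Dn (C : Submodule (ZMod 2) W) (n : ℕ) (T : Finset (Fin 24)) : Prop :=
  (tets C T).Nonempty ∧ ((tets C T).filter (· ⊆ T)).card = n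

/-- sets at distance two from a codeword -/
def D2 (C : Submodule (ZMod 2) W) (T : Finset (Fin 24)) : Prop :=
  ∃ a ∈ T, ∃ b, b ∉ T ∧ InC C (symmDiff T {a, b})

/-- the five classes -/
def PP (C : Submodule (ZMod 2) W) (k : Fin 5) (T : Finset (Fin 24)) : Prop :=
  T.card = 12 ∧ (![Dn C 3, Dn C 1, Dn C 0, D2 C, InC C] : Fin 5 → Finset (Fin 24) → Prop) k T

lemma tets_image {C : Submodule (ZMod 2) W} {g : Equiv.Perm (Fin 24)} (hg : IsAut C g) (T : Finset (Fin 24)) :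
    tets C (T.image g) = (tets C T).image (Finset.image g) := by
  ext t
  rw [Finset.mem_image]
  constructor
  · intro h
    rw [mem_tets] at h
    have e : (t.image (g⁻¹ : Equiv.Perm (Fin 24))).image g = t := by
      rw [Finset.image_image]; simp [Function.comp_def]
    refine ⟨t.image (g⁻¹ : Equiv.Perm (Fin 24)), mem_tets.mpr ⟨?_, ?_⟩, e⟩
    · rw [Finset.card_image_of_injective _ (Equiv.injective _), h.1]
    · rw [← hg.inC, image_symmDiff', e]; exact h.2
  · rintro ⟨s, hs, rfl⟩
    rw [mem_tets] at hs ⊢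
    rw [Finset.card_image_of_injective _ g.injective, ← image_symmDiff', hg.inC]
    exact hs

lemma Dn.image {C : Submodule (ZMod 2) W} {g : Equiv.Perm (Fin 24)} (hg : IsAut C g) {n : ℕ} {T : Finset (Fin 24)}
    (h : Dn C n T) : Dn C n (T.image g) := by
  refine ⟨?_, ?_⟩
  · rw [tets_image hg]; exact h.1.image _
  · rw [tets_image hg, Finset.filter_image, Finset.card_image_of_injective _ (Finset.image_injective g.injective),
      ← h.2]
    congr 1
    apply Finset.filter_congr
    intro t _
    exact Finset.image_subset_image_iff g.injective

lemma D2.image {C : Submodule (ZMod 2) W} {g : Equiv.Perm (Fin 24)} (hg : IsAut C g) {T : Finset (Fin 24)}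
    (h : D2 C T) : D2 C (T.image g) := by
  obtain ⟨a, ha, b, hb, h⟩ := h
  refine ⟨g a, Finset.mem_image_of_mem _ ha, g b, ?_, ?_⟩
  · simpa using hb
  · have : ({g a, g b} : Finset (Fin 24)) = ({a, b} : Finset (Fin 24)).image g := by simp
    rw [this, ← image_symmDiff', hg.inC]
    exact h

lemma PP.equiv {C : Submodule (ZMod 2) W} {k : Fin 5} {S T : Finset (Fin 24)} (h : PP C k S)
    (hST : M24Equiv C S T) : PP C k T := by
  refine ⟨(M24.card hST).symm.trans h.1, ?_⟩
  obtain ⟨g, hg, rfl⟩ := m24_iff.mp hST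
  have h := h.2
  fin_cases k
  · exact Dn.image hg h
  · exact Dn.image hg h
  · exact Dn.image hg h
  · exact D2.image hg h
  · exact (hg.inC _).mpr h

/-- codes for exclusivity: size of the coset leader -/
lemma leader_unique {C : Submodule (ZMod 2) W} (hC : IsGolayCode C) {T R R' : Finset (Fin 24)}
    (h : InC C (symmDiff R T)) (h' : InC C (symmDiff R' T)) (hc : R.card + R'.card < 8) : R = R' := by
  apply eq_of_symmDiff hC
  · have := h.symmDiff h'
    rwa [symmDiff_comm R' T, symmDiff_assoc, ← symmDiff_assoc T T, symmDiff_self, bot_symmDiff] at this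
  · have := card_symmDiff' R R'
    omega

lemma D2.pair {C : Submodule (ZMod 2) W} {T : Finset (Fin 24)} (h : D2 C T) :
    ∃ R : Finset (Fin 24), R.card = 2 ∧ InC C (symmDiff R T) := by
  obtain ⟨a, ha, b, hb, h⟩ := h
  exact ⟨{a, b}, Finset.card_pair (fun e => hb (e ▸ ha)), by rwa [symmDiff_comm]⟩

lemma PP.unique {C : Submodule (ZMod 2) W} (hC : IsGolayCode C) {k l : Fin 5} {T : Finset (Fin 24)}
    (h : PP C k T) (h' : PP C l T) : k = l := by
  obtain ⟨-, h⟩ := h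
  obtain ⟨-, h'⟩ := h'
  have e1 : ∀ n, Dn C n T → D2 C T → False := by
    intro n h1 h2
    obtain ⟨t, ht⟩ := h1.1
    rw [mem_tets] at ht
    obtain ⟨R, hR1, hR2⟩ := h2.pair
    have := leader_unique hC ht.2 hR2 (by omega)
    rw [this] at ht; omega
  have h0 : InC C T → InC C (symmDiff ∅ T) := fun h => by
    rw [← Finset.bot_eq_empty, bot_symmDiff]; exact h
  have e2 : ∀ n, Dn C n T → InC C T → False := by
    intro n h1 h2
    obtain ⟨t, ht⟩ := h1.1
    rw [mem_tets] at ht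
    have := leader_unique hC ht.2 (h0 h2) (by rw [Finset.card_empty]; omega)
    rw [this, Finset.card_empty] at ht; omega
  have e3 : D2 C T → InC C T → False := by
    intro h2 h1
    obtain ⟨R, hR1, hR2⟩ := h2.pair
    have := leader_unique hC hR2 (h0 h1) (by rw [Finset.card_empty]; omega)
    rw [this, Finset.card_empty] at hR1; omega
  have e4 : ∀ n m, Dn C n T → Dn C m T → n = m := fun n m h1 h2 => h1.2.symm.trans h2.2
  fin_cases k <;> fin_cases l <;> first
    | rfl
    | exact (e1 _ h h').elim
    | exact (e1 _ h' h).elim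
    | exact (e2 _ h h').elim
    | exact (e2 _ h' h).elim
    | exact (e3 h h').elim
    | exact (e3 h' h).elim
    | exact absurd (e4 _ _ h h') (by decide)

/-! ### Columns -/

/-- the columns -/
def colm : Finset (Finset (Fin 24)) := {ms 15, ms 240, ms 3840, ms 61440, ms 983040, ms 15728640}

lemma colm_card : colm.card = 6 := by decide

lemma inC_ms {m : ℕ} (h : rd bas m = 0) : InC C0 (ms m) := by
  unfold InC
  rw [ind_ms, ← rd_sound bas wd_mem_C0, h, wd_zero]; exact C0.zero_mem

lemma ms_symmDiff (a b : ℕ) : symmDiff (ms a) (ms b) = ms (a ^^^ b) := by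
  apply ind_injective
  rw [ind_symmDiff, ind_ms, ind_ms, ind_ms, wd_xor]

lemma tets15 : tets C0 (ms 15) = colm := by
  symm
  apply Finset.eq_of_subset_of_card_le
  · intro t ht
    rw [mem_tets]
    simp only [colm, Finset.mem_insert, Finset.mem_singleton] at ht
    rcases ht with rfl | rfl | rfl | rfl | rfl | rfl <;>
    · refine ⟨by decide, ?_⟩
      rw [ms_symmDiff]
      exact inC_ms (by decide +kernel)
  · rw [colm_card, tets, tet_card golay_C0 (by decide)]

lemma tets_of_coset {C : Submodule (ZMod 2) W} {S T : Finset (Fin 24)} (h : InC C (symmDiff S T)) : tets C S = tets C T := by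
  unfold tets
  rw [cst_eq.mpr h]

lemma land_iff (m a : ℕ) (ha : a < 2 ^ 24) : Nat.land m a = a ↔ ms a ⊆ ms m := by
  constructor
  · intro h i hi
    rw [mem_ms] at hi ⊢
    have : (m &&& a).testBit i = true := by
      show (Nat.land m a).testBit i = true
      rw [h, hi]
    rw [Nat.testBit_and, Bool.and_eq_true] at this
    exact this.1
  · intro h
    show m &&& a = a
    apply Nat.eq_of_testBit_eq
    intro i
    rw [Nat.testBit_and]
    by_cases hi : i < 24
    · cases hb : a.testBit i
      · simp
      · have := h (mem_ms.mpr (show a.testBit ((⟨i, hi⟩ : Fin 24) : ℕ) = true from hb))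
        rw [mem_ms] at this
        simp [this]
    · rw [Nat.testBit_lt_two_pow (lt_of_lt_of_le ha (Nat.pow_le_pow_right (by norm_num) (by omega)))]
      simp

lemma fc_eq (m : ℕ) : fc m = (colm.filter (· ⊆ ms m)).card := by
  have key : ∀ a, a < 2 ^ 24 → cond (Nat.beq (Nat.land m a) a) 1 0 = if ms a ⊆ ms m then 1 else 0 := by
    intro a ha
    by_cases h : ms a ⊆ ms m
    · rw [if_pos h, (land_iff m a ha).mpr h, Nat.beq_refl]; rfl
    · rw [if_neg h]
      have : Nat.beq (Nat.land m a) a = false := by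
        rw [← Bool.not_eq_true, Nat.beq_eq]
        exact fun h' => h ((land_iff m a ha).mp h')
      rw [this]; rfl
  rw [Finset.card_filter]
  unfold colm
  rw [Finset.sum_insert (by decide), Finset.sum_insert (by decide), Finset.sum_insert (by decide),
    Finset.sum_insert (by decide), Finset.sum_insert (by decide), Finset.sum_singleton]
  unfold fc
  rw [key _ (by norm_num), key _ (by norm_num), key _ (by norm_num), key _ (by norm_num), key _ (by norm_num),
    key _ (by norm_num)]
  rfl

end FiveOrbits
end

section
open Matrix

namespace FiveOrbits

/-- representatives -/
def R5 : Fin 5 → Finset (Fin 24) := ![ms 4095, ms 210607, ms 3364458, ms 221130, ms 221129]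

lemma Dn_ms {m n : ℕ} (h : rd bas (m ^^^ 15) = 0) (hf : fc m = n) : Dn C0 n (ms m) := by
  have h1 : tets C0 (ms m) = colm := by
    rw [← tets15]
    apply tets_of_coset
    rw [ms_symmDiff]
    exact inC_ms h
  refine ⟨?_, ?_⟩
  · rw [h1, ← Finset.card_pos, colm_card]; norm_num
  · rw [h1, ← fc_eq, hf]

lemma PP_R5 (k : Fin 5) : PP C0 k (R5 k) := by
  fin_cases k
  · exact ⟨by decide, Dn_ms (m := 4095) (n := 3) (by decide +kernel) (by decide +kernel)⟩
  · exact ⟨by decide, Dn_ms (m := 210607) (n := 1) (by decide +kernel) (by decide +kernel)⟩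
  · exact ⟨by decide, Dn_ms (m := 3364458) (n := 0) (by decide +kernel) (by decide +kernel)⟩
  · refine ⟨by decide, 1, by decide, 0, by decide, ?_⟩
    have e : ({1, 0} : Finset (Fin 24)) = ms 3 := by decide
    show InC C0 (symmDiff (ms 221130) {1, 0})
    rw [e, ms_symmDiff]
    exact inC_ms (by decide +kernel)
  · exact ⟨by decide, inC_ms (m := 221129) (by decide +kernel)⟩

lemma tb_of_wd {m z : ℕ} (h : wd m = wd z) (i : Fin 24) : tb m i = tb z i := by
  have h2 := Finset.ext_iff.mp (ms_of_wd h) i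
  rw [mem_ms, mem_ms] at h2
  rw [tb_eq, tb_eq]
  exact Bool.eq_iff_iff.mpr h2

lemma ext1_wd (m z : ℕ) (h : wd m = wd z) : ext1 m = ext1 z := by
  unfold ext1
  rw [show tb m 0 = tb z 0 from tb_of_wd h 0, show tb m 1 = tb z 1 from tb_of_wd h 1]

lemma ext3_wd (m z : ℕ) (h : wd m = wd z) : ext3 m = ext3 z := by
  unfold ext3
  rw [show tb m 0 = tb z 0 from tb_of_wd h 0, show tb m 1 = tb z 1 from tb_of_wd h 1]

lemma equiv_image {C : Submodule (ZMod 2) W} {g : Equiv.Perm (Fin 24)} (hg : IsAut C g) (S : Finset (Fin 24)) :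
    M24Equiv C S (S.image g) := m24_iff.mpr ⟨g, hg, rfl⟩

lemma trans4 {T : Finset (Fin 24)} (h12 : T.card = 12) (hT : InC C0 T) : M24Equiv C0 T (ms 221129) := by
  obtain ⟨a, ha⟩ : T.Nonempty := Finset.card_pos.mp (by omega)
  obtain ⟨b, hb⟩ : ∃ b, b ∉ T := by
    by_contra! h
    have : T = Finset.univ := by ext; simp [h]
    rw [this] at h12; simp at h12
  obtain ⟨g, hg, hga, hgb⟩ := trans_pair (fun e => hb (e ▸ ha) : a ≠ b)
  have e := equiv_image hg T
  obtain ⟨r, hr, h⟩ := descent gs1 0 ext1 [221129] ext1_wd gs1_ok chkX1 (T.image g)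
    (by rw [wd_zero, add_zero]; exact (hg.inC T).mpr hT) ((M24.card e).symm.trans h12) (by
      intro m hm
      have h0 : (0 : Fin 24) ∈ ms m := by rw [hm, ← hga]; exact Finset.mem_image_of_mem _ ha
      have h1 : (1 : Fin 24) ∉ ms m := by rw [hm, ← hgb]; simpa using hb
      rw [mem_ms] at h0 h1
      rw [ext1, tb_eq, tb_eq, Bool.and_eq_true, Bool.not_eq_true']
      exact ⟨h0, by simpa using h1⟩)
  rw [List.mem_singleton] at hr
  subst hr
  exact M24.trans e h

lemma trans3 {T : Finset (Fin 24)} (h12 : T.card = 12) (hT : D2 C0 T) : M24Equiv C0 T (ms 221130) := by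
  obtain ⟨b, hb, a, ha, hT⟩ := hT
  obtain ⟨g, hg, hga, hgb⟩ := trans_pair (fun e => ha (e ▸ hb) : a ≠ b)
  have e := equiv_image hg T
  have e3 : ms 3 = ({b, a} : Finset (Fin 24)).image g := by
    simp only [Finset.image_insert, Finset.image_singleton, hga, hgb]
    decide
  obtain ⟨r, hr, h⟩ := descent gs1 3 ext3 [221130] ext3_wd gs1_ok chkX3 (T.image g)
    (by
      rw [← ind_ms, ← ind_symmDiff, e3, ← image_symmDiff']
      exact (hg.inC _).mpr hT) ((M24.card e).symm.trans h12) (by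
      intro m hm
      have h0 : (1 : Fin 24) ∈ ms m := by rw [hm, ← hgb]; exact Finset.mem_image_of_mem _ hb
      have h1 : (0 : Fin 24) ∉ ms m := by rw [hm, ← hga]; simpa using ha
      rw [mem_ms] at h0 h1
      rw [ext3, tb_eq, tb_eq, Bool.and_eq_true, Bool.not_eq_true']
      exact ⟨h0, by simpa using h1⟩)
  rw [List.mem_singleton] at hr
  subst hr
  exact M24.trans e h

lemma trans012 {T : Finset (Fin 24)} (h12 : T.card = 12) (hT : (tets C0 T).Nonempty) :
    M24Equiv C0 T (ms 4095) ∨ M24Equiv C0 T (ms 210607) ∨ M24Equiv C0 T (ms 3364458) := by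
  obtain ⟨t, ht⟩ := hT
  rw [mem_tets] at ht
  obtain ⟨g, hg, hgt⟩ := trans_four ht.1
  have e := equiv_image hg T
  obtain ⟨r, hr, h⟩ := descent gs2 15 (fun _ => true) [4095, 210607, 3364458] (fun _ _ _ => rfl) gs2_ok chkX2
    (T.image g)
    (by
      rw [← ind_ms, ← ind_symmDiff, ← hgt, ← image_symmDiff', symmDiff_comm]
      exact (hg.inC _).mpr ht.2) ((M24.card e).symm.trans h12) (fun _ _ => rfl)
  have h2 := M24.trans e h
  simp only [List.mem_cons, List.not_mem_nil, or_false] at hr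
  rcases hr with rfl | rfl | rfl
  · exact Or.inl h2
  · exact Or.inr (Or.inl h2)
  · exact Or.inr (Or.inr h2)

lemma exists_k {T : Finset (Fin 24)} (h12 : T.card = 12) : ∃ k, M24Equiv C0 T (R5 k) := by
  obtain ⟨R, h1, h2, h3⟩ := exists_leader golay_C0 _ T rfl
  rw [h12] at h2
  have : R.card = 0 ∨ R.card = 2 ∨ R.card = 4 := by omega
  rcases this with h | h | h
  · rw [Finset.card_eq_zero.mp h, ← Finset.bot_eq_empty, symmDiff_bot] at h3
    exact ⟨4, trans4 h12 h3⟩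
  · obtain ⟨a, b, hab, rfl⟩ := Finset.card_eq_two.mp h
    refine ⟨3, trans3 h12 ?_⟩
    have h4 := card_symmDiff' T {a, b}
    have h5 := wt_C0 h3
    rw [h12, h] at h4
    have h7 : (T ∩ {a, b}).card ≤ ({a, b} : Finset (Fin 24)).card := Finset.card_le_card Finset.inter_subset_right
    rw [h] at h7
    have h6 : (T ∩ {a, b}).card = 1 := by omega
    by_cases ha : a ∈ T
    · by_cases hb : b ∈ T
      · have : T ∩ {a, b} = {a, b} := by
          ext x; simp only [Finset.mem_inter, Finset.mem_insert, Finset.mem_singleton]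
          constructor
          · exact fun h => h.2
          · rintro (rfl | rfl) <;> simp [ha, hb]
        rw [this] at h6; omega
      · exact ⟨a, ha, b, hb, h3⟩
    · by_cases hb : b ∈ T
      · exact ⟨b, hb, a, ha, by rw [Finset.pair_comm]; exact h3⟩
      · have : T ∩ {a, b} = ∅ := by
          ext x; simp only [Finset.mem_inter, Finset.mem_insert, Finset.mem_singleton, Finset.notMem_empty, iff_false]
          rintro ⟨hxT, rfl | rfl⟩
          · exact ha hxT
          · exact hb hxT
        rw [this] at h6; simp at h6
  · have := trans012 h12 ⟨R, mem_tets.mpr ⟨h, by rwa [symmDiff_comm]⟩⟩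
    rcases this with h | h | h
    · exact ⟨0, h⟩
    · exact ⟨1, h⟩
    · exact ⟨2, h⟩

lemma equiv_iff_PP (k : Fin 5) (T : Finset (Fin 24)) : M24Equiv C0 (R5 k) T ↔ PP C0 k T := by
  constructor
  · exact fun h => (PP_R5 k).equiv h
  · intro h
    obtain ⟨l, hl⟩ := exists_k h.1
    have h2 := h.equiv hl
    have := PP.unique golay_C0 h2 (PP_R5 l)
    rw [this]
    exact M24.symm hl

/-! ### Counting -/

lemma count4 : Nat.card {T : Finset (Fin 24) // PP C0 4 T} = 2576 := by
  rw [← cnt_dod, ← count_coset 0 _ (fun T => T.card = 12) (fun m => by rw [Nat.beq_eq, cnt24])]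
  apply Nat.card_congr
  apply Equiv.subtypeEquivRight
  intro T
  rw [wd_zero, add_zero, and_comm]
  rfl

lemma symmDiff_pair_mem {c : Finset (Fin 24)} {a b : Fin 24} (ha : a ∈ c) (hb : b ∉ c) :
    symmDiff c {a, b} = insert b (c.erase a) := by
  have hab : a ≠ b := fun e => hb (e ▸ ha)
  ext x
  simp only [Finset.mem_symmDiff, Finset.mem_insert, Finset.mem_singleton, Finset.mem_erase]
  by_cases h1 : x = a
  · subst h1; simp [ha, hab]
  · by_cases h2 : x = b
    · subst h2; simp [hb]
    · simp [h1, h2]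

lemma count3 : Nat.card {T : Finset (Fin 24) // PP C0 3 T} = 370944 := by
  classical
  set A : Finset (Finset (Fin 24)) := Finset.univ.filter fun T => PP C0 4 T with hA
  have hAc : A.card = 2576 := by
    rw [← count4]
    exact (Nat.subtype_card A (by simp [hA])).symm
  set B : Finset (Finset (Fin 24)) := Finset.univ.filter fun T => PP C0 3 T with hB
  rw [Nat.subtype_card B (by simp [hB])]
  have hs : (A.sigma fun c => c ×ˢ cᶜ).card = 370944 := by
    rw [Finset.card_sigma, Finset.sum_const_nat (m := 144), hAc]
    intro c hc
    have h12 : c.card = 12 := (Finset.mem_filter.mp hc).2.1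
    rw [Finset.card_product, Finset.card_compl, h12, Fintype.card_fin]
  rw [← hs]
  symm
  apply Finset.card_bij (fun p _ => symmDiff p.1 {p.2.1, p.2.2})
  · rintro ⟨c, a, b⟩ hp
    simp only [Finset.mem_sigma, Finset.mem_product, Finset.mem_compl] at hp
    obtain ⟨hc, ha, hb⟩ := hp
    obtain ⟨h12, hC⟩ := (Finset.mem_filter.mp hc).2
    have hab : a ≠ b := fun e => hb (e ▸ ha)
    refine Finset.mem_filter.mpr ⟨Finset.mem_univ _, ?_, b, ?_, a, ?_, ?_⟩
    · show (symmDiff c {a, b}).card = 12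
      rw [symmDiff_pair_mem ha hb, Finset.card_insert_of_notMem (fun h => hb (Finset.mem_of_mem_erase h)),
        Finset.card_erase_of_mem ha, h12]
    · show b ∈ symmDiff c {a, b}
      rw [symmDiff_pair_mem ha hb]; exact Finset.mem_insert_self _ _
    · show a ∉ symmDiff c {a, b}
      rw [symmDiff_pair_mem ha hb]; simp [hab]
    · show InC C0 (symmDiff (symmDiff c {a, b}) {b, a})
      rw [Finset.pair_comm b a, symmDiff_symmDiff_cancel_right]
      exact hC
  · rintro ⟨c, a, b⟩ hp ⟨c', a', b'⟩ hp' he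
    simp only [Finset.mem_sigma, Finset.mem_product, Finset.mem_compl] at hp hp'
    obtain ⟨hc, ha, hb⟩ := hp
    obtain ⟨hc', ha', hb'⟩ := hp'
    have hC : InC C0 c := (Finset.mem_filter.mp hc).2.2
    have hC' : InC C0 c' := (Finset.mem_filter.mp hc').2.2
    have he : symmDiff c {a, b} = symmDiff c' {a', b'} := he
    have hab : a ≠ b := fun e => hb (e ▸ ha)
    have hab' : a' ≠ b' := fun e => hb' (e ▸ ha')
    have hR : ({a, b} : Finset (Fin 24)) = {a', b'} := by
      apply leader_unique golay_C0 (T := symmDiff c {a, b})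
      · rw [symmDiff_comm, symmDiff_symmDiff_cancel_right]; exact hC
      · rw [he, symmDiff_comm, symmDiff_symmDiff_cancel_right]; exact hC'
      · rw [Finset.card_pair hab, Finset.card_pair hab']; norm_num
    have hcc : c = c' := by
      rw [hR] at he
      exact symmDiff_left_injective _ he
    subst hcc
    have h1 : a = a' := by
      have : a ∈ ({a', b'} : Finset (Fin 24)) := by rw [← hR]; simp
      rcases Finset.mem_insert.mp this with h | h
      · exact h
      · exact absurd ((Finset.mem_singleton.mp h) ▸ ha) hb'
    have h2 : b = b' := by
      have : b ∈ ({a', b'} : Finset (Fin 24)) := by rw [← hR]; simp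
      rcases Finset.mem_insert.mp this with h | h
      · exact absurd (h ▸ ha') hb
      · exact Finset.mem_singleton.mp h
    subst h1 h2
    rfl
  · intro T hT
    obtain ⟨h12, a, ha, b, hb, hC⟩ := (Finset.mem_filter.mp hT).2
    have hab : a ≠ b := fun e => hb (e ▸ ha)
    refine ⟨⟨symmDiff T {a, b}, b, a⟩, ?_, ?_⟩
    · simp only [Finset.mem_sigma, Finset.mem_product, Finset.mem_compl]
      refine ⟨Finset.mem_filter.mpr ⟨Finset.mem_univ _, ?_, hC⟩, ?_, ?_⟩
      · rw [symmDiff_pair_mem ha hb, Finset.card_insert_of_notMem (fun h => hb (Finset.mem_of_mem_erase h)),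
          Finset.card_erase_of_mem ha, h12]
      · rw [symmDiff_pair_mem ha hb]; exact Finset.mem_insert_self _ _
      · rw [symmDiff_pair_mem ha hb]; simp [hab]
    · show symmDiff (symmDiff T {a, b}) {b, a} = T
      rw [Finset.pair_comm b a, symmDiff_symmDiff_cancel_right]

lemma countn (n v : ℕ) (hv : cntC (fun m => Nat.beq (cnt m (List.range 24)) 12 && Nat.beq (fc m) n) bas 15 = v) :
    10626 * v = Nat.card {T : Finset (Fin 24) // T.card = 12 ∧ Dn C0 n T} * 6 := by
  classical
  set B : Finset (Finset (Fin 24)) := Finset.univ.filter fun T => T.card = 12 ∧ Dn C0 n T with hB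
  have hmB : ∀ T, T ∈ B ↔ T.card = 12 ∧ Dn C0 n T := by simp [hB]
  rw [Nat.subtype_card B hmB]
  have h10626 : (Finset.powersetCard 4 (Finset.univ : Finset (Fin 24))).card = 10626 := by
    rw [Finset.card_powersetCard, Finset.card_univ, Fintype.card_fin]; decide
  rw [← h10626]
  apply Finset.card_mul_eq_card_mul (fun t T => InC C0 (symmDiff t T))
  · intro t ht
    have ht4 : t.card = 4 := (Finset.mem_powersetCard.mp ht).2
    obtain ⟨g, hg, hgt⟩ := trans_four ht4
    rw [← hv, ← count_coset 15 _ (fun T => T.card = 12 ∧ (colm.filter (· ⊆ T)).card = n) (fun m => by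
      rw [Bool.and_eq_true, Nat.beq_eq, Nat.beq_eq, cnt24, fc_eq])]
    have hinv : ∀ T : Finset (Fin 24), (T.image (g⁻¹ : Equiv.Perm (Fin 24))).image g = T := fun T => by
      rw [Finset.image_image]; simp [Function.comp_def]
    have key : ∀ T : Finset (Fin 24), (T ∈ B ∧ InC C0 (symmDiff t T)) ↔
        (ind (T.image g) + wd 15 ∈ C0 ∧ (T.image g).card = 12 ∧ (colm.filter (· ⊆ T.image g)).card = n) := by
      intro T
      have h1 : InC C0 (symmDiff t T) ↔ ind (T.image g) + wd 15 ∈ C0 := by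
        rw [← hg.inC, image_symmDiff', hgt, symmDiff_comm]
        unfold InC
        rw [ind_symmDiff, ind_ms]
      rw [← h1, hmB, Finset.card_image_of_injective _ g.injective, and_comm]
      refine and_congr_right fun h => and_congr_right fun _ => ?_
      have h3 : tets C0 (T.image g) = colm := by
        rw [← tets15]
        apply tets_of_coset
        rw [← hgt, ← image_symmDiff', hg.inC, symmDiff_comm]
        exact h
      constructor
      · intro hD
        have := (hD.image hg).2
        rwa [h3] at this
      · intro hD
        have hDg : Dn C0 n (T.image g) := ⟨by rw [h3, ← Finset.card_pos, colm_card]; norm_num, by rw [h3]; exact hD⟩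
        have := hDg.image hg.inv
        rw [Finset.image_image] at this
        simpa [Function.comp_def] using this
    rw [← Nat.subtype_card (Finset.bipartiteAbove (fun t T => InC C0 (symmDiff t T)) B t)
      (p := fun T => T ∈ B ∧ InC C0 (symmDiff t T)) (fun T => by simp [Finset.mem_bipartiteAbove])]
    apply Nat.card_congr
    refine Equiv.ofBijective (fun T => ⟨T.1.image g, (key T.1).mp T.2⟩) ⟨?_, ?_⟩
    · intro S T h
      exact Subtype.ext (Finset.image_injective g.injective (congrArg Subtype.val h))
    · rintro ⟨T, hT⟩
      exact ⟨⟨T.image (g⁻¹ : Equiv.Perm (Fin 24)), (key _).mpr (by rw [hinv]; exact hT)⟩, Subtype.ext (hinv T)⟩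
  · intro T hT
    obtain ⟨h12, ⟨t, ht⟩, -⟩ := (hmB T).mp hT
    rw [mem_tets] at ht
    have : Finset.bipartiteBelow (fun t T => InC C0 (symmDiff t T)) (Finset.powersetCard 4 Finset.univ) T
        = tets C0 t := by
      rw [tets_of_coset ht.2]
      ext s
      rw [Finset.mem_bipartiteBelow, mem_tets, Finset.mem_powersetCard_univ]
    rw [this, tets, tet_card golay_C0 ht.1]

/-- orbit sizes -/
def osz : Fin 5 → ℕ := ![2^2*5*7*11*23, 2^4*3^2*5*7*11*23, 2^6*3^2*7*11*23, 2^8*3^2*7*23, 2^4*7*23]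

lemma count_PP (k : Fin 5) : Nat.card {T : Finset (Fin 24) // PP C0 k T} = osz k := by
  fin_cases k
  · have := countn 3 _ cnt_fc3
    show Nat.card {T : Finset (Fin 24) // T.card = 12 ∧ Dn C0 3 T} = 2^2*5*7*11*23
    omega
  · have := countn 1 _ cnt_fc1
    show Nat.card {T : Finset (Fin 24) // T.card = 12 ∧ Dn C0 1 T} = 2^4*3^2*5*7*11*23
    omega
  · have := countn 0 _ cnt_fc0
    show Nat.card {T : Finset (Fin 24) // T.card = 12 ∧ Dn C0 0 T} = 2^6*3^2*7*11*23
    omega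
  · exact count3
  · exact count4

/-- the first half of the theorem -/
theorem m24_orbits {C : Submodule (ZMod 2) W} (hC : IsGolayCode C) :
    ∃ S : Fin 5 → Finset (Fin 24),
      (∀ k, (S k).card = 12) ∧
      (∀ k l, k ≠ l → ¬ M24Equiv C (S k) (S l)) ∧
      (∀ T : Finset (Fin 24), T.card = 12 → ∃ k, M24Equiv C (S k) T) ∧
      (∀ k, Nat.card {T : Finset (Fin 24) // M24Equiv C (S k) T} = osz k) := by
  obtain ⟨σ, -, hσ⟩ := uniq hC
  have hinv : ∀ T : Finset (Fin 24), (T.image (σ⁻¹ : Equiv.Perm (Fin 24))).image σ = T := fun T => by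
    rw [Finset.image_image]; simp [Function.comp_def]
  have key : ∀ S T, M24Equiv C S T ↔ M24Equiv C0 (S.image σ) (T.image σ) := by
    intro S T
    rw [← hσ, m24_pull]
  refine ⟨fun k => (R5 k).image (σ⁻¹ : Equiv.Perm (Fin 24)), ?_, ?_, ?_, ?_⟩
  · intro k
    rw [Finset.card_image_of_injective _ (Equiv.injective _), (PP_R5 k).1]
  · intro k l hkl h
    rw [key, hinv, hinv, equiv_iff_PP] at h
    exact hkl (PP.unique golay_C0 h (PP_R5 l))
  · intro T hT
    obtain ⟨k, hk⟩ := exists_k (T := T.image σ) (by rw [Finset.card_image_of_injective _ σ.injective, hT])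
    exact ⟨k, by rw [key, hinv]; exact M24.symm hk⟩
  · intro k
    rw [← count_PP k]
    apply Nat.card_congr
    refine Equiv.ofBijective (fun T => ⟨T.1.image σ, ?_⟩) ⟨?_, ?_⟩
    · have := T.2
      rw [key, hinv, equiv_iff_PP] at this
      exact this
    · intro S T h
      exact Subtype.ext (Finset.image_injective σ.injective (congrArg Subtype.val h))
    · rintro ⟨T, hT⟩
      refine ⟨⟨T.image (σ⁻¹ : Equiv.Perm (Fin 24)), ?_⟩, Subtype.ext (hinv T)⟩
      rw [key, hinv, hinv, equiv_iff_PP]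
      exact hT

end FiveOrbits
end

section
open Matrix

namespace FiveOrbits

variable {Λ : EvenUnimodularLattice 24}

/-! ### Isometries -/

/-- linear isometries of the lattice -/
def IsIsom (Λ : EvenUnimodularLattice 24) (e : V ≃ₗ[ℤ] V) : Prop := ∀ v w, ip Λ (e v) (e w) = ip Λ v w

lemma IsIsom.symm {e : V ≃ₗ[ℤ] V} (h : IsIsom Λ e) : IsIsom Λ e.symm := by
  intro v w
  rw [← h, e.apply_symm_apply, e.apply_symm_apply]

lemma IsIsom.trans {e e' : V ≃ₗ[ℤ] V} (h : IsIsom Λ e) (h' : IsIsom Λ e') : IsIsom Λ (e.trans e') := by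
  intro v w
  rw [LinearEquiv.trans_apply, LinearEquiv.trans_apply, h', h]

lemma ip_mulVec (U : Matrix (Fin 24) (Fin 24) ℤ) (v w : V) :
    ip Λ (U *ᵥ v) (U *ᵥ w) = v ⬝ᵥ (Uᵀ * Λ.gram * U) *ᵥ w := by
  rw [← inner_eq_ip, EvenUnimodularLattice.inner, ← mulVec_mulVec, ← mulVec_mulVec,
    dotProduct_mulVec v, vecMul_transpose]

lemma autEquiv_iff {N N' : Submodule ℤ V} :
    AutEquiv Λ N N' ↔ ∃ e : V ≃ₗ[ℤ] V, IsIsom Λ e ∧ N.map e.toLinearMap = N' := by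
  constructor
  · rintro ⟨U, hU, rfl⟩
    have hdet : IsUnit U.det := by
      have := congrArg Matrix.det hU
      rw [det_mul, det_mul, det_transpose, Λ.unimodular, mul_one] at this
      exact IsUnit.of_mul_eq_one _ this
    have hE : ∀ v, Matrix.toLin'OfInv (Matrix.nonsing_inv_mul U hdet) (Matrix.mul_nonsing_inv U hdet) v = U *ᵥ v :=
      fun v => by simp [Matrix.toLin'OfInv]
    refine ⟨Matrix.toLin'OfInv (Matrix.nonsing_inv_mul U hdet) (Matrix.mul_nonsing_inv U hdet), ?_, ?_⟩
    swap
    · congr 1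
    intro v w
    rw [hE, hE]
    rw [ip_mulVec, hU, ← inner_eq_ip]
    rfl
  · rintro ⟨e, he, rfl⟩
    have h1 : Matrix.mulVecLin (LinearMap.toMatrix' e.toLinearMap) = e.toLinearMap := by
      rw [← Matrix.toLin'_apply', Matrix.toLin'_toMatrix']
    refine ⟨LinearMap.toMatrix' e.toLinearMap, ?_, by rw [h1]⟩
    apply Matrix.ext_iff_mulVec.mpr
    intro w
    apply dotProduct_eq
    intro v
    rw [dotProduct_comm, dotProduct_comm _ v, ← ip_mulVec, ← Matrix.mulVecLin_apply, ← Matrix.mulVecLin_apply, h1]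
    refine (he v w).trans ?_
    rw [← inner_eq_ip]; rfl

lemma AutEquiv.refl' (N : Submodule ℤ V) : AutEquiv Λ N N :=
  autEquiv_iff.mpr ⟨LinearEquiv.refl ℤ V, fun _ _ => rfl, Submodule.map_id N⟩

lemma AutEquiv.symm' {N N' : Submodule ℤ V} (h : AutEquiv Λ N N') : AutEquiv Λ N' N := by
  obtain ⟨e, he, rfl⟩ := autEquiv_iff.mp h
  refine autEquiv_iff.mpr ⟨e.symm, he.symm, ?_⟩
  rw [← Submodule.map_comp]
  simp

lemma AutEquiv.trans' {N N' N'' : Submodule ℤ V} (h : AutEquiv Λ N N') (h' : AutEquiv Λ N' N'') :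
    AutEquiv Λ N N'' := by
  obtain ⟨e, he, rfl⟩ := autEquiv_iff.mp h
  obtain ⟨e', he', rfl⟩ := autEquiv_iff.mp h'
  refine autEquiv_iff.mpr ⟨e.trans e', he.trans he', ?_⟩
  rw [← Submodule.map_comp]
  rfl

lemma red_map (e : V ≃ₗ[ℤ] V) {v w : V} (h : Λ.red v = Λ.red w) : Λ.red (e v) = Λ.red (e w) := by
  rw [red_eq_iff] at h ⊢
  obtain ⟨z, hz⟩ := h
  exact ⟨e z, by rw [← map_sub, hz, map_smul]⟩

lemma IsFrame.isom {f : Fin 24 → V} (hf : IsFrame Λ f) {e : V ≃ₗ[ℤ] V} (he : IsIsom Λ e) :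
    IsFrame Λ (fun i => e (f i)) :=
  ⟨fun i => by rw [he, hf.self], fun i j h => by rw [he, hf.orth i j h], fun i j => red_map e (hf.red i j)⟩

lemma IsFrame.perm {f : Fin 24 → V} (hf : IsFrame Λ f) (σ : Equiv.Perm (Fin 24)) :
    IsFrame Λ (fun i => f (σ i)) :=
  ⟨fun _ => hf.self _, fun _ _ h => hf.orth _ _ fun h' => h (σ.injective h'), fun _ _ => hf.red _ _⟩

lemma leechSet_perm {C : Submodule (ZMod 2) W} (σ : Equiv.Perm (Fin 24)) (x : V) :
    LeechSet (pull σ C) x ↔ LeechSet C (fun i => x (σ i)) := by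
  unfold LeechSet
  refine exists_congr fun m => and_congr Iff.rfl (and_congr ?_ (and_congr Iff.rfl ?_))
  · exact (σ.surjective.forall (p := fun i => 2 ∣ x i - m))
  · rw [Equiv.sum_comp σ x]

lemma IsGood.isom {f : Fin 24 → V} {C : Submodule (ZMod 2) W} (hf : IsGood Λ f C) {e : V ≃ₗ[ℤ] V}
    (he : IsIsom Λ e) : IsGood Λ (fun i => e (f i)) C := by
  refine ⟨hf.frame.isom he, hf.golay, fun x => ?_⟩
  rw [← hf.mem_iff]
  have key : ∀ v, coord Λ (fun i => e (f i)) (e v) = coord Λ f v := fun v => by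
    funext i; rw [coord_apply, coord_apply, he]
  constructor
  · rintro ⟨v, rfl⟩
    exact ⟨e.symm v, by rw [← key, e.apply_symm_apply]⟩
  · rintro ⟨v, rfl⟩
    exact ⟨e v, key v⟩

lemma IsGood.perm {f : Fin 24 → V} {C : Submodule (ZMod 2) W} (hf : IsGood Λ f C) (σ : Equiv.Perm (Fin 24)) :
    IsGood Λ (fun i => f (σ i)) (pull σ⁻¹ C) := by
  refine ⟨hf.frame.perm σ, pull_golay hf.golay _, fun x => ?_⟩
  rw [leechSet_perm, ← hf.mem_iff]
  constructor
  · rintro ⟨v, rfl⟩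
    exact ⟨v, by funext i; simp⟩
  · rintro ⟨v, hv⟩
    refine ⟨v, ?_⟩
    funext i
    have := congrFun hv (σ i)
    simpa using this

lemma IsGood.exists_isom {f f' : Fin 24 → V} {C : Submodule (ZMod 2) W} (hf : IsGood Λ f C)
    (hf' : IsGood Λ f' C) : ∃ e, IsIsom Λ e ∧ ∀ i, e (f i) = f' i := by
  have hr : LinearMap.range (coord Λ f) = LinearMap.range (coord Λ f') := by
    ext x; rw [hf.mem_iff, hf'.mem_iff]
  let e1 := LinearEquiv.ofInjective (coord Λ f) hf.frame.coord_injective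
  let e2 := LinearEquiv.ofInjective (coord Λ f') hf'.frame.coord_injective
  let e := (e1.trans (LinearEquiv.ofEq _ _ hr)).trans e2.symm
  have key : ∀ v, coord Λ f' (e v) = coord Λ f v := by
    intro v
    have h : e2 (e v) = LinearEquiv.ofEq _ _ hr (e1 v) := e2.apply_symm_apply _
    exact congrArg Subtype.val h
  refine ⟨e, fun v w => ?_, fun i => ?_⟩
  · have h1 := hf.frame.ip_coord v w
    have h2 := hf'.frame.ip_coord (e v) (e w)
    rw [key, key] at h2
    omega
  · apply hf'.frame.coord_injective
    rw [key, hf.frame.coord_frame, hf'.frame.coord_frame]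

theorem exists_good' (hΛ : IsLeech Λ) {C : Submodule (ZMod 2) W} (hC : IsGolayCode C) {c : W}
    (hc : c ∈ frameClasses Λ) : ∃ f, IsGood Λ f C ∧ ∀ i, Λ.red (f i) = c := by
  obtain ⟨f, C', hf, hfc⟩ := exists_good hΛ hc
  obtain ⟨σ, -, hσ⟩ := uniq hC
  obtain ⟨σ', -, hσ'⟩ := uniq hf.golay
  refine ⟨fun i => f ((σ⁻¹ * σ')⁻¹ i), ?_, fun i => hfc _⟩
  have := hf.perm (σ⁻¹ * σ')⁻¹
  rwa [inv_inv, pull_mul, hσ', ← hσ, ← pull_mul, inv_mul_cancel, pull_one] at this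

lemma code_le {f f' : Fin 24 → V} {C C' : Submodule (ZMod 2) W} (hf : IsGood Λ f C) (hf' : IsGood Λ f' C')
    (h : ∀ i, f i = f' i ∨ f i = - f' i) : C ≤ C' := by
  intro c hc
  have h4 : 4 ∣ (supp c).card := by
    obtain ⟨σ, -, hσ⟩ := uniq hf.golay
    have h5 : InC C (supp c) := by unfold InC; rwa [ind_supp]
    rw [inC_image (g := σ), hσ] at h5
    have h6 := wt_C0 h5
    rw [Finset.card_image_of_injective _ σ.injective] at h6
    omega
  obtain ⟨v, hv⟩ : (fun i => if c i ≠ 0 then (2 : ℤ) else 0) ∈ LinearMap.range (coord Λ f) := by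
    rw [hf.mem_iff]
    refine ⟨0, Or.inl rfl, fun i => ?_, ?_, ?_⟩
    · dsimp only; split_ifs <;> norm_num
    · convert! hc using 1
      funext i
      have : ∀ a : ZMod 2, ((((if a ≠ 0 then (2 : ℤ) else 0) - 0) / 2 : ℤ) : ZMod 2) = a := by decide
      exact this (c i)
    · rw [← Finset.sum_filter, Finset.sum_const]
      change 8 ∣ (supp c).card • (2 : ℤ) - _
      rw [nsmul_eq_mul]
      omega
  have hv' : ∀ i, coord Λ f' v i = coord Λ f v i ∨ coord Λ f' v i = - coord Λ f v i := by
    intro i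
    rw [coord_apply, coord_apply]
    rcases h i with h | h
    · rw [h]; exact Or.inl rfl
    · rw [h, map_neg, neg_neg]; exact Or.inr rfl
  rw [hv] at hv'
  obtain ⟨m, hm, h2, h3, -⟩ := (hf'.mem_iff _).mp ⟨v, rfl⟩
  have hm0 : m = 0 := by
    have := h2 0
    have h5 := hv' 0
    dsimp only at h5
    split_ifs at h5 <;> omega
  subst hm0
  convert! h3 using 1
  funext i
  have h5 := hv' i
  dsimp only at h5
  have h6 : ∀ a : ZMod 2, ∀ z : ZMod 2, (a ≠ 0 → z = 1) → (a = 0 → z = 0) → a = z := by decide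
  refine h6 _ _ (fun h7 => ?_) (fun h7 => ?_)
  · rw [if_pos h7] at h5
    rcases h5 with h5 | h5 <;> rw [h5] <;> decide
  · rw [if_neg (not_not.mpr h7)] at h5
    rcases h5 with h5 | h5 <;> rw [h5] <;> decide

lemma code_eq {f f' : Fin 24 → V} {C C' : Submodule (ZMod 2) W} (hf : IsGood Λ f C) (hf' : IsGood Λ f' C')
    (h : ∀ i, f i = f' i ∨ f i = - f' i) : C = C' := by
  refine le_antisymm (code_le hf hf' h) (code_le hf' hf fun i => ?_)
  rcases h i with h | h
  · exact Or.inl h.symm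
  · exact Or.inr (by rw [h, neg_neg])

end FiveOrbits
end

section
open Matrix

namespace FiveOrbits

variable {Λ : EvenUnimodularLattice 24}

/-! ### The sublattices attached to 12-subsets of a frame -/

/-- the sublattice attached to a frame and a set of frame vectors -/
def NT (Λ : EvenUnimodularLattice 24) (f : Fin 24 → V) (T : Finset (Fin 24)) : Submodule ℤ V where
  carrier := {v | (∀ i, i ∉ T → coord Λ f v i = 0) ∧ ∀ i, 4 ∣ coord Λ f v i}
  add_mem' := by
    rintro a b ⟨h1, h2⟩ ⟨h3, h4⟩
    refine ⟨fun i hi => ?_, fun i => ?_⟩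
    · rw [map_add, Pi.add_apply, h1 i hi, h3 i hi, add_zero]
    · rw [map_add, Pi.add_apply]; exact dvd_add (h2 i) (h4 i)
  zero_mem' := by
    refine ⟨fun i _ => ?_, fun i => ?_⟩ <;> rw [map_zero, Pi.zero_apply]
    exact dvd_zero _
  smul_mem' := by
    rintro c a ⟨h1, h2⟩
    refine ⟨fun i hi => ?_, fun i => ?_⟩ <;> rw [map_smul, Pi.smul_apply, smul_eq_mul]
    · rw [h1 i hi, mul_zero]
    · exact Dvd.dvd.mul_left (h2 i) c

lemma mem_NT {f : Fin 24 → V} {T : Finset (Fin 24)} {v : V} :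
    v ∈ NT Λ f T ↔ (∀ i, i ∉ T → coord Λ f v i = 0) ∧ ∀ i, 4 ∣ coord Λ f v i := Iff.rfl

lemma coord_isom {f : Fin 24 → V} {e : V ≃ₗ[ℤ] V} (he : IsIsom Λ e) (v : V) :
    coord Λ (fun i => e (f i)) (e v) = coord Λ f v := by
  funext i; rw [coord_apply, coord_apply, he]

lemma NT_isom {f : Fin 24 → V} {e : V ≃ₗ[ℤ] V} (he : IsIsom Λ e) (T : Finset (Fin 24)) :
    (NT Λ f T).map e.toLinearMap = NT Λ (fun i => e (f i)) T := by
  ext v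
  rw [Submodule.mem_map]
  constructor
  · rintro ⟨w, hw, rfl⟩
    rw [mem_NT] at hw ⊢
    rw [LinearEquiv.coe_coe, coord_isom he]
    exact hw
  · intro hv
    refine ⟨e.symm v, ?_, e.apply_symm_apply v⟩
    rw [mem_NT, ← coord_isom he, e.apply_symm_apply]
    exact hv

lemma NT_perm {f : Fin 24 → V} (g : Equiv.Perm (Fin 24)) (T : Finset (Fin 24)) :
    NT Λ (fun i => f (g i)) T = NT Λ f (T.image g) := by
  ext v
  rw [mem_NT, mem_NT, g.surjective.forall (p := fun i => i ∉ T.image g → _),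
    g.surjective.forall (p := fun i => 4 ∣ coord Λ f v i)]
  simp

lemma frame_mem_NT {f : Fin 24 → V} (hf : IsFrame Λ f) {T : Finset (Fin 24)} {i : Fin 24} :
    f i ∈ NT Λ f T ↔ i ∈ T := by
  rw [mem_NT, hf.coord_frame]
  constructor
  · rintro ⟨h, -⟩
    by_contra hi
    have := h i hi
    rw [Pi.single_eq_same] at this
    omega
  · intro hi
    refine ⟨fun j hj => ?_, fun j => ?_⟩
    · rw [Pi.single_eq_of_ne]; rintro rfl; exact hj hi
    · rw [Pi.single_apply]; split_ifs <;> norm_num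

lemma frame_dvd {f : Fin 24 → V} {T : Finset (Fin 24)} (i : Fin 24) : ∀ w ∈ NT Λ f T, 4 ∣ ip Λ (f i) w := by
  intro w hw
  rw [ip_comm]
  exact hw.2 i

/-- building lattice vectors with coordinates divisible by four -/
lemma IsGood.exists_four {f : Fin 24 → V} {C : Submodule (ZMod 2) W} (hf : IsGood Λ f C) (y : V)
    (hy : 2 ∣ ∑ i, y i) : ∃ v, coord Λ f v = fun i => 4 * y i := by
  rw [← LinearMap.mem_range, hf.mem_iff]
  refine ⟨0, Or.inl rfl, fun i => ?_, ?_, ?_⟩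
  · dsimp only; omega
  · convert! C.zero_mem using 1
    funext i
    rw [show (4 * y i - 0) / 2 = 2 * y i by omega, Int.cast_mul]
    rw [show ((2 : ℤ) : ZMod 2) = 0 by decide, zero_mul]
    rfl
  · rw [← Finset.mul_sum]; omega

lemma IsGood.sum_even {f : Fin 24 → V} {C : Submodule (ZMod 2) W} (hf : IsGood Λ f C) {v y : V}
    (h : ∀ i, coord Λ f v i = 4 * y i) : 2 ∣ ∑ i, y i := by
  obtain ⟨m, hm, h2, -, h4⟩ := (hf.mem_iff _).mp ⟨v, rfl⟩
  simp only [h] at h2 h4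
  rw [← Finset.mul_sum] at h4
  have := h2 0
  omega

lemma frame_vec {f : Fin 24 → V} {C : Submodule (ZMod 2) W} (hf : IsGood Λ f C) {T : Finset (Fin 24)}
    (hT : T.card = 12) {v : V} (hv : v ∈ NT Λ f T) (h8 : ip Λ v v = 8)
    (h4 : ∀ w ∈ NT Λ f T, 4 ∣ ip Λ v w) : ∃ i ∈ T, v = f i ∨ v = - f i := by
  obtain ⟨hv0, hv4⟩ := hv
  choose y hy using hv4
  have hsq : ∑ i ∈ T, y i ^ 2 = 4 := by
    have h1 := hf.frame.ip_coord v v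
    have h2 : coord Λ f v ⬝ᵥ coord Λ f v = 16 * ∑ i ∈ T, y i ^ 2 := by
      rw [dotProduct, Finset.mul_sum]
      symm
      apply Finset.sum_subset_zero_on_sdiff (Finset.subset_univ T)
      · intro i hi
        rw [hv0 i (Finset.mem_sdiff.mp hi).2, zero_mul]
      · intro i _
        rw [hy]; ring
    omega
  have hpar : ∀ i ∈ T, ∀ j ∈ T, 2 ∣ y i - y j := by
    intro i hi j hj
    by_cases hij : i = j
    · subst hij; simp
    obtain ⟨w, hw⟩ := hf.exists_four (Pi.single i 1 - Pi.single j 1) (by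
      simp [Finset.sum_sub_distrib])
    have hwN : w ∈ NT Λ f T := by
      rw [mem_NT, hw]
      refine ⟨fun k hk => ?_, fun k => dvd_mul_right _ _⟩
      have h1 : k ≠ i := by rintro rfl; exact hk hi
      have h2 : k ≠ j := by rintro rfl; exact hk hj
      simp [h1, h2]
    have h1 := h4 w hwN
    have h2 := hf.frame.ip_coord v w
    have h3 : coord Λ f v ⬝ᵥ coord Λ f w = 4 * (coord Λ f v i - coord Λ f v j) := by
      have : coord Λ f w = (4 : ℤ) • (Pi.single i 1 - Pi.single j 1 : V) := by rw [hw]; rfl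
      rw [this, dotProduct_smul, dotProduct_sub, dotProduct_single, dotProduct_single, smul_eq_mul, mul_one, mul_one]
    have h5 := hy i
    have h6 := hy j
    omega
  have hev : ∀ i ∈ T, 2 ∣ y i := by
    by_contra! h
    obtain ⟨i, hi, h⟩ := h
    have h1 : ∀ j ∈ T, 1 ≤ y j ^ 2 := by
      intro j hj
      have h2 := hpar i hi j hj
      have : y j ≠ 0 := by omega
      have := sq_pos_of_ne_zero this
      omega
    have h2 := Finset.card_nsmul_le_sum T (fun j => y j ^ 2) 1 h1
    rw [hT, hsq] at h2
    simp at h2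
  obtain ⟨i, hi, hi0⟩ : ∃ i ∈ T, y i ^ 2 ≠ 0 := by
    apply Finset.exists_ne_zero_of_sum_ne_zero
    rw [hsq]; norm_num
  have hi0' : y i ≠ 0 := fun h => hi0 (by rw [h]; rfl)
  rw [← Finset.add_sum_erase T _ hi] at hsq
  have hrest : 0 ≤ ∑ j ∈ T.erase i, y j ^ 2 := Finset.sum_nonneg fun j _ => sq_nonneg _
  obtain ⟨z, hz⟩ := hev i hi
  have hz0 : 1 ≤ z ^ 2 := by
    have : z ≠ 0 := by rintro rfl; exact hi0' (by rw [hz]; rfl)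
    have := sq_pos_of_ne_zero this
    omega
  have hz1 : z ^ 2 = 1 := by
    rw [hz] at hsq
    have : (2 * z) ^ 2 = 4 * z ^ 2 := by ring
    omega
  have hr0 : ∑ j ∈ T.erase i, y j ^ 2 = 0 := by
    rw [hz] at hsq
    have : (2 * z) ^ 2 = 4 * z ^ 2 := by ring
    omega
  have hj0 : ∀ j, j ≠ i → coord Λ f v j = 0 := by
    intro j hj
    by_cases hjT : j ∈ T
    · have := (Finset.sum_eq_zero_iff_of_nonneg fun j _ => sq_nonneg (y j)).mp hr0 j (Finset.mem_erase.mpr ⟨hj, hjT⟩)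
      rw [hy, pow_eq_zero_iff (by norm_num) |>.mp this, mul_zero]
    · exact hv0 j hjT
  refine ⟨i, hi, ?_⟩
  rcases sq_eq_one_iff.mp hz1 with h | h
  · left
    apply hf.frame.coord_injective
    rw [hf.frame.coord_frame]
    funext j
    by_cases hj : j = i
    · subst hj; rw [hy, hz, h, Pi.single_eq_same]; norm_num
    · rw [hj0 j hj, Pi.single_eq_of_ne hj]
  · right
    apply hf.frame.coord_injective
    rw [map_neg, hf.frame.coord_frame]
    funext j
    rw [Pi.neg_apply]
    by_cases hj : j = i
    · subst hj; rw [hy, hz, h, Pi.single_eq_same]; norm_num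
    · rw [hj0 j hj, Pi.single_eq_of_ne hj, neg_zero]

/-- frames in the same class differ by a signed permutation -/
lemma signed_perm (hΛ : IsLeech Λ) {f f' : Fin 24 → V} (hf : IsFrame Λ f) (hf' : IsFrame Λ f')
    (h : Λ.red (f' 0) = Λ.red (f 0)) :
    ∃ g : Equiv.Perm (Fin 24), ∀ i, f' i = f (g i) ∨ f' i = - f (g i) := by
  choose g hg using fun i => hf.eq_or_neg hΛ (hf'.self i) ((hf'.red i 0).trans h)
  have hinj : Function.Injective g := by
    intro i j hij
    by_contra hne
    have h0 := hf'.orth i j hne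
    rcases hg i with h1 | h1 <;> rcases hg j with h2 | h2 <;> rw [h1, h2, hij] at h0 <;>
      simp [hf.self] at h0
  exact ⟨Equiv.ofBijective g (Finite.injective_iff_bijective.mp hinj), hg⟩

lemma autEquiv_of_m24 {f : Fin 24 → V} {C : Submodule (ZMod 2) W} (hf : IsGood Λ f C)
    {S T : Finset (Fin 24)} (h : M24Equiv C S T) : AutEquiv Λ (NT Λ f S) (NT Λ f T) := by
  obtain ⟨g, hg, rfl⟩ := m24_iff.mp h
  have hf' := hf.perm g
  rw [show pull g⁻¹ C = C from hg.inv] at hf'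
  obtain ⟨e, he, hef⟩ := hf.exists_isom hf'
  refine autEquiv_iff.mpr ⟨e, he, ?_⟩
  rw [NT_isom he]
  simp only [hef]
  exact NT_perm g S

lemma m24_of_autEquiv (hΛ : IsLeech Λ) {f : Fin 24 → V} {C : Submodule (ZMod 2) W} (hf : IsGood Λ f C)
    {S T : Finset (Fin 24)} (hS : S.card = 12) (hT : T.card = 12)
    (h : AutEquiv Λ (NT Λ f S) (NT Λ f T)) : M24Equiv C S T := by
  obtain ⟨e, he, heq⟩ := autEquiv_iff.mp h
  have key : ∀ i ∈ S, ∃ j ∈ T, e (f i) = f j ∨ e (f i) = - f j := by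
    intro i hi
    apply frame_vec hf hT
    · rw [← heq]; exact Submodule.mem_map_of_mem ((frame_mem_NT hf.frame).mpr hi)
    · rw [he, hf.frame.self]
    · intro w hw
      rw [← heq] at hw
      obtain ⟨u, hu, rfl⟩ := Submodule.mem_map.mp hw
      rw [LinearEquiv.coe_coe, he]
      exact frame_dvd i u hu
  have hSne : S.Nonempty := by rw [← Finset.card_pos]; omega
  have hred : Λ.red (e (f 0)) = Λ.red (f 0) := by
    obtain ⟨i, hi⟩ := hSne
    obtain ⟨j, -, hj⟩ := key i hi
    rw [red_map e (hf.frame.red 0 i)]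
    rcases hj with hj | hj <;> rw [hj]
    · exact hf.frame.red _ _
    · rw [red_neg]; exact hf.frame.red _ _
  obtain ⟨g, hg⟩ := signed_perm hΛ hf.frame (hf.frame.isom he) hred
  have hC : C = pull g⁻¹ C := code_eq (hf.isom he) (hf.perm g) hg
  have hA : IsAut C g := by
    have : IsAut C g⁻¹ := hC.symm
    simpa using this.inv
  refine m24_iff.mpr ⟨g, hA, Finset.eq_of_subset_of_card_le ?_ ?_⟩
  · intro k hk
    obtain ⟨i, hi, rfl⟩ := Finset.mem_image.mp hk
    obtain ⟨j, hj, h⟩ := key i hi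
    have : g i = j := by
      by_contra hne
      have h0 := hf.frame.orth _ _ hne
      have h1 := hf.frame.self (g i)
      rcases h with h | h <;> rcases hg i with h2 | h2 <;> rw [h2] at h
      · rw [← h, h1] at h0; omega
      · rw [← h, map_neg, h1] at h0; omega
      · rw [← neg_eq_iff_eq_neg.mpr h, map_neg, h1] at h0; omega
      · rw [← neg_injective h, h1] at h0; omega
    rw [this]; exact hj
  · rw [Finset.card_image_of_injective _ g.injective, hS, hT]

end FiveOrbits
end

section
open Matrix

namespace FiveOrbits

variable {Λ : EvenUnimodularLattice 24}

lemma isD12_NT {f : Fin 24 → V} {C : Submodule (ZMod 2) W} (hf : IsGood Λ f C) {T : Finset (Fin 24)}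
    (hT : T.card = 12) : IsD12TwoSublattice Λ (NT Λ f T) := by
  let t : Fin 12 → Fin 24 := T.orderEmbOfFin hT
  have ht : Function.Injective t := (T.orderEmbOfFin hT).injective
  have htT : ∀ i, i ∈ T ↔ ∃ j, t j = i := by
    intro i
    rw [← Finset.mem_coe, ← T.range_orderEmbOfFin hT]
    exact Set.mem_range
  -- extension by zero
  let ext : (Fin 12 → ℤ) → V := fun x i => ∑ j, if t j = i then x j else 0
  have ext_t : ∀ x j, ext x (t j) = x j := by
    intro x j
    simp only [ext, ht.eq_iff]
    simp
  have ext_0 : ∀ x i, i ∉ T → ext x i = 0 := by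
    intro x i hi
    apply Finset.sum_eq_zero
    intro j _
    rw [if_neg]
    intro h
    exact hi ((htT i).mpr ⟨j, h⟩)
  have ext_sum : ∀ x, ∑ i, ext x i = ∑ j, x j := by
    intro x
    simp only [ext]
    rw [Finset.sum_comm]
    simp
  have h1 : ∀ x : D12, ∃ v, coord Λ f v = fun i => 4 * ext x i := fun x =>
    hf.exists_four _ (by rw [ext_sum]; exact x.2)
  choose φ hφ using h1
  have ext_add : ∀ x y, ext (x + y) = ext x + ext y := by
    intro x y; funext i
    simp only [ext, Pi.add_apply, ← Finset.sum_add_distrib]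
    refine Finset.sum_congr rfl fun j _ => ?_
    split_ifs <;> simp
  have ext_smul : ∀ (a : ℤ) x, ext (a • x) = a • ext x := by
    intro a x; funext i
    simp only [ext, Pi.smul_apply, Finset.smul_sum]
    refine Finset.sum_congr rfl fun j _ => ?_
    split_ifs <;> simp
  let φ' : D12 →ₗ[ℤ] V :=
    { toFun := φ
      map_add' := fun x y => by
        apply hf.frame.coord_injective
        rw [map_add, hφ, hφ, hφ, Submodule.coe_add, ext_add]
        funext i
        simp only [Pi.add_apply]; ring
      map_smul' := fun a x => by
        apply hf.frame.coord_injective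
        rw [map_smul, hφ, hφ, Submodule.coe_smul, ext_smul]
        funext i
        simp only [Pi.smul_apply, smul_eq_mul, RingHom.id_apply]; ring }
  have hφ' : ∀ x, coord Λ f (φ' x) = fun i => 4 * ext x i := hφ
  refine ⟨φ', ?_, ?_, ?_⟩
  · intro x y h
    apply Subtype.ext
    funext j
    have h2 := congrFun (congrArg (coord Λ f) h) (t j)
    rw [hφ', hφ'] at h2
    simp only [ext_t] at h2
    omega
  · ext v
    constructor
    · rintro ⟨x, rfl⟩
      rw [mem_NT, hφ']
      exact ⟨fun i hi => by dsimp only; rw [ext_0 _ i hi, mul_zero], fun i => dvd_mul_right _ _⟩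
    · rintro ⟨h0, h4⟩
      choose y hy using h4
      have h2 := hf.sum_even hy
      have hext : ext (fun j => y (t j)) = y := by
        funext i
        by_cases hi : i ∈ T
        · obtain ⟨j, rfl⟩ := (htT i).mp hi
          rw [ext_t]
        · have h3 := h0 i hi
          rw [hy] at h3
          rw [ext_0 _ i hi]
          omega
      refine ⟨⟨fun j => y (t j), ?_⟩, ?_⟩
      · show 2 ∣ ∑ j, y (t j)
        rw [← ext_sum (fun j => y (t j)), hext]
        exact h2
      · apply hf.frame.coord_injective
        rw [hφ']
        funext i
        rw [hy]
        simp only [hext]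
  · intro x y
    rw [inner_eq_ip]
    have h2 := hf.frame.ip_coord (φ' x) (φ' y)
    have h3 : coord Λ f (φ' x) ⬝ᵥ coord Λ f (φ' y) = 16 * ((x : Fin 12 → ℤ) ⬝ᵥ (y : Fin 12 → ℤ)) := by
      rw [hφ', hφ', dotProduct, dotProduct, Finset.mul_sum]
      symm
      have : ∀ j, 16 * ((x : Fin 12 → ℤ) j * (y : Fin 12 → ℤ) j) = 4 * ext x (t j) * (4 * ext y (t j)) := by
        intro j; rw [ext_t, ext_t]; ring
      simp only [this]
      rw [← Finset.sum_image (s := Finset.univ) (g := t) (f := fun i => 4 * ext x i * (4 * ext y i))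
        (fun a _ b _ h => ht h)]
      apply Finset.sum_subset (Finset.subset_univ _)
      intro i _ hi
      rw [ext_0 _ i, mul_zero, zero_mul]
      intro h
      obtain ⟨j, rfl⟩ := (htT i).mp h
      exact hi (Finset.mem_image_of_mem t (Finset.mem_univ j))
    omega

lemma isD12_isom {N N' : Submodule ℤ V} (hN : IsD12TwoSublattice Λ N) (h : AutEquiv Λ N N') :
    IsD12TwoSublattice Λ N' := by
  obtain ⟨e, he, rfl⟩ := autEquiv_iff.mp h
  obtain ⟨φ, h1, rfl, h3⟩ := hN
  refine ⟨e.toLinearMap.comp φ, e.injective.comp h1, LinearMap.range_comp _ _, fun x y => ?_⟩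
  rw [← h3, inner_eq_ip, inner_eq_ip]
  exact he _ _

/-- twice a standard basis vector -/
def w2 (j : Fin 12) : D12 := ⟨Pi.single j 2, by
  show 2 ∣ ∑ i, (Pi.single j 2 : Fin 12 → ℤ) i
  simp⟩

/-- difference of two basis vectors -/
def dd (i j : Fin 12) : D12 := ⟨Pi.single i 1 - Pi.single j 1, by
  show 2 ∣ ∑ k, (Pi.single i 1 - Pi.single j 1 : Fin 12 → ℤ) k
  simp [Finset.sum_sub_distrib]⟩

theorem classify (hΛ : IsLeech Λ) {N : Submodule ℤ V} (hN : IsD12TwoSublattice Λ N) :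
    ∃ c ∈ frameClasses Λ, ∀ f C, IsGood Λ f C → (∀ i, Λ.red (f i) = c) →
      ∃ T : Finset (Fin 24), T.card = 12 ∧ N = NT Λ f T := by
  obtain ⟨φ, hinj, rfl, hip⟩ := hN
  simp only [inner_eq_ip] at hip
  have hxw : ∀ (x : D12) j, ip Λ (φ x) (φ (w2 j)) = 4 * (x : Fin 12 → ℤ) j := by
    intro x j
    rw [hip]
    show 2 * ((x : Fin 12 → ℤ) ⬝ᵥ Pi.single j 2) = _
    rw [dotProduct_single]; ring
  have hself : ∀ j, ip Λ (φ (w2 j)) (φ (w2 j)) = 8 := by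
    intro j
    rw [hxw]
    show 4 * (Pi.single j 2 : Fin 12 → ℤ) j = 8
    rw [Pi.single_eq_same]; norm_num
  have horth : ∀ i j, i ≠ j → ip Λ (φ (w2 i)) (φ (w2 j)) = 0 := by
    intro i j hij
    rw [hxw]
    show 4 * (Pi.single i 2 : Fin 12 → ℤ) j = 0
    rw [Pi.single_eq_of_ne hij.symm]; norm_num
  have hred : ∀ j, Λ.red (φ (w2 j)) = Λ.red (φ (w2 0)) := by
    intro j
    rw [red_eq_iff]
    refine ⟨φ (dd j 0), ?_⟩
    rw [← map_sub, ← map_smul]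
    congr 1
    apply Subtype.ext
    funext k
    show (Pi.single j 2 : Fin 12 → ℤ) k - (Pi.single 0 2 : Fin 12 → ℤ) k =
      2 * ((Pi.single j 1 : Fin 12 → ℤ) k - (Pi.single 0 1 : Fin 12 → ℤ) k)
    simp only [Pi.single_apply]
    split_ifs <;> norm_num
  refine ⟨Λ.red (φ (w2 0)), ?_, ?_⟩
  · rw [mem_frameClasses]
    exact ⟨φ (w2 0), (mem_cls Λ).mpr ⟨by rw [hself]; norm_num, rfl⟩⟩
  intro f C hf hfc
  choose t ht using fun j => hf.frame.eq_or_neg hΛ (hself j) ((hred j).trans (hfc 0).symm)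
  have htinj : Function.Injective t := by
    intro i j hij
    by_contra hne
    have h0 := horth i j hne
    rcases ht i with h1 | h1 <;> rcases ht j with h2 | h2 <;> rw [h1, h2, hij] at h0 <;>
      simp [hf.frame.self] at h0
  have hct : ∀ (x : D12) j, coord Λ f (φ x) (t j) = 4 * (x : Fin 12 → ℤ) j ∨
      coord Λ f (φ x) (t j) = - (4 * (x : Fin 12 → ℤ) j) := by
    intro x j
    rw [← hxw, coord_apply]
    rcases ht j with h | h <;> rw [h]
    · exact Or.inl rfl
    · right; rw [map_neg, neg_neg]
  have hc0 : ∀ (x : D12) i, i ∉ Finset.univ.image t → coord Λ f (φ x) i = 0 := by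
    intro x i hi
    have h2 : (2 : ℤ) • x = ∑ j, (x : Fin 12 → ℤ) j • w2 j := by
      apply Subtype.ext
      funext k
      rw [Submodule.coe_sum, Finset.sum_apply]
      show 2 * (x : Fin 12 → ℤ) k = ∑ j, (x : Fin 12 → ℤ) j * (Pi.single j 2 : Fin 12 → ℤ) k
      simp [Pi.single_apply, mul_comm]
    have h3 := congrArg (fun z => ip Λ (φ z) (f i)) h2
    simp only [map_sum, LinearMap.sum_apply] at h3
    rw [Finset.sum_eq_zero] at h3
    · rw [map_smul, map_smul, LinearMap.smul_apply, smul_eq_mul] at h3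
      rw [coord_apply]; omega
    · intro j _
      have hne : t j ≠ i := by
        rintro rfl; exact hi (Finset.mem_image_of_mem t (Finset.mem_univ j))
      rw [map_smul, map_smul, LinearMap.smul_apply, smul_eq_mul]
      rcases ht j with h | h <;> rw [h]
      · rw [hf.frame.orth _ _ hne, mul_zero]
      · rw [map_neg, LinearMap.neg_apply, hf.frame.orth _ _ hne, neg_zero, mul_zero]
  refine ⟨Finset.univ.image t, ?_, ?_⟩
  · rw [Finset.card_image_of_injective _ htinj]; simp
  ext v
  constructor
  · rintro ⟨x, rfl⟩
    refine ⟨hc0 x, fun i => ?_⟩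
    by_cases hi : i ∈ Finset.univ.image t
    · obtain ⟨j, -, rfl⟩ := Finset.mem_image.mp hi
      have := hct x j
      omega
    · rw [hc0 x i hi]; exact dvd_zero _
  · rintro ⟨h0, h4⟩
    choose y hy using h4
    have h2 := hf.sum_even hy
    have hsum : ∑ i, y i = ∑ j, y (t j) := by
      rw [← Finset.sum_image (s := Finset.univ) (g := t) (f := y) (fun a _ b _ h => htinj h)]
      symm
      apply Finset.sum_subset (Finset.subset_univ _)
      intro i _ hi
      have := h0 i hi
      rw [hy] at this
      omega
    -- signs
    have hs : ∀ j, ∃ s : ℤ, (s = 1 ∨ s = -1) ∧ φ (w2 j) = s • f (t j) := by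
      intro j
      rcases ht j with h | h
      · exact ⟨1, Or.inl rfl, by rw [h, one_smul]⟩
      · exact ⟨-1, Or.inr rfl, by rw [h, neg_smul, one_smul]⟩
    choose s hs1 hs2 using hs
    have hss : ∀ j, s j * s j = 1 := fun j => by rcases hs1 j with h | h <;> rw [h] <;> norm_num
    have hD : (fun j => s j * y (t j)) ∈ D12 := by
      show 2 ∣ ∑ j, s j * y (t j)
      rw [hsum] at h2
      have h3 : (2 : ℤ) ∣ ∑ j, s j * y (t j) - ∑ j, y (t j) := by
        rw [← Finset.sum_sub_distrib]
        apply Finset.dvd_sum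
        intro j _
        rcases hs1 j with h | h <;> rw [h] <;> omega
      omega
    refine ⟨⟨_, hD⟩, ?_⟩
    apply hf.frame.coord_injective
    funext i
    by_cases hi : i ∈ Finset.univ.image t
    · obtain ⟨j, -, rfl⟩ := Finset.mem_image.mp hi
      have h3 := hxw ⟨_, hD⟩ j
      rw [hs2, map_smul, smul_eq_mul] at h3
      rw [hy, coord_apply]
      dsimp only at h3
      calc _ = (s j * s j) * ip Λ (φ ⟨_, hD⟩) (f (t j)) := by rw [hss, one_mul]
        _ = s j * (4 * (s j * y (t j))) := by rw [mul_assoc, h3]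
        _ = (s j * s j) * (4 * y (t j)) := by ring
        _ = _ := by rw [hss, one_mul]
    · rw [hc0 _ i hi, h0 i hi]

theorem d12_orbits (hΛ : IsLeech Λ) : ∃ N : Fin 5 → Submodule ℤ (Fin 24 → ℤ),
      (∀ k, IsD12TwoSublattice Λ (N k)) ∧
      (∀ k l, k ≠ l → ¬ AutEquiv Λ (N k) (N l)) ∧
      (∀ N', IsD12TwoSublattice Λ N' → ∃ k, AutEquiv Λ (N k) N') ∧
      (∀ k, Nat.card {N' : Submodule ℤ (Fin 24 → ℤ) //
          AutEquiv Λ (N k) N'} = osz k * 8292375) := by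
  obtain ⟨c0, hc0⟩ := frameClasses_nonempty Λ hΛ
  obtain ⟨f, C, hf, hfc⟩ := exists_good hΛ hc0
  obtain ⟨S, hS1, hS2, hS3, hS4⟩ := m24_orbits hf.golay
  have hF : ∀ c : frameClasses Λ, ∃ f', IsGood Λ f' C ∧ ∀ i, Λ.red (f' i) = c :=
    fun c => exists_good' hΛ hf.golay c.2
  choose F hFg hFc using hF
  -- all frames are equivalent
  have hbase : ∀ c T, AutEquiv Λ (NT Λ f T) (NT Λ (F c) T) := by
    intro c T
    obtain ⟨e, he, hef⟩ := hf.exists_isom (hFg c)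
    refine autEquiv_iff.mpr ⟨e, he, ?_⟩
    rw [NT_isom he]
    simp only [hef]
  have hcl : ∀ N', IsD12TwoSublattice Λ N' → ∃ c T, T.card = 12 ∧ N' = NT Λ (F c) T := by
    intro N' hN'
    obtain ⟨c, hc, h⟩ := classify hΛ hN'
    obtain ⟨T, hT, h⟩ := h (F ⟨c, hc⟩) C (hFg _) (hFc _)
    exact ⟨⟨c, hc⟩, T, hT, h⟩
  refine ⟨fun k => NT Λ f (S k), fun k => isD12_NT hf (hS1 k), ?_, ?_, ?_⟩
  · intro k l hkl h
    exact hS2 k l hkl (m24_of_autEquiv hΛ hf (hS1 k) (hS1 l) h)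
  · intro N' hN'
    obtain ⟨c, T, hT, rfl⟩ := hcl N' hN'
    obtain ⟨k, hk⟩ := hS3 T hT
    exact ⟨k, AutEquiv.trans' (autEquiv_of_m24 hf hk) (hbase c T)⟩
  · intro k
    have hcard : Nat.card ({T : Finset (Fin 24) // M24Equiv C (S k) T} × frameClasses Λ) = osz k * 8292375 := by
      rw [Nat.card_prod, hS4, Nat.card_eq_fintype_card, Fintype.card_coe, card_frameClasses Λ hΛ]
    rw [← hcard]
    symm
    apply Nat.card_congr
    refine Equiv.ofBijective (fun p => ⟨NT Λ (F p.2) p.1.1,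
      AutEquiv.trans' (autEquiv_of_m24 hf p.1.2) (hbase p.2 p.1.1)⟩) ⟨?_, ?_⟩
    · rintro ⟨⟨T, hT⟩, c⟩ ⟨⟨T', hT'⟩, c'⟩ h
      have h : NT Λ (F c) T = NT Λ (F c') T' := congrArg Subtype.val h
      have hTc : T.card = 12 := (M24.card hT).symm.trans (hS1 k)
      have hTc' : T'.card = 12 := (M24.card hT').symm.trans (hS1 k)
      obtain ⟨i, hi⟩ : T.Nonempty := by rw [← Finset.card_pos]; omega
      have hcc : c = c' := by
        obtain ⟨j, -, hj⟩ := frame_vec (hFg c') hTc' (v := F c i)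
          (by rw [← h]; exact (frame_mem_NT (hFg c).frame).mpr hi) ((hFg c).frame.self i)
          (by rw [← h]; exact frame_dvd i)
        apply Subtype.ext
        rw [← hFc c i, ← hFc c' j]
        rcases hj with hj | hj <;> rw [hj]
        rw [red_neg]
      subst hcc
      have : T = T' := by
        ext j
        rw [← frame_mem_NT (hFg c).frame, h, frame_mem_NT (hFg c).frame]
      subst this
      rfl
    · rintro ⟨N', hN'⟩
      obtain ⟨c, T, hT, rfl⟩ := hcl N' (isD12_isom (isD12_NT hf (hS1 k)) hN')
      have h := m24_of_autEquiv hΛ hf (hS1 k) hT (AutEquiv.trans' hN' (AutEquiv.symm' (hbase c T)))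
      exact ⟨⟨⟨T, h⟩, c⟩, rfl⟩

end FiveOrbits
end

/-- `M₂₄` has exactly five orbits on the 12-element subsets of the
24 points (special, extraspecial, umbral, transverse, penumbral dodecads); hence
`Aut(Λ)`, `Λ` the Leech lattice, has exactly five orbits of sublattices isomorphic to
`D₁₂(2)`, of sizes `2²·5·7·11·23·n_F`, `2⁴·3²·5·7·11·23·n_F`, `2⁶·3²·7·11·23·n_F`,
`2⁸·3²·7·23·n_F` and `2⁴·7·23·n_F`, where `n_F = 8292375` is the number of frames. -/
theorem five_orbits_of_dodecads_and_D12_sublattices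
    (Λ : EvenUnimodularLattice 24) (hΛ : IsLeech Λ)
    (C : Submodule (ZMod 2) (Fin 24 → ZMod 2)) (hC : IsGolayCode C)
    (o : Fin 5 → ℕ)
    (ho : o = ![2^2*5*7*11*23, 2^4*3^2*5*7*11*23, 2^6*3^2*7*11*23,
                2^8*3^2*7*23, 2^4*7*23])
    (nF : ℕ) (hnF : nF = 8292375) :
    (∃ S : Fin 5 → Finset (Fin 24),
      (∀ k, (S k).card = 12) ∧
      (∀ k l, k ≠ l → ¬ M24Equiv C (S k) (S l)) ∧
      (∀ T : Finset (Fin 24), T.card = 12 → ∃ k, M24Equiv C (S k) T) ∧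
      (∀ k, Nat.card {T : Finset (Fin 24) // M24Equiv C (S k) T} = o k)) ∧
    (∃ N : Fin 5 → Submodule ℤ (Fin 24 → ℤ),
      (∀ k, IsD12TwoSublattice Λ (N k)) ∧
      (∀ k l, k ≠ l → ¬ AutEquiv Λ (N k) (N l)) ∧
      (∀ N', IsD12TwoSublattice Λ N' → ∃ k, AutEquiv Λ (N k) N') ∧
      (∀ k, Nat.card {N' : Submodule ℤ (Fin 24 → ℤ) //
          AutEquiv Λ (N k) N'} = o k * nF)) := by
  subst hnF ho
  exact ⟨FiveOrbits.m24_orbits hC, FiveOrbits.d12_orbits hΛ⟩
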